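/- Order-type Theorem: let λ be the supremum of the writable ordinals. Then the order type of the set of clockable ordinals (under the usual ordering of ordinals) equals the order type of the set of writable ordinals, and both equal λ; moreover λ is neither clockable nor writable, but λ is eventually writable. -/

import Mathlib

open scoped Classical

namespace ITTM

/-- A real is an element of Cantor space. -/
abbrev R := ℕ → Bool

/-- The constant-zero real. -/
def zeroR : R := fun _ => false

/-- The real ⟨1,0,0,...⟩ coding the answer "Yes". -/
def oneR : R := fun n => decide (n = 0)

/-- The real coding a natural number `p`: `p` ones followed by zeros. -/
def natR (p : ℕ) : R := fun n => decide (n < p)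

/-- The real coding the pair of reals `(y, z)`. -/
def pairR (y z : R) : R := fun n => if n % 2 = 0 then y (n / 2) else z (n / 2)

/-- A snapshot of an infinite time Turing machine computation with state set
`Fin (Q+1)`: the current state, the head position, and the contents of the
three tapes (tape 0 is the input tape, tape 1 the scratch tape, tape 2 the
output tape); cells hold values in `Bool` (`true` = 1, `false` = 0). -/
structure Snapshot (Q : ℕ) where
  state : Fin (Q + 1)
  head : ℕ
  tape : Fin 3 → ℕ → Bool

/-- An infinite time Turing machine program: a finite set of states
`Fin (Q+1)` with distinguished start, limit and halt states, and a finite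
transition table which, given the current state and the three cell values
read by the head, specifies the next state, the three values to write, and
the direction to move (`true` = right, `false` = left). -/
structure Machine where
  Q : ℕ
  start : Fin (Q + 1)
  limit : Fin (Q + 1)
  halt : Fin (Q + 1)
  trans : Fin (Q + 1) × (Fin 3 → Bool) → Fin (Q + 1) × (Fin 3 → Bool) × Bool

instance : Inhabited Machine := ⟨⟨0, 0, 0, 0, fun _ => (0, fun _ => false, true)⟩⟩

namespace Machine

/-- The initial snapshot on input `x`: head on cell 0 in the start state, `x`
on the input tape, the other tapes filled with zeros. -/
def init (M : Machine) (x : R) : Snapshot M.Q where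
  state := M.start
  head := 0
  tape := fun i n => if i = 0 then x n else false

/-- One step of computation applied to a snapshot. -/
def stepSnap (M : Machine) (s : Snapshot M.Q) : Snapshot M.Q :=
  let t := M.trans (s.state, fun i => s.tape i s.head)
  { state := t.1
    head := if t.2.2 then s.head + 1 else s.head - 1
    tape := fun i n => if n = s.head then t.2.1 i else s.tape i n }

/-- The snapshot of the computation of machine `M` on input `x` at ordinal
stage `α`, defined by transfinite recursion: at stage 0 the initial snapshot,
at successor stages the transition table is applied, and at limit stages the
head is on cell 0 in the limit state and each cell holds the `limsup` of its
earlier values (1 iff its value was 1 cofinally often below the limit). -/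
noncomputable def snap (M : Machine) (x : R) : Ordinal.{0} → Snapshot M.Q :=
  WellFounded.fix Ordinal.lt_wf fun α ih =>
    if _h0 : α = 0 then M.init x
    else if hs : ∃ β, β < α ∧ α = β + 1 then
      M.stepSnap (ih hs.choose hs.choose_spec.1)
    else
      { state := M.limit
        head := 0
        tape := fun i n =>
          decide (∀ β < α, ∃ γ, β ≤ γ ∧ ∃ hγ : γ < α, (ih γ hγ).tape i n = true) }

/-- The machine is in the halt state at stage `α`. -/
def haltedAt (M : Machine) (x : R) (α : Ordinal) : Prop :=
  (M.snap x α).state = M.halt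

/-- The computation of `M` on input `x` halts exactly at stage `α`: stage `α`
is the first stage at which the machine is in the halt state. -/
def haltsAt (M : Machine) (x : R) (α : Ordinal) : Prop :=
  M.haltedAt x α ∧ ∀ β < α, ¬ M.haltedAt x β

/-- The computation of `M` on input `x` halts. -/
def halts (M : Machine) (x : R) : Prop := ∃ α, M.haltedAt x α

/-- The computation of `M` on input `x` halts with output `y`: at the first
stage at which the machine is in the halt state, the output tape reads `y`. -/
def outputs (M : Machine) (x y : R) : Prop :=
  ∃ α, M.haltsAt x α ∧ (M.snap x α).tape 2 = y

end Machine

/-- Machines are coded by natural numbers. -/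
noncomputable instance : Encodable Machine :=
  Encodable.ofEquiv
    (Σ Q : ℕ, (Fin (Q + 1) × Fin (Q + 1) × Fin (Q + 1)) ×
      ((Fin (Q + 1) × (Fin 3 → Bool)) → Fin (Q + 1) × (Fin 3 → Bool) × Bool))
    { toFun := fun M => ⟨M.Q, (M.start, M.limit, M.halt), M.trans⟩
      invFun := fun s => ⟨s.1, s.2.1.1, s.2.1.2.1, s.2.1.2.2, s.2.2⟩
      left_inv := fun _ => rfl
      right_inv := fun _ => rfl }

/-- The machine coded by the natural number `p`; every natural number codes a
machine, and every machine is coded by some natural number. -/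
noncomputable def prog (p : ℕ) : Machine :=
  ((Encodable.decode p : Option Machine)).getD default

/-- `φ_p(x)` halts with output `y`. -/
noncomputable def phiOutputs (p : ℕ) (x y : R) : Prop := (prog p).outputs x y

/-- A set of reals is infinite time decidable when some machine, on any input
`x`, halts with output ⟨1,0,0,...⟩ if `x ∈ A` and output ⟨0,0,0,...⟩ if
`x ∉ A`. -/
def ITTMDecidable (A : Set R) : Prop :=
  ∃ M : Machine, ∀ x : R, (x ∈ A → M.outputs x oneR) ∧ (x ∉ A → M.outputs x zeroR)

/-- A set of reals is infinite time semi-decidable when it is the halting set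
of some machine. -/
def ITTMSemiDecidable (A : Set R) : Prop :=
  ∃ M : Machine, A = {x : R | M.halts x}

/-- The binary relation on ℕ coded by the real `x`:
`n ◁ k ⟺ x(⟨n,k⟩) = 1` where `⟨·,·⟩` is the pairing function. -/
def rel (x : R) (n k : ℕ) : Prop := x (Nat.pair n k) = true

/-- The field of the relation coded by `x`. -/
def field (x : R) : Set ℕ := {n | ∃ k, rel x n k ∨ rel x k n}

/-- The relation coded by `x`, restricted to its field. -/
def relOn (x : R) : field x → field x → Prop := fun a b => rel x a.1 b.1

/-- The real `x` codes a well-order of (a subset of) ℕ, namely its field. -/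
def codesWellOrder (x : R) : Prop := IsWellOrder (field x) (relOn x)

/-- The set of reals coding well-orders. -/
def WO : Set R := {x | codesWellOrder x}

/-- The real `x` codes a well-order of order type `α`. -/
def codesOrdinal (x : R) (α : Ordinal) : Prop :=
  ∃ h : codesWellOrder x, @Ordinal.type _ (relOn x) h = α

/-- An ordinal is clockable when some machine on input 0 halts exactly at
stage `α`. -/
def Clockable (α : Ordinal) : Prop := ∃ M : Machine, M.haltsAt zeroR α

/-- A real is writable when it is the output of some machine on input 0. -/
def WritableReal (x : R) : Prop := ∃ M : Machine, M.outputs zeroR x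

/-- An ordinal is writable when some writable real codes a well-order of that
order type. -/
def WritableOrdinal (α : Ordinal) : Prop :=
  ∃ x : R, WritableReal x ∧ codesOrdinal x α

/-- A real is eventually writable when some machine on input 0 never halts,
but from some stage onward the content of its output tape is exactly `x`. -/
def EventuallyWritableReal (x : R) : Prop :=
  ∃ M : Machine, ¬ M.halts zeroR ∧ ∃ α : Ordinal, ∀ β ≥ α, (M.snap zeroR β).tape 2 = x

/-- An ordinal is eventually writable when some eventually writable real codes
a well-order of that order type. -/
def EventuallyWritableOrdinal (α : Ordinal) : Prop :=
  ∃ x : R, EventuallyWritableReal x ∧ codesOrdinal x α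

end ITTM

namespace ITTM

section

/-- The limit superior of a transfinite sequence of bits at stage `α`. -/
noncomputable def limsupBit (α : Ordinal.{0}) (f : Ordinal.{0} → Bool) : Bool :=
  decide (∀ β < α, ∃ γ, β ≤ γ ∧ γ < α ∧ f γ = true)

theorem limsupBit_eq_true {α : Ordinal.{0}} {f : Ordinal.{0} → Bool} :
    limsupBit α f = true ↔ ∀ β < α, ∃ γ, β ≤ γ ∧ γ < α ∧ f γ = true := by
  simp [limsupBit]

theorem limsupBit_congr {α : Ordinal.{0}} {f g : Ordinal.{0} → Bool}
    (h : ∀ γ < α, f γ = g γ) : limsupBit α f = limsupBit α g := by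
  rw [Bool.eq_iff_iff, limsupBit_eq_true, limsupBit_eq_true]
  constructor <;> intro H β hβ <;> obtain ⟨γ, h1, h2, h3⟩ := H β hβ <;>
    refine ⟨γ, h1, h2, ?_⟩
  · rw [← h γ h2, h3]
  · rw [h γ h2, h3]

theorem limsupBit_eq_of_eventually {α : Ordinal.{0}} {f : Ordinal.{0} → Bool} {b : Bool}
    {β : Ordinal.{0}} (hβ : β < α) (h : ∀ γ, β ≤ γ → γ < α → f γ = b) :
    limsupBit α f = b := by
  cases b
  · rw [← Bool.not_eq_true, limsupBit_eq_true]
    intro H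
    obtain ⟨γ, h1, h2, h3⟩ := H β hβ
    rw [h γ h1 h2] at h3
    cases h3
  · rw [limsupBit_eq_true]
    intro δ hδ
    exact ⟨max β δ, le_max_right _ _, max_lt hβ hδ, h _ (le_max_left _ _) (max_lt hβ hδ)⟩

theorem exists_add_nat_of_lt_add_omega0 {B γ : Ordinal.{0}} (h1 : B ≤ γ)
    (h2 : γ < B + Ordinal.omega0) : ∃ n : ℕ, γ = B + n := by
  obtain ⟨δ, rfl⟩ := exists_add_of_le h1
  obtain ⟨n, hn⟩ := Ordinal.lt_omega0.1 (lt_of_add_lt_add_left h2)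
  exact ⟨n, by rw [hn]⟩

theorem add_nat_lt_add_omega0 (B : Ordinal.{0}) (n : ℕ) : B + n < B + Ordinal.omega0 := by
  gcongr
  exact Ordinal.natCast_lt_omega0 n

theorem limsupBit_add_omega0 {B : Ordinal.{0}} {f : Ordinal.{0} → Bool} :
    limsupBit (B + Ordinal.omega0) f = true ↔ ∀ n : ℕ, ∃ m : ℕ, n ≤ m ∧ f (B + m) = true := by
  rw [limsupBit_eq_true]
  constructor
  · intro H n
    obtain ⟨γ, h1, h2, h3⟩ := H (B + n) (add_nat_lt_add_omega0 B n)
    obtain ⟨m, rfl⟩ := exists_add_nat_of_lt_add_omega0 (le_self_add.trans h1) h2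
    refine ⟨m, ?_, h3⟩
    exact_mod_cast le_of_add_le_add_left h1
  · intro H β hβ
    rcases lt_or_ge β B with h | h
    · obtain ⟨m, -, hm⟩ := H 0
      exact ⟨B + m, h.le.trans le_self_add, add_nat_lt_add_omega0 B m, hm⟩
    · obtain ⟨n, rfl⟩ := exists_add_nat_of_lt_add_omega0 h hβ
      obtain ⟨m, h1, hm⟩ := H n
      refine ⟨B + m, ?_, add_nat_lt_add_omega0 B m, hm⟩
      gcongr

namespace Machine

theorem snap_zero (M : Machine) (x : R) : M.snap x 0 = M.init x := by
  rw [snap, WellFounded.fix_eq]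
  simp

theorem snap_succ (M : Machine) (x : R) (α : Ordinal.{0}) :
    M.snap x (α + 1) = M.stepSnap (M.snap x α) := by
  have hs : ∃ β, β < α + 1 ∧ α + 1 = β + 1 := ⟨α, lt_add_one α, rfl⟩
  have hc : hs.choose = α := (Order.succ_injective hs.choose_spec.2).symm
  conv_lhs => rw [snap, WellFounded.fix_eq]
  rw [dif_neg (by simp), dif_pos hs]
  change M.stepSnap (M.snap x hs.choose) = _
  rw [hc]

theorem snap_limit (M : Machine) (x : R) {α : Ordinal.{0}} (h : Order.IsSuccLimit α) :
    M.snap x α = ⟨M.limit, 0, fun i n => limsupBit α fun γ => (M.snap x γ).tape i n⟩ := by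
  have hs : ¬ ∃ β, β < α ∧ α = β + 1 := by
    rintro ⟨β, -, rfl⟩
    simp at h
  conv_lhs => rw [snap, WellFounded.fix_eq]
  rw [dif_neg (by rintro rfl; exact Ordinal.not_isSuccLimit_zero h), dif_neg hs]
  congr 1
  funext i n
  rw [limsupBit]
  simp only [exists_prop]
  rfl

end Machine

/-- A machine with an arbitrary finite set of states and with its three tapes kept apart. -/
structure TM (σ : Type) where
  start : σ
  limit : σ
  halt : σ
  trans : σ → Bool → Bool → Bool → σ × (Bool × Bool × Bool) × Bool

/-- A configuration of a `TM`. -/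
structure Conf (σ : Type) where
  state : σ
  head : ℕ
  t0 : ℕ → Bool
  t1 : ℕ → Bool
  t2 : ℕ → Bool

namespace TM

variable {σ : Type}

/-- One step of computation of a `TM`. -/
def step (M : TM σ) (c : Conf σ) : Conf σ :=
  let t := M.trans c.state (c.t0 c.head) (c.t1 c.head) (c.t2 c.head)
  ⟨t.1, if t.2.2 then c.head + 1 else c.head - 1, Function.update c.t0 c.head t.2.1.1,
    Function.update c.t1 c.head t.2.1.2.1, Function.update c.t2 c.head t.2.1.2.2⟩

theorem exists_equiv_fin (σ : Type) [Finite σ] [Nonempty σ] : ∃ Q, Nonempty (σ ≃ Fin (Q + 1)) := by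
  refine ⟨Nat.card σ - 1, ?_⟩
  rw [Nat.sub_add_cancel Nat.card_pos]
  exact ⟨Finite.equivFin σ⟩

/-- A machine over a finite set of states is simulated step by step by a `Machine`. -/
theorem exists_machine [Finite σ] (M : TM σ) :
    ∃ (N : Machine) (conf : Ordinal.{0} → Conf σ),
      (∀ α, N.haltedAt zeroR α ↔ (conf α).state = M.halt) ∧
      (∀ α, (N.snap zeroR α).tape 2 = (conf α).t2) ∧
      conf 0 = ⟨M.start, 0, fun _ => false, fun _ => false, fun _ => false⟩ ∧
      (∀ α, conf (α + 1) = M.step (conf α)) ∧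
      (∀ α, Order.IsSuccLimit α → conf α = ⟨M.limit, 0,
        fun n => limsupBit α fun γ => (conf γ).t0 n,
        fun n => limsupBit α fun γ => (conf γ).t1 n,
        fun n => limsupBit α fun γ => (conf γ).t2 n⟩) := by
  have : Nonempty σ := ⟨M.start⟩
  obtain ⟨Q, ⟨e⟩⟩ := exists_equiv_fin σ
  let N : Machine :=
    { Q := Q
      start := e M.start
      limit := e M.limit
      halt := e M.halt
      trans := fun p =>
        let t := M.trans (e.symm p.1) (p.2 0) (p.2 1) (p.2 2)
        (e t.1, ![t.2.1.1, t.2.1.2.1, t.2.1.2.2], t.2.2) }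
  let cv : Snapshot Q → Conf σ := fun s => ⟨e.symm s.state, s.head, s.tape 0, s.tape 1, s.tape 2⟩
  have hstep : ∀ s : Snapshot Q, cv (N.stepSnap s) = M.step (cv s) := by
    intro s
    simp only [cv, N, Machine.stepSnap, step, Equiv.symm_apply_apply, Conf.mk.injEq]
    refine ⟨trivial, trivial, ?_, ?_, ?_⟩ <;> funext n <;> simp [Function.update_apply]
  refine ⟨N, fun α => cv (N.snap zeroR α), fun α => ?_, fun α => rfl, ?_, fun α => ?_, fun α h => ?_⟩
  · change (N.snap zeroR α).state = e M.halt ↔ e.symm (N.snap zeroR α).state = M.halt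
    rw [Equiv.symm_apply_eq]
  · beta_reduce
    rw [Machine.snap_zero]
    simp [cv, N, Machine.init, zeroR]
  · beta_reduce
    rw [Machine.snap_succ, hstep]
  · beta_reduce
    conv_lhs => rw [Machine.snap_limit N _ h]
    simp [cv, N]

end TM

end

section

/-- The contents of the memory of a register machine: registers, a random access bit array `D`,
an output pointer `P` and an output array `O`. -/
structure Store where
  regs : ℕ → ℕ
  D : ℕ → Bool
  P : ℕ
  O : ℕ → Bool

/-- Instructions of the register machine. -/
inductive Instr where
  /-- Increment a register. -/
  | inc (r : ℕ)
  /-- Decrement a register, or jump if it is zero. -/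
  | dec (r z : ℕ)
  /-- Jump if the bit of `D` addressed by a register is set. -/
  | rd (r t : ℕ)
  /-- Write a bit of `D` addressed by a register. -/
  | wr (r : ℕ) (b : Bool)
  /-- Increment the output pointer. -/
  | incP
  /-- Set the bit of `O` at the output pointer, and reset the pointer. -/
  | out
  | jmp (t : ℕ)
  | halt

/-- The register used by an instruction. -/
def Instr.reg : Instr → ℕ
  | inc r => r
  | dec r _ => r
  | rd r _ => r
  | wr r _ => r
  | _ => 0

/-- One step of the register machine: the program counter and store before and after. -/
inductive IStep (pr : List Instr) : ℕ × Store → ℕ × Store → Prop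
  | inc {pc s r} (h : pr[pc]? = some (.inc r)) :
      IStep pr (pc, s) (pc + 1, { s with regs := Function.update s.regs r (s.regs r + 1) })
  | decZero {pc s r z} (h : pr[pc]? = some (.dec r z)) (h0 : s.regs r = 0) :
      IStep pr (pc, s) (z, s)
  | decSucc {pc s r z k} (h : pr[pc]? = some (.dec r z)) (h0 : s.regs r = k + 1) :
      IStep pr (pc, s) (pc + 1, { s with regs := Function.update s.regs r k })
  | rd {pc s r t} (h : pr[pc]? = some (.rd r t)) :
      IStep pr (pc, s) (if s.D (s.regs r) then t else pc + 1, s)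
  | wr {pc s r b} (h : pr[pc]? = some (.wr r b)) :
      IStep pr (pc, s) (pc + 1, { s with D := Function.update s.D (s.regs r) b })
  | incP {pc s} (h : pr[pc]? = some .incP) :
      IStep pr (pc, s) (pc + 1, { s with P := s.P + 1 })
  | out {pc s} (h : pr[pc]? = some .out) :
      IStep pr (pc, s) (pc + 1, { s with P := 0, O := Function.update s.O s.P true })
  | jmp {pc s t} (h : pr[pc]? = some (.jmp t)) : IStep pr (pc, s) (t, s)

/-- States of the machine executing a register machine program on interleaved tracks. -/
inductive RState (N K : ℕ) where
  | lim
  | halt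
  | clean (off : ZMod K)
  | go (pc : Fin (N + 1)) (off : ZMod K)
  | back (pc : Fin (N + 1)) (off : ZMod K)
  | ret (pc : Fin (N + 1)) (off : ZMod K)
  | retc (pc : Fin (N + 1)) (off : ZMod K)

instance (N K : ℕ) [NeZero K] : Finite (RState N K) := by
  let f : RState N K → Fin 7 × Fin (N + 1) × ZMod K := fun s =>
    match s with
    | .lim => (0, 0, 0)
    | .halt => (1, 0, 0)
    | .clean o => (2, 0, o)
    | .go p o => (3, p, o)
    | .back p o => (4, p, o)
    | .ret p o => (5, p, o)
    | .retc p o => (6, p, o)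
  refine Finite.of_injective f ?_
  intro a b h
  cases a <;> cases b <;> simp [f] at h ⊢ <;> exact h

section Trans

variable (pr : List Instr) (K : ℕ)

/-- The program counter as a component of the state. -/
def pcState (pc : ℕ) : Fin (pr.length + 1) := Fin.ofNat _ pc

/-- The transition table of the machine executing the program `pr`. -/
def rtrans : RState pr.length K → Bool → Bool → Bool →
    RState pr.length K × (Bool × Bool × Bool) × Bool
  | .halt, b0, b1, b2 => (.halt, (b0, b1, b2), true)
  | .clean o, _, b1, b2 => (.clean (o + 1), (false, if o = 1 then b1 else false, b2), true)
  | .lim, b0, b1, b2 =>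
    if b1 then (.clean 1, (false, false, b2), true)
    else (.go 0 0, (b0, true, b2), false)
  | .go pc o, b0, b1, b2 =>
    match pr[pc.val]? with
    | some (.inc r) =>
      if o = (r : ZMod K) + 2 ∧ b1 = false then
        (.ret (pcState pr (pc.val + 1)) (o + 1), (b0, true, b2), true)
      else (.go pc (o + 1), (b0, b1, b2), true)
    | some (.dec r _) =>
      if o = (r : ZMod K) + 2 ∧ b1 = false then (.back pc (o - 1), (b0, b1, b2), false)
      else (.go pc (o + 1), (b0, b1, b2), true)
    | some (.rd r _) =>
      if o = (r : ZMod K) + 2 ∧ b1 = false then (.back pc (o - 1), (b0, b1, b2), false)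
      else (.go pc (o + 1), (b0, b1, b2), true)
    | some (.wr r _) =>
      if o = (r : ZMod K) + 2 ∧ b1 = false then (.back pc (o - 1), (b0, b1, b2), false)
      else (.go pc (o + 1), (b0, b1, b2), true)
    | some .incP =>
      if b0 = false then (.ret (pcState pr (pc.val + 1)) (o + 1), (true, b1, b2), true)
      else (.go pc (o + 1), (b0, b1, b2), true)
    | some .out =>
      if b0 = false then (.retc (pcState pr (pc.val + 1)) (o + 1), (b0, b1, true), true)
      else (.go pc (o + 1), (b0, b1, b2), true)
    | some (.jmp t) => (.go (pcState pr t) 0, (b0, b1, b2), false)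
    | _ => (.halt, (b0, b1, b2), true)
  | .back pc o, b0, b1, b2 =>
    match pr[pc.val]? with
    | some (.dec r z) =>
      if o = (r : ZMod K) + 2 then
        (.ret (pcState pr (pc.val + 1)) (o + 1), (b0, false, b2), true)
      else if o = 0 ∧ b1 = true then (.go (pcState pr z) 0, (b0, b1, b2), false)
      else (.back pc (o - 1), (b0, b1, b2), false)
    | some (.rd _ t) =>
      if o = 1 then
        (.ret (pcState pr (if b1 then t else pc.val + 1)) (o + 1), (b0, b1, b2), true)
      else (.back pc (o - 1), (b0, b1, b2), false)
    | some (.wr _ b) =>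
      if o = 1 then (.ret (pcState pr (pc.val + 1)) (o + 1), (b0, b, b2), true)
      else (.back pc (o - 1), (b0, b1, b2), false)
    | _ => (.halt, (b0, b1, b2), true)
  | .ret pc o, b0, b1, b2 =>
    if o = 0 ∧ b1 = true then (.go pc 0, (b0, b1, b2), false)
    else (.ret pc (o - 1), (b0, b1, b2), false)
  | .retc pc o, _, b1, b2 =>
    if o = 0 ∧ b1 = true then (.go pc 0, (false, b1, b2), false)
    else (.retc pc (o - 1), (false, b1, b2), false)

/-- The machine executing the program `pr` in passes of length `ω`. -/
def rtm : TM (RState pr.length K) := ⟨.clean 0, .lim, .halt, rtrans pr K⟩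

end Trans

/-- A unary number as the contents of a track. -/
def unary (P : ℕ) : ℕ → Bool := fun n => decide (n < P)

/-- The scratch tape: a marker track, the bit array `D`, and the registers in unary. -/
def scratch (K : ℕ) (regs : ℕ → ℕ) (D : ℕ → Bool) : ℕ → Bool := fun p =>
  if p % K = 0 then decide (p = 0) else if p % K = 1 then D (p / K)
  else decide (p / K < regs (p % K - 2))

/-- The configuration about to execute instruction `pc` on the store `s`. -/
def goConf (pr : List Instr) (K pc : ℕ) (s : Store) : Conf (RState pr.length K) :=
  ⟨.go (pcState pr pc) 0, 0, unary s.P, scratch K s.regs s.D, s.O⟩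

/-- The bit array stored on the scratch tape. -/
def dTrack (K : ℕ) (t : ℕ → Bool) : ℕ → Bool := fun i => t (K * i + 1)

/-- A step of a machine, not in the halt state and with bit array and output in `S`. -/
def GStep {N K : ℕ} (M : TM (RState N K)) (S : Set ((ℕ → Bool) × (ℕ → Bool)))
    (c c' : Conf (RState N K)) : Prop :=
  c.state ≠ .halt ∧ (dTrack K c.t1, c.t2) ∈ S ∧ M.step c = c'

section Scratch

variable {K : ℕ}

theorem scratch_zero {regs : ℕ → ℕ} {D : ℕ → Bool} : scratch K regs D 0 = true := by
  simp [scratch]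

theorem add_div_of_lt {i j : ℕ} (h : j < K) : (K * i + j) / K = i := by
  rw [Nat.mul_add_div (by omega), Nat.div_eq_of_lt h, add_zero]

theorem add_mod_of_lt {i j : ℕ} (h : j < K) : (K * i + j) % K = j := by
  rw [Nat.mul_add_mod, Nat.mod_eq_of_lt h]

theorem eq_mul_add {p j : ℕ} (h : p % K = j) : p = K * (p / K) + j := by
  rw [← h, Nat.div_add_mod]

theorem dTrack_scratch {regs : ℕ → ℕ} {D : ℕ → Bool} (hK : 2 ≤ K) :
    dTrack K (scratch K regs D) = D := by
  funext i
  simp [dTrack, scratch, add_div_of_lt (show 1 < K by omega), add_mod_of_lt (show 1 < K by omega)]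

theorem scratch_reg {regs : ℕ → ℕ} {D : ℕ → Bool} {r i : ℕ} (hr : r + 2 < K) :
    scratch K regs D (K * i + (r + 2)) = decide (i < regs r) := by
  simp [scratch, add_div_of_lt hr, add_mod_of_lt hr]

theorem scratch_update_reg {regs : ℕ → ℕ} {D : ℕ → Bool} {r i : ℕ} (hr : r + 2 < K) (b : Bool)
    {v : ℕ} (hb : ∀ j, (j < v ↔ if j = i then b = true else j < regs r)) :
    Function.update (scratch K regs D) (K * i + (r + 2)) b =
      scratch K (Function.update regs r v) D := by
  funext p
  simp only [Function.update_apply, scratch]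
  by_cases hp : p = K * i + (r + 2)
  · have h1 := hb i
    simp only [if_true] at h1
    subst hp
    simp [add_div_of_lt hr, add_mod_of_lt hr, h1]
  · rw [if_neg hp]
    by_cases h0 : p % K = 0
    · rw [if_pos h0, if_pos h0]
    by_cases h1 : p % K = 1
    · rw [if_neg h0, if_neg h0, if_pos h1, if_pos h1]
    rw [if_neg h0, if_neg h0, if_neg h1, if_neg h1]
    by_cases h2 : p % K - 2 = r
    · rw [if_pos h2]
      have h4 : p % K = r + 2 := by omega
      have h5 := hb (p / K)
      rw [if_neg] at h5
      · simp [h2, h5]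
      · rintro rfl
        exact hp (eq_mul_add h4)
    · rw [if_neg h2]

theorem scratch_update_D {regs : ℕ → ℕ} {D : ℕ → Bool} {i : ℕ} (hK : 2 ≤ K) (b : Bool) :
    Function.update (scratch K regs D) (K * i + 1) b = scratch K regs (Function.update D i b) := by
  have h1 : 1 < K := by omega
  funext p
  simp only [Function.update_apply, scratch]
  by_cases hp : p = K * i + 1
  · subst hp
    simp [add_div_of_lt h1, add_mod_of_lt h1]
  · rw [if_neg hp]
    refine if_congr Iff.rfl rfl ?_
    by_cases h2 : p % K = 1
    · rw [if_pos h2, if_pos h2, if_neg]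
      rintro rfl
      exact hp (eq_mul_add h2)
    · rw [if_neg h2, if_neg h2]

end Scratch

end

section

open Relation

section Exec

variable {pr : List Instr} {K : ℕ} {S : Set ((ℕ → Bool) × (ℕ → Bool))}

theorem natCast_eq_zero_iff_mod {m : ℕ} : (m : ZMod K) = 0 ↔ m % K = 0 := by
  rw [ZMod.natCast_eq_zero_iff, Nat.dvd_iff_mod_eq_zero]

theorem natCast_eq_iff_mod {m j : ℕ} (hj : j < K) : (m : ZMod K) = j ↔ m % K = j := by
  rw [ZMod.natCast_eq_natCast_iff', Nat.mod_eq_of_lt hj]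

theorem natCast_eq_one_iff_mod {m : ℕ} (hK : 2 ≤ K) : (m : ZMod K) = 1 ↔ m % K = 1 := by
  simpa using natCast_eq_iff_mod (K := K) (m := m) (j := 1) (by omega)

theorem natCast_eq_reg_iff_mod {m r : ℕ} (hr : r + 2 < K) :
    (m : ZMod K) = (r : ZMod K) + 2 ↔ m % K = r + 2 := by
  simpa using natCast_eq_iff_mod (K := K) (m := m) hr

theorem scan_up {M : TM (RState pr.length K)} {c : ℕ → Conf (RState pr.length K)} {a b : ℕ}
    (hab : a ≤ b) (h : ∀ m, a ≤ m → m < b → GStep M S (c m) (c (m + 1))) :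
    ReflTransGen (GStep M S) (c a) (c b) := by
  induction b, hab using Nat.le_induction with
  | base => exact .refl
  | succ b hb ih => exact (ih fun m h1 h2 => h m h1 (by omega)).tail (h b hb (by omega))

theorem scan_down {M : TM (RState pr.length K)} {c : ℕ → Conf (RState pr.length K)} {a b : ℕ}
    (hab : a ≤ b) (h : ∀ m, a ≤ m → m < b → GStep M S (c (m + 1)) (c m)) :
    ReflTransGen (GStep M S) (c b) (c a) := by
  induction b, hab using Nat.le_induction with
  | base => exact .refl
  | succ b hb ih => exact (ih fun m h1 h2 => h m h1 (by omega)).head (h b hb (by omega))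

theorem rtm_step {st st' : RState pr.length K} {hd : ℕ} {t0 t1 t2 : ℕ → Bool} {w0 w1 w2 d : Bool}
    (h : rtrans pr K st (t0 hd) (t1 hd) (t2 hd) = (st', (w0, w1, w2), d)) :
    (rtm pr K).step ⟨st, hd, t0, t1, t2⟩ = ⟨st', if d then hd + 1 else hd - 1,
      Function.update t0 hd w0, Function.update t1 hd w1, Function.update t2 hd w2⟩ := by
  simp [TM.step, rtm, h]

theorem rtm_step_right {st st' : RState pr.length K} {hd : ℕ} {t0 t1 t2 : ℕ → Bool}
    (h : rtrans pr K st (t0 hd) (t1 hd) (t2 hd) = (st', (t0 hd, t1 hd, t2 hd), true)) :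
    (rtm pr K).step ⟨st, hd, t0, t1, t2⟩ = ⟨st', hd + 1, t0, t1, t2⟩ := by
  rw [rtm_step h]; simp

theorem rtm_step_left {st st' : RState pr.length K} {hd : ℕ} {t0 t1 t2 : ℕ → Bool}
    (h : rtrans pr K st (t0 hd) (t1 hd) (t2 hd) = (st', (t0 hd, t1 hd, t2 hd), false)) :
    (rtm pr K).step ⟨st, hd, t0, t1, t2⟩ = ⟨st', hd - 1, t0, t1, t2⟩ := by
  rw [rtm_step h]; simp

theorem scratch_marker {regs : ℕ → ℕ} {D : ℕ → Bool} {m : ℕ} (h : m % K = 0) :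
    scratch K regs D m = decide (m = 0) := by
  simp [scratch, h]

/-- Returning to the left end of the tape. -/
theorem transGen_ret {s : Store} (hK : 2 ≤ K) (hS : (s.D, s.O) ∈ S) (pc m : ℕ) :
    TransGen (GStep (rtm pr K) S)
      ⟨.ret (pcState pr pc) (m : ZMod K), m, unary s.P, scratch K s.regs s.D, s.O⟩
      (goConf pr K pc s) := by
  refine TransGen.tail' (b := ⟨.ret (pcState pr pc) ((0 : ℕ) : ZMod K), 0, unary s.P,
    scratch K s.regs s.D, s.O⟩) ?_ ⟨by simp, by simpa [dTrack_scratch hK] using hS, ?_⟩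
  · refine scan_down (c := fun m => ⟨.ret (pcState pr pc) (m : ZMod K), m, unary s.P,
      scratch K s.regs s.D, s.O⟩) (Nat.zero_le m)
      fun m _ _ => ⟨by simp, by simpa [dTrack_scratch hK] using hS, ?_⟩
    rw [rtm_step_left (st' := .ret (pcState pr pc) (m : ZMod K))]
    · simp
    · simp only [rtrans]
      rw [if_neg]
      · simp
      · rintro ⟨h1, h2⟩
        rw [scratch_marker (natCast_eq_zero_iff_mod.1 h1)] at h2
        simp at h2
  · rw [rtm_step_left (st' := .go (pcState pr pc) 0)]
    · rfl
    · simp [rtrans, scratch_zero]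

theorem pcState_val {pc : ℕ} {ins : Instr} (h : pr[pc]? = some ins) :
    pr[(pcState pr pc).val]? = some ins := by
  obtain ⟨h1, -⟩ := List.getElem?_eq_some_iff.1 h
  rw [pcState, Fin.val_ofNat, Nat.mod_eq_of_lt (by omega), h]

theorem pcState_val_succ {pc : ℕ} {ins : Instr} (h : pr[pc]? = some ins) :
    pcState pr ((pcState pr pc).val + 1) = pcState pr (pc + 1) := by
  obtain ⟨h1, -⟩ := List.getElem?_eq_some_iff.1 h
  rw [pcState, pcState, Fin.val_ofNat, Nat.mod_eq_of_lt (a := pc) (by omega), pcState]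

/-- Scanning for the end of the unary representation of a register. -/
theorem go_scan_reg {s : Store} (hK : 2 ≤ K) (hS : (s.D, s.O) ∈ S) {pc r : ℕ} (hr : r + 2 < K)
    (hins : ∀ (o : ZMod K) b0 b1 b2, ¬ (o = (r : ZMod K) + 2 ∧ b1 = false) →
      rtrans pr K (.go (pcState pr pc) o) b0 b1 b2 =
        (.go (pcState pr pc) (o + 1), (b0, b1, b2), true)) :
    ReflTransGen (GStep (rtm pr K) S) (goConf pr K pc s)
      ⟨.go (pcState pr pc) ((K * s.regs r + (r + 2) : ℕ) : ZMod K), K * s.regs r + (r + 2),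
        unary s.P, scratch K s.regs s.D, s.O⟩ := by
  have := scan_up (S := S) (M := rtm pr K) (c := fun m => ⟨.go (pcState pr pc) (m : ZMod K), m,
      unary s.P, scratch K s.regs s.D, s.O⟩) (Nat.zero_le (K * s.regs r + (r + 2)))
      fun m _ hm => ⟨by simp, by simpa [dTrack_scratch hK] using hS, ?_⟩
  · simpa [goConf] using this
  rw [rtm_step_right (st' := .go (pcState pr pc) ((m + 1 : ℕ) : ZMod K))]
  rw [hins _ _ _ _ ?_]
  · simp
  rintro ⟨h1, h2⟩
  rw [natCast_eq_reg_iff_mod hr] at h1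
  rw [eq_mul_add h1, scratch_reg hr] at h2
  simp only [decide_eq_false_iff_not, not_lt] at h2
  have h3 := eq_mul_add h1
  have h4 := Nat.mul_le_mul_left K h2
  omega

/-- Scanning for the end of the output pointer. -/
theorem go_scan_P {s : Store} (hK : 2 ≤ K) (hS : (s.D, s.O) ∈ S) {pc : ℕ}
    (hins : ∀ (o : ZMod K) b1 b2,
      rtrans pr K (.go (pcState pr pc) o) true b1 b2 =
        (.go (pcState pr pc) (o + 1), (true, b1, b2), true)) :
    ReflTransGen (GStep (rtm pr K) S) (goConf pr K pc s)
      ⟨.go (pcState pr pc) (s.P : ZMod K), s.P, unary s.P, scratch K s.regs s.D, s.O⟩ := by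
  have := scan_up (S := S) (M := rtm pr K) (c := fun m => ⟨.go (pcState pr pc) (m : ZMod K), m,
      unary s.P, scratch K s.regs s.D, s.O⟩) (Nat.zero_le s.P)
      fun m _ hm => ⟨by simp, by simpa [dTrack_scratch hK] using hS, ?_⟩
  · simpa [goConf] using this
  have h : unary s.P m = true := by simpa [unary] using hm
  rw [rtm_step_right (st' := .go (pcState pr pc) ((m + 1 : ℕ) : ZMod K))]
  rw [h, hins]
  simp

/-- Walking back from the end of a register to an earlier cell. -/
theorem back_scan {s : Store} (hK : 2 ≤ K) (hS : (s.D, s.O) ∈ S) {pc a b : ℕ} (hab : a ≤ b)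
    (hins : ∀ m, a ≤ m → m < b →
      rtrans pr K (.back (pcState pr pc) ((m + 1 : ℕ) : ZMod K)) (unary s.P (m + 1))
        (scratch K s.regs s.D (m + 1)) (s.O (m + 1)) =
        (.back (pcState pr pc) (((m + 1 : ℕ) : ZMod K) - 1), (unary s.P (m + 1),
        scratch K s.regs s.D (m + 1), s.O (m + 1)), false)) :
    ReflTransGen (GStep (rtm pr K) S)
      ⟨.back (pcState pr pc) (b : ZMod K), b, unary s.P, scratch K s.regs s.D, s.O⟩
      ⟨.back (pcState pr pc) (a : ZMod K), a, unary s.P, scratch K s.regs s.D, s.O⟩ := by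
  refine scan_down (S := S) (M := rtm pr K) (c := fun m => ⟨.back (pcState pr pc) (m : ZMod K), m,
      unary s.P, scratch K s.regs s.D, s.O⟩) hab
      fun m h1 h2 => ⟨by simp, by simpa [dTrack_scratch hK] using hS, ?_⟩
  rw [rtm_step_left (hins m h1 h2)]
  simp

/-- From the end of a register walking back to a cell of the same block or below. -/
theorem go_scan_reg_back {s : Store} (hK : 2 ≤ K) (hS : (s.D, s.O) ∈ S) {pc r a : ℕ}
    (hr : r + 2 < K)
    (hins : ∀ (o : ZMod K) b0 b1 b2,
      rtrans pr K (.go (pcState pr pc) o) b0 b1 b2 =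
        if o = (r : ZMod K) + 2 ∧ b1 = false then
          (.back (pcState pr pc) (o - 1), (b0, b1, b2), false)
        else (.go (pcState pr pc) (o + 1), (b0, b1, b2), true))
    (ha : a < K * s.regs r + (r + 2))
    (hback : ∀ m, a < m → m < K * s.regs r + (r + 2) →
      rtrans pr K (.back (pcState pr pc) (m : ZMod K)) (unary s.P m)
        (scratch K s.regs s.D m) (s.O m) =
        (.back (pcState pr pc) ((m : ZMod K) - 1), (unary s.P m,
        scratch K s.regs s.D m, s.O m), false)) :
    ReflTransGen (GStep (rtm pr K) S) (goConf pr K pc s)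
      ⟨.back (pcState pr pc) (a : ZMod K), a, unary s.P, scratch K s.regs s.D, s.O⟩ := by
  refine (go_scan_reg hK hS hr (fun o b0 b1 b2 h => by rw [hins, if_neg h])).trans ?_
  refine ReflTransGen.head (b := ⟨.back (pcState pr pc) ((K * s.regs r + (r + 1) : ℕ) : ZMod K),
    K * s.regs r + (r + 1), unary s.P, scratch K s.regs s.D, s.O⟩)
    ⟨by simp, by simpa [dTrack_scratch hK] using hS, ?_⟩ ?_
  · rw [rtm_step_left (st' := .back (pcState pr pc) ((K * s.regs r + (r + 1) : ℕ) : ZMod K))]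
    · simp
    · rw [hins, if_pos]
      · simp only [Prod.mk.injEq, RState.back.injEq, true_and, and_true]
        push_cast
        ring
      · exact ⟨by simp, by simp [scratch_reg hr]⟩
  · exact back_scan hK hS (by omega) fun m h1 h2 => hback (m + 1) (by omega) (by omega)

theorem update_unary_succ {P : ℕ} : Function.update (unary P) P true = unary (P + 1) := by
  funext n
  by_cases h : n = P
  · subst h; simp [unary]
  · simp only [Function.update_of_ne h, unary, decide_eq_decide]
    omega

theorem transGen_inc {s : Store} (hK : 2 ≤ K) {pc r : ℕ} (hr : r + 2 < K)
    (h : pr[pc]? = some (.inc r)) (hS : (s.D, s.O) ∈ S) :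
    TransGen (GStep (rtm pr K) S) (goConf pr K pc s)
      (goConf pr K (pc + 1) { s with regs := Function.update s.regs r (s.regs r + 1) }) := by
  have hp := pcState_val h
  refine TransGen.trans_right (go_scan_reg hK hS hr (r := r) ?_) (TransGen.head
    ⟨by simp, by simpa [dTrack_scratch hK] using hS, ?_⟩
    (transGen_ret (s := { s with regs := Function.update s.regs r (s.regs r + 1) }) hK hS
      (pc + 1) (K * s.regs r + (r + 2) + 1)))
  · intro o b0 b1 b2 h1
    simp only [rtrans, hp, if_neg h1]
  · rw [rtm_step (st' := .ret (pcState pr (pc + 1)) ((K * s.regs r + (r + 2) + 1 : ℕ) : ZMod K))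
      (w0 := unary s.P (K * s.regs r + (r + 2))) (w1 := true)
      (w2 := s.O (K * s.regs r + (r + 2))) (d := true)]
    · rw [scratch_update_reg hr true (v := s.regs r + 1)]
      · simp
      · intro j
        split_ifs <;> simp <;> omega
    · simp only [rtrans, hp]
      rw [if_pos ⟨by simp, by simp [scratch_reg hr]⟩, pcState_val_succ h]
      simp

theorem transGen_decZero {s : Store} (hK : 2 ≤ K) {pc r z : ℕ} (hr : r + 2 < K)
    (h : pr[pc]? = some (.dec r z)) (h0 : s.regs r = 0) (hS : (s.D, s.O) ∈ S) :
    TransGen (GStep (rtm pr K) S) (goConf pr K pc s) (goConf pr K z s) := by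
  have hp := pcState_val h
  refine TransGen.tail' (go_scan_reg_back hK hS hr (r := r) (a := 0) ?_ (by omega) ?_)
    ⟨by simp, by simpa [dTrack_scratch hK] using hS, ?_⟩
  · intro o b0 b1 b2
    simp only [rtrans, hp]
  · intro m h1 h2
    rw [h0] at h2
    have h3 : m % K = m := Nat.mod_eq_of_lt (by omega)
    simp only [rtrans, hp]
    rw [if_neg, if_neg]
    · rw [natCast_eq_zero_iff_mod]; omega
    · rw [natCast_eq_reg_iff_mod hr]; omega
  · rw [rtm_step_left (st' := .go (pcState pr z) 0)]
    · rfl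
    · simp only [rtrans, hp]
      rw [if_neg, if_pos]
      · simp [scratch_zero]
      · rw [natCast_eq_reg_iff_mod hr]; simp

theorem transGen_decSucc {s : Store} (hK : 2 ≤ K) {pc r z k : ℕ} (hr : r + 2 < K)
    (h : pr[pc]? = some (.dec r z)) (h0 : s.regs r = k + 1) (hS : (s.D, s.O) ∈ S) :
    TransGen (GStep (rtm pr K) S) (goConf pr K pc s)
      (goConf pr K (pc + 1) { s with regs := Function.update s.regs r k }) := by
  have hp := pcState_val h
  refine TransGen.trans_right (go_scan_reg_back hK hS hr (r := r) (a := K * k + (r + 2)) ?_ ?_ ?_)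
    (TransGen.head ⟨by simp, by simpa [dTrack_scratch hK] using hS, ?_⟩
    (transGen_ret (s := { s with regs := Function.update s.regs r k }) hK hS
      (pc + 1) (K * k + (r + 2) + 1)))
  · intro o b0 b1 b2
    simp only [rtrans, hp]
  · rw [h0, mul_add]; omega
  · intro m h1 h2
    rw [h0, mul_add] at h2
    simp only [rtrans, hp]
    rw [if_neg, if_neg]
    · rintro ⟨h3, h4⟩
      rw [scratch_marker (natCast_eq_zero_iff_mod.1 h3)] at h4
      simp at h4
      omega
    · rw [natCast_eq_reg_iff_mod hr]
      intro h3
      have h4 := eq_mul_add h3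
      have h5 : k < m / K := by
        by_contra! h6
        have := Nat.mul_le_mul_left K h6
        omega
      have := Nat.mul_le_mul_left K h5
      rw [Nat.succ_eq_add_one, mul_add] at this
      omega
  · rw [rtm_step (st' := .ret (pcState pr (pc + 1)) ((K * k + (r + 2) + 1 : ℕ) : ZMod K))
      (w0 := unary s.P (K * k + (r + 2))) (w1 := false)
      (w2 := s.O (K * k + (r + 2))) (d := true)]
    · rw [scratch_update_reg hr false (v := k)]
      · simp
      · intro j
        rw [h0]
        split_ifs <;> simp <;> omega
    · simp only [rtrans, hp]
      rw [if_pos (by simp), pcState_val_succ h]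
      simp

theorem back_step_of_mod_ne_one {s : Store} (hK : 2 ≤ K) {r m : ℕ} (hr : r + 2 < K)
    (h1 : K * s.regs r + 1 < m) (h2 : m < K * s.regs r + (r + 2)) : (m : ZMod K) ≠ 1 := by
  rw [Ne, natCast_eq_one_iff_mod hK]
  obtain ⟨d, rfl⟩ := Nat.exists_eq_add_of_lt h1
  rw [show K * s.regs r + 1 + d + 1 = K * s.regs r + (d + 2) by ring, add_mod_of_lt (by omega)]
  omega

theorem transGen_rd {s : Store} (hK : 2 ≤ K) {pc r t : ℕ} (hr : r + 2 < K)
    (h : pr[pc]? = some (.rd r t)) (hS : (s.D, s.O) ∈ S) :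
    TransGen (GStep (rtm pr K) S) (goConf pr K pc s)
      (goConf pr K (if s.D (s.regs r) then t else pc + 1) s) := by
  have hp := pcState_val h
  have hD : scratch K s.regs s.D (K * s.regs r + 1) = s.D (s.regs r) :=
    congrFun (dTrack_scratch hK) _
  refine TransGen.trans_right (go_scan_reg_back hK hS hr (r := r) (a := K * s.regs r + 1) ?_
    (by omega) ?_)
    (TransGen.head ⟨by simp, by simpa [dTrack_scratch hK] using hS, ?_⟩
    (transGen_ret hK hS _ (K * s.regs r + 1 + 1)))
  · intro o b0 b1 b2
    simp only [rtrans, hp]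
  · intro m h1 h2
    simp only [rtrans, hp]
    rw [if_neg (back_step_of_mod_ne_one hK hr h1 h2)]
  · rw [rtm_step_right]
    simp only [rtrans, hp]
    rw [if_pos (by simp), hD]
    cases s.D (s.regs r)
    · simp [pcState_val_succ h]
    · simp

theorem transGen_wr {s : Store} (hK : 2 ≤ K) {pc r : ℕ} {b : Bool} (hr : r + 2 < K)
    (h : pr[pc]? = some (.wr r b)) (hS : (s.D, s.O) ∈ S)
    (hS' : (Function.update s.D (s.regs r) b, s.O) ∈ S) :
    TransGen (GStep (rtm pr K) S) (goConf pr K pc s)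
      (goConf pr K (pc + 1) { s with D := Function.update s.D (s.regs r) b }) := by
  have hp := pcState_val h
  refine TransGen.trans_right (go_scan_reg_back hK hS hr (r := r) (a := K * s.regs r + 1) ?_
    (by omega) ?_)
    (TransGen.head ⟨by simp, by simpa [dTrack_scratch hK] using hS, ?_⟩
    (transGen_ret hK hS' _ (K * s.regs r + 1 + 1)))
  · intro o b0 b1 b2
    simp only [rtrans, hp]
  · intro m h1 h2
    simp only [rtrans, hp]
    rw [if_neg (back_step_of_mod_ne_one hK hr h1 h2)]
  · rw [rtm_step (st' := .ret (pcState pr (pc + 1)) ((K * s.regs r + 1 + 1 : ℕ) : ZMod K))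
      (w0 := unary s.P (K * s.regs r + 1)) (w1 := b)
      (w2 := s.O (K * s.regs r + 1)) (d := true)]
    · simp [scratch_update_D hK]
    · simp only [rtrans, hp]
      rw [if_pos (by simp), pcState_val_succ h]
      simp

theorem transGen_incP {s : Store} (hK : 2 ≤ K) {pc : ℕ}
    (h : pr[pc]? = some .incP) (hS : (s.D, s.O) ∈ S) :
    TransGen (GStep (rtm pr K) S) (goConf pr K pc s)
      (goConf pr K (pc + 1) { s with P := s.P + 1 }) := by
  have hp := pcState_val h
  refine TransGen.trans_right (go_scan_P hK hS ?_)
    (TransGen.head ⟨by simp, by simpa [dTrack_scratch hK] using hS, ?_⟩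
    (transGen_ret (s := { s with P := s.P + 1 }) hK hS _ (s.P + 1)))
  · intro o b1 b2
    simp [rtrans, hp]
  · rw [rtm_step (st' := .ret (pcState pr (pc + 1)) ((s.P + 1 : ℕ) : ZMod K))
      (w0 := true) (w1 := scratch K s.regs s.D s.P) (w2 := s.O s.P) (d := true)]
    · simp [update_unary_succ]
    · simp only [rtrans, hp]
      rw [if_pos (by simp [unary]), pcState_val_succ h]
      simp

theorem transGen_out {s : Store} (hK : 2 ≤ K) {pc : ℕ}
    (h : pr[pc]? = some .out) (hS : (s.D, s.O) ∈ S)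
    (hS' : (s.D, Function.update s.O s.P true) ∈ S) :
    TransGen (GStep (rtm pr K) S) (goConf pr K pc s)
      (goConf pr K (pc + 1) { s with P := 0, O := Function.update s.O s.P true }) := by
  have hp := pcState_val h
  refine TransGen.trans_right (go_scan_P hK hS ?_) ?_
  · intro o b1 b2
    simp [rtrans, hp]
  let c : ℕ → Conf (RState pr.length K) := fun m =>
    ⟨.retc (pcState pr (pc + 1)) (m : ZMod K), m, fun n => decide (n ≤ m ∧ n < s.P),
      scratch K s.regs s.D, Function.update s.O s.P true⟩
  refine TransGen.head' (b := c (s.P + 1))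
    ⟨by simp, by simpa [dTrack_scratch hK] using hS, ?_⟩ ?_
  · rw [rtm_step (st' := .retc (pcState pr (pc + 1)) ((s.P + 1 : ℕ) : ZMod K))
      (w0 := unary s.P s.P) (w1 := scratch K s.regs s.D s.P) (w2 := true) (d := true)]
    · simp only [Function.update_eq_self, if_true, c, Conf.mk.injEq, true_and, and_true]
      funext n
      simp only [unary, decide_eq_decide]
      omega
    · simp only [rtrans, hp]
      rw [if_pos (by simp [unary]), pcState_val_succ h]
      simp
  refine (scan_down (c := c) (a := 0) (by omega)
    fun m h1 h2 => ⟨by simp [c], by simpa [c, dTrack_scratch hK] using hS', ?_⟩).tail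
    ⟨by simp [c], by simpa [c, dTrack_scratch hK] using hS', ?_⟩
  · simp only [c]
    rw [rtm_step (st' := .retc (pcState pr (pc + 1)) (m : ZMod K))
      (w0 := false) (w1 := scratch K s.regs s.D (m + 1))
      (w2 := Function.update s.O s.P true (m + 1)) (d := false)]
    · simp only [Function.update_eq_self, Conf.mk.injEq, true_and, and_true]
      refine ⟨by simp, ?_⟩
      funext n
      by_cases hn : n = m + 1
      · subst hn; simp
      · rw [Function.update_of_ne hn, decide_eq_decide]
        omega
    · simp only [rtrans]
      rw [if_neg]
      · simp
      · rintro ⟨h3, h4⟩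
        rw [scratch_marker (natCast_eq_zero_iff_mod.1 h3)] at h4
        simp at h4
  · simp only [c]
    rw [rtm_step (st' := .go (pcState pr (pc + 1)) 0)
      (w0 := false) (w1 := scratch K s.regs s.D 0)
      (w2 := Function.update s.O s.P true 0) (d := false)]
    · simp only [Function.update_eq_self, Conf.mk.injEq, true_and, and_true, goConf]
      refine ⟨by simp, ?_⟩
      funext n
      by_cases hn : n = 0
      · subst hn; simp [unary]
      · rw [Function.update_of_ne hn]
        simp [unary]
        omega
    · simp [rtrans, scratch_zero]

theorem transGen_jmp {s : Store} (hK : 2 ≤ K) {pc t : ℕ}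
    (h : pr[pc]? = some (.jmp t)) (hS : (s.D, s.O) ∈ S) :
    TransGen (GStep (rtm pr K) S) (goConf pr K pc s) (goConf pr K t s) := by
  have hp := pcState_val h
  refine .single ⟨by simp [goConf], by simpa [goConf, dTrack_scratch hK] using hS, ?_⟩
  rw [goConf, rtm_step_left (st' := .go (pcState pr t) 0)]
  · rfl
  · simp [rtrans, hp]

theorem step_halt {s : Store} {pc : ℕ} (h : pr[pc]? = some .halt) :
    (rtm pr K).step (goConf pr K pc s) =
      ⟨.halt, 1, unary s.P, scratch K s.regs s.D, s.O⟩ := by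
  rw [goConf, rtm_step_right (st' := .halt)]
  simp [rtrans, pcState_val h]

/-- The machine simulates the register machine. -/
theorem transGen_of_iStep (hK : ∀ ins ∈ pr, ins.reg + 2 < K) (hK2 : 2 ≤ K) {pc pc' : ℕ}
    {s s' : Store} (h : IStep pr (pc, s) (pc', s'))
    (hS : (s.D, s.O) ∈ S) (hS' : (s'.D, s'.O) ∈ S) :
    TransGen (GStep (rtm pr K) S) (goConf pr K pc s) (goConf pr K pc' s') := by
  cases h with
  | inc h => exact transGen_inc hK2 (hK _ (List.mem_of_getElem? h)) h hS
  | decZero h h0 => exact transGen_decZero hK2 (hK _ (List.mem_of_getElem? h)) h h0 hS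
  | decSucc h h0 => exact transGen_decSucc hK2 (hK _ (List.mem_of_getElem? h)) h h0 hS
  | rd h => exact transGen_rd hK2 (hK _ (List.mem_of_getElem? h)) h hS
  | wr h => exact transGen_wr hK2 (hK _ (List.mem_of_getElem? h)) h hS hS'
  | incP h => exact transGen_incP hK2 h hS
  | out h => exact transGen_out hK2 h hS hS'
  | jmp h => exact transGen_jmp hK2 h hS

end Exec

end

section

open Relation

/-- Structured programs for the register machine. -/
inductive Cmd where
  | skip
  | inc (r : ℕ)
  | seq (a b : Cmd)
  /-- While the register is nonzero, decrement it and run the body. -/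
  | loop (r : ℕ) (c : Cmd)
  /-- If the register is zero run `a`, otherwise decrement it and run `b`. -/
  | cases (r : ℕ) (a b : Cmd)
  /-- Run the body if the bit of `D` addressed by the register is set. -/
  | rd (r : ℕ) (c : Cmd)
  | wr (r : ℕ) (b : Bool)
  | incP
  | out

namespace Cmd

/-- The length of the compiled code. -/
def size : Cmd → ℕ
  | skip => 0
  | inc _ => 1
  | seq a b => a.size + b.size
  | loop _ c => c.size + 2
  | cases _ a b => b.size + a.size + 2
  | rd _ c => c.size + 2
  | wr _ _ => 1
  | incP => 1
  | out => 1

/-- Compiling a structured program to code starting at the address `n`. -/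
def comp : Cmd → ℕ → List Instr
  | skip, _ => []
  | inc r, _ => [.inc r]
  | seq a b, n => a.comp n ++ b.comp (n + a.size)
  | loop r c, n => .dec r (n + c.size + 2) :: (c.comp (n + 1) ++ [.jmp n])
  | cases r a b, n => .dec r (n + b.size + 2) :: (b.comp (n + 1) ++
      (.jmp (n + b.size + a.size + 2) :: a.comp (n + b.size + 2)))
  | rd r c, n => .rd r (n + 2) :: .jmp (n + c.size + 2) :: c.comp (n + 2)
  | wr r b, _ => [.wr r b]
  | incP, _ => [.incP]
  | out, _ => [.out]

theorem length_comp (c : Cmd) (n : ℕ) : (c.comp n).length = c.size := by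
  induction c generalizing n with
  | skip => rfl
  | inc r => rfl
  | seq a b iha ihb => simp [comp, size, iha, ihb]
  | loop r c ih => simp [comp, size, ih]
  | cases r a b iha ihb => simp [comp, size, iha, ihb]; omega
  | rd r c ih => simp [comp, size, ih]
  | wr r b => rfl
  | incP => rfl
  | out => rfl

end Cmd

/-- Big step semantics, with every pair of bit array and output that arises in `S`. -/
inductive Exec (S : Set ((ℕ → Bool) × (ℕ → Bool))) : Cmd → Store → Store → Prop
  | skip {s} : Exec S .skip s s
  | inc {r s} : Exec S (.inc r) s { s with regs := Function.update s.regs r (s.regs r + 1) }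
  | seq {a b s s' s''} (h1 : Exec S a s s') (h2 : Exec S b s' s'') : Exec S (.seq a b) s s''
  | loopZero {r c s} (h : s.regs r = 0) : Exec S (.loop r c) s s
  | loopSucc {r c k s s' s''} (h : s.regs r = k + 1)
      (h1 : Exec S c { s with regs := Function.update s.regs r k } s')
      (h2 : Exec S (.loop r c) s' s'') : Exec S (.loop r c) s s''
  | casesZero {r a b s s'} (h : s.regs r = 0) (h1 : Exec S a s s') : Exec S (.cases r a b) s s'
  | casesSucc {r a b k s s'} (h : s.regs r = k + 1)
      (h1 : Exec S b { s with regs := Function.update s.regs r k } s') :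
      Exec S (.cases r a b) s s'
  | rdFalse {r c s} (h : s.D (s.regs r) = false) : Exec S (.rd r c) s s
  | rdTrue {r c s s'} (h : s.D (s.regs r) = true) (h1 : Exec S c s s') : Exec S (.rd r c) s s'
  | wr {r b s} (h : (Function.update s.D (s.regs r) b, s.O) ∈ S) :
      Exec S (.wr r b) s { s with D := Function.update s.D (s.regs r) b }
  | incP {s} : Exec S .incP s { s with P := s.P + 1 }
  | out {s} (h : (s.D, Function.update s.O s.P true) ∈ S) :
      Exec S .out s { s with P := 0, O := Function.update s.O s.P true }

/-- A step of the register machine between stores with bit array and output in `S`. -/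
def SStep (pr : List Instr) (S : Set ((ℕ → Bool) × (ℕ → Bool))) (x y : ℕ × Store) : Prop :=
  IStep pr x y ∧ (x.2.D, x.2.O) ∈ S ∧ (y.2.D, y.2.O) ∈ S

/-- The list `l` occurs in the program `pr` at the address `n`. -/
def CodeAt (pr : List Instr) (n : ℕ) (l : List Instr) : Prop :=
  ∀ i ins, l[i]? = some ins → pr[n + i]? = some ins

theorem codeAt_cons {pr : List Instr} {n : ℕ} {a : Instr} {l : List Instr} :
    CodeAt pr n (a :: l) ↔ pr[n]? = some a ∧ CodeAt pr (n + 1) l := by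
  constructor
  · intro h
    refine ⟨h 0 a rfl, fun i ins hi => ?_⟩
    rw [add_assoc, add_comm 1]
    exact h (i + 1) ins (by simpa using hi)
  · rintro ⟨h1, h2⟩ i ins hi
    cases i with
    | zero => simp at hi; subst hi; exact h1
    | succ i =>
      rw [add_comm i, ← add_assoc]
      exact h2 i ins (by simpa using hi)

theorem codeAt_nil {pr : List Instr} {n : ℕ} : CodeAt pr n [] := by
  intro i ins h
  simp at h

theorem codeAt_append {pr : List Instr} {n : ℕ} {l l' : List Instr} :
    CodeAt pr n (l ++ l') ↔ CodeAt pr n l ∧ CodeAt pr (n + l.length) l' := by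
  induction l generalizing n with
  | nil => simp [codeAt_nil]
  | cons a l ih =>
    simp only [List.cons_append, codeAt_cons, ih, List.length_cons, and_assoc]
    rw [add_assoc, add_comm 1]

theorem Exec.mem {S : Set ((ℕ → Bool) × (ℕ → Bool))} {c : Cmd} {s s' : Store}
    (h : Exec S c s s') (hs : (s.D, s.O) ∈ S) : (s'.D, s'.O) ∈ S := by
  induction h with
  | skip => exact hs
  | inc => exact hs
  | seq _ _ ih1 ih2 => exact ih2 (ih1 hs)
  | loopZero => exact hs
  | loopSucc _ _ _ ih1 ih2 => exact ih2 (ih1 hs)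
  | casesZero _ _ ih => exact ih hs
  | casesSucc _ _ ih => exact ih hs
  | rdFalse => exact hs
  | rdTrue _ _ ih => exact ih hs
  | wr h => exact h
  | incP => exact hs
  | out h => exact h

theorem Exec.mono {S S' : Set ((ℕ → Bool) × (ℕ → Bool))} (hS : S ⊆ S') {c : Cmd} {s s' : Store}
    (h : Exec S c s s') : Exec S' c s s' := by
  induction h with
  | skip => exact .skip
  | inc => exact .inc
  | seq _ _ ih1 ih2 => exact .seq ih1 ih2
  | loopZero h => exact .loopZero h
  | loopSucc h _ _ ih1 ih2 => exact .loopSucc h ih1 ih2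
  | casesZero h _ ih => exact .casesZero h ih
  | casesSucc h _ ih => exact .casesSucc h ih
  | rdFalse h => exact .rdFalse h
  | rdTrue h _ ih => exact .rdTrue h ih
  | wr h => exact .wr (hS h)
  | incP => exact .incP
  | out h => exact .out (hS h)

/-- Compiled code executes the structured program. -/
theorem Exec.steps {pr : List Instr} {S : Set ((ℕ → Bool) × (ℕ → Bool))} {c : Cmd} {s s' : Store}
    (h : Exec S c s s') (hs : (s.D, s.O) ∈ S) {n : ℕ} (hc : CodeAt pr n (c.comp n)) :
    ReflTransGen (SStep pr S) (n, s) (n + c.size, s') := by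
  induction h generalizing n with
  | skip => exact .refl
  | inc => exact .single ⟨.inc (codeAt_cons.1 hc).1, hs, hs⟩
  | seq h1 h2 ih1 ih2 =>
    rw [Cmd.comp, codeAt_append, Cmd.length_comp] at hc
    rw [Cmd.size, ← add_assoc]
    exact (ih1 hs hc.1).trans (ih2 (h1.mem hs) hc.2)
  | loopZero h =>
    rw [Cmd.comp, codeAt_cons] at hc
    exact .single ⟨.decZero hc.1 h, hs, hs⟩
  | @loopSucc r c k s s1 s2 h h1 h2 ih1 ih2 =>
    have hc' := hc
    rw [Cmd.comp, codeAt_cons, codeAt_append, Cmd.length_comp, codeAt_cons] at hc'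
    refine ReflTransGen.head ⟨.decSucc hc'.1 h, hs, hs⟩ ((ih1 hs hc'.2.1).trans ?_)
    exact ReflTransGen.head ⟨.jmp hc'.2.2.1, h1.mem hs, h1.mem hs⟩ (ih2 (h1.mem hs) hc)
  | @casesZero r a b s s1 h h1 ih =>
    rw [Cmd.comp, codeAt_cons, codeAt_append, Cmd.length_comp, codeAt_cons] at hc
    refine ReflTransGen.head ⟨.decZero hc.1 h, hs, hs⟩ ?_
    have := ih hs (n := n + b.size + 2) (by convert hc.2.2.2 using 1; ring)
    rw [Cmd.size]
    convert this using 2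
    ring
  | @casesSucc r a b k s s1 h h1 ih =>
    rw [Cmd.comp, codeAt_cons, codeAt_append, Cmd.length_comp, codeAt_cons] at hc
    refine ReflTransGen.head ⟨.decSucc hc.1 h, hs, hs⟩ ((ih hs hc.2.1).tail ?_)
    have := IStep.jmp (s := s1) hc.2.2.1
    exact ⟨by rw [Cmd.size]; convert this using 2; ring, h1.mem hs, h1.mem hs⟩
  | @rdFalse r c s h =>
    rw [Cmd.comp, codeAt_cons, codeAt_cons] at hc
    have := IStep.rd (s := s) hc.1
    rw [h] at this
    exact ReflTransGen.head ⟨this, hs, hs⟩ (.single ⟨.jmp hc.2.1, hs, hs⟩)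
  | @rdTrue r c s s1 h h1 ih =>
    rw [Cmd.comp, codeAt_cons, codeAt_cons] at hc
    have := IStep.rd (s := s) hc.1
    rw [h, if_pos rfl] at this
    refine ReflTransGen.head ⟨this, hs, hs⟩ ?_
    have := ih hs hc.2.2
    rw [Cmd.size]
    convert this using 2
    omega
  | wr h => exact .single ⟨.wr (codeAt_cons.1 hc).1, hs, h⟩
  | incP => exact .single ⟨.incP (codeAt_cons.1 hc).1, hs, hs⟩
  | out h => exact .single ⟨.out (codeAt_cons.1 hc).1, hs, h⟩

end

section

open Relation

/-- Execution of a program which only changes registers. -/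
def RExec (c : Cmd) (ρ ρ' : ℕ → ℕ) : Prop :=
  ∀ D P O, Exec ∅ c ⟨ρ, D, P, O⟩ ⟨ρ', D, P, O⟩

theorem RExec.inc (r : ℕ) (ρ : ℕ → ℕ) : RExec (.inc r) ρ (Function.update ρ r (ρ r + 1)) :=
  fun _ _ _ => Exec.inc

theorem RExec.skip (ρ : ℕ → ℕ) : RExec .skip ρ ρ := fun _ _ _ => Exec.skip

theorem RExec.seq {a b : Cmd} {ρ ρ' ρ'' : ℕ → ℕ} (h1 : RExec a ρ ρ') (h2 : RExec b ρ' ρ'') :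
    RExec (.seq a b) ρ ρ'' := fun D P O => (h1 D P O).seq (h2 D P O)

theorem RExec.loop {r n : ℕ} {c : Cmd} (f : ℕ → ℕ → ℕ) (hf : ∀ k, f k r = k)
    (h : ∀ k < n, RExec c (Function.update (f (k + 1)) r k) (f k)) :
    RExec (.loop r c) (f n) (f 0) := by
  induction n with
  | zero => exact fun _ _ _ => Exec.loopZero (hf 0)
  | succ n ih =>
    intro D P O
    exact Exec.loopSucc (hf (n + 1)) (h n (by omega) D P O)
      (ih (fun k hk => h k (by omega)) D P O)

/-- Setting a register to zero. -/
def Cmd.clear (r : ℕ) : Cmd := .loop r .skip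

theorem RExec.clear (r : ℕ) (ρ : ℕ → ℕ) : RExec (.clear r) ρ (Function.update ρ r 0) := by
  have := RExec.loop (r := r) (n := ρ r) (c := .skip) (fun k => Function.update ρ r k)
    (fun k => by simp) (fun k _ => by simpa using RExec.skip _)
  rwa [Function.update_eq_self] at this

/-- Moving the contents of a register into a register containing zero. -/
def Cmd.move (r o : ℕ) : Cmd := .loop r (.inc o)

theorem RExec.move {r o : ℕ} {ρ : ℕ → ℕ} (hro : r ≠ o) (ho : ρ o = 0) :
    RExec (.move r o) ρ (Function.update (Function.update ρ r 0) o (ρ r)) := by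
  have := RExec.loop (r := r) (n := ρ r) (c := .inc o)
    (fun k => Function.update (Function.update ρ r k) o (ρ r - k))
    (fun k => by simp [hro]) (fun k hk => ?_)
  · rw [Nat.sub_self, Function.update_eq_self, Nat.sub_zero, ← ho, Function.update_eq_self, ho]
      at this
    exact this
  convert RExec.inc o _ using 1
  funext j
  simp only [Function.update_apply]
  split_ifs <;> simp_all
  omega

/-- Copying a register into a register containing zero, using the temporary register `t`. -/
def Cmd.copy (r o t : ℕ) : Cmd := .seq (.loop r (.seq (.inc o) (.inc t))) (.move t r)

theorem RExec.copy {r o t : ℕ} {ρ : ℕ → ℕ} (hro : r ≠ o) (hrt : r ≠ t) (hot : o ≠ t)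
    (ho : ρ o = 0) (ht : ρ t = 0) : RExec (.copy r o t) ρ (Function.update ρ o (ρ r)) := by
  refine RExec.seq (ρ' := Function.update (Function.update (Function.update ρ r 0) o (ρ r)) t (ρ r))
    ?_ ?_
  · have := RExec.loop (r := r) (n := ρ r) (c := .seq (.inc o) (.inc t))
      (fun k => Function.update (Function.update (Function.update ρ r k) o (ρ r - k)) t (ρ r - k))
      (fun k => by simp [hro, hrt]) (fun k hk => ?_)
    · convert this using 1
      · funext j
        simp only [Function.update_apply]
        split_ifs <;> simp_all
      · simp
    convert (RExec.inc o _).seq (RExec.inc t _) using 1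
    funext j
    simp only [Function.update_apply]
    split_ifs <;> simp_all <;> omega
  · convert RExec.move (r := t) (o := r) (Ne.symm hrt) ?_ using 1
    · funext j
      simp only [Function.update_apply]
      split_ifs <;> simp_all
    · simp [hro, hrt]

/-- The function `f` is computed by register programs, for every choice of input registers `a`,
output register `o` and bound `t` below the scratch registers. -/
def Computes {n : ℕ} (f : List.Vector ℕ n → ℕ) : Prop :=
  ∀ (a : Fin n → ℕ) (o t : ℕ), (∀ i, a i < t) → o < t → (∀ i, a i ≠ o) →
    ∃ c : Cmd, ∀ ρ : ℕ → ℕ, ρ o = 0 → (∀ j, t ≤ j → ρ j = 0) →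
      RExec c ρ (Function.update ρ o (f (List.Vector.ofFn fun i => ρ (a i))))

theorem exists_cmd_clear_range (t n : ℕ) :
    ∃ c : Cmd, ∀ ρ : ℕ → ℕ, RExec c ρ (fun j => if t ≤ j ∧ j < t + n then 0 else ρ j) := by
  induction n with
  | zero =>
    refine ⟨.skip, fun ρ => ?_⟩
    convert RExec.skip ρ using 1
    funext j
    rw [if_neg (by omega)]
  | succ n ih =>
    obtain ⟨c, hc⟩ := ih
    refine ⟨.seq c (.clear (t + n)), fun ρ => ?_⟩
    convert (hc ρ).seq (RExec.clear _ _) using 1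
    funext j
    simp only [Function.update_apply]
    split_ifs <;> first | rfl | omega

theorem Computes.comp {m n : ℕ} {f : List.Vector ℕ n → ℕ} {g : Fin n → List.Vector ℕ m → ℕ}
    (hf : Computes f) (hg : ∀ i, Computes (g i)) :
    Computes fun v => f (List.Vector.ofFn fun i => g i v) := by
  intro a o t ha ho hao
  have hstep : ∀ k ≤ n, ∃ c : Cmd, ∀ ρ : ℕ → ℕ, (∀ j, t ≤ j → ρ j = 0) →
      RExec c ρ (fun j => if h : t ≤ j ∧ j < t + k ∧ j - t < n then
        g ⟨j - t, h.2.2⟩ (List.Vector.ofFn fun i => ρ (a i)) else ρ j) := by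
    intro k hk
    induction k with
    | zero =>
      refine ⟨.skip, fun ρ _ => ?_⟩
      convert RExec.skip ρ using 1
      funext j
      rw [dif_neg (by omega)]
    | succ k ih =>
      obtain ⟨c, hc⟩ := ih (by omega)
      obtain ⟨c', hc'⟩ := hg ⟨k, by omega⟩ a (t + k) (t + n) (fun i => by have := ha i; omega)
        (by omega) (fun i => by have := ha i; omega)
      refine ⟨.seq c c', fun ρ hρ => ?_⟩
      convert (hc ρ hρ).seq (hc' _ ?_ ?_) using 1
      · funext j
        simp only [Function.update_apply]
        by_cases hj : j = t + k
        · subst hj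
          rw [dif_pos (by omega), if_pos rfl]
          congr 2
          · simp
          · funext i
            rw [dif_neg (by have := ha i; omega)]
        · rw [if_neg hj]
          by_cases h2 : t ≤ j ∧ j < t + k ∧ j - t < n
          · rw [dif_pos h2, dif_pos (by omega)]
          · rw [dif_neg h2, dif_neg (by omega)]
      · rw [dif_neg (by omega)]
        exact hρ _ (by omega)
      · intro j hj
        rw [dif_neg (by omega)]
        exact hρ _ (by omega)
  obtain ⟨c1, h1⟩ := hstep n le_rfl
  obtain ⟨c2, h2⟩ := hf (fun i => t + i) o (t + n) (fun i => by omega) (by omega)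
    (fun i => by omega)
  obtain ⟨c3, h3⟩ := exists_cmd_clear_range t n
  refine ⟨.seq c1 (.seq c2 c3), fun ρ h0 hρ => ?_⟩
  convert (h1 ρ hρ).seq ((h2 _ ?_ ?_).seq (h3 _)) using 1
  · funext j
    simp only [Function.update_apply]
    by_cases hj : j = o
    · subst hj
      rw [if_pos rfl, if_neg (by omega), if_pos rfl]
      congr 2
      funext i
      rw [dif_pos (by omega)]
      congr 1
      ext
      simp
    · rw [if_neg hj, if_neg hj]
      by_cases h4 : t ≤ j ∧ j < t + n
      · rw [if_pos h4, hρ j h4.1]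
      · rw [if_neg h4, dif_neg (by omega)]
  · rw [dif_neg (by omega), h0]
  · intro j hj
    rw [dif_neg (by omega)]
    exact hρ _ (by omega)

theorem Computes.prec {n : ℕ} {f : List.Vector ℕ n → ℕ} {g : List.Vector ℕ (n + 2) → ℕ}
    (hf : Computes f) (hg : Computes g) :
    Computes fun v : List.Vector ℕ (n + 1) =>
      v.head.rec (f v.tail) fun y IH => g (y ::ᵥ IH ::ᵥ v.tail) := by
  intro a o t ha ho hao
  obtain ⟨c1, h1⟩ := hf (fun i => a i.succ) o (t + 3) (fun i => by have := ha i.succ; omega)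
    (by omega) (fun i => hao _)
  obtain ⟨c2, h2⟩ := hg (Fin.cons (t + 1) (Fin.cons o fun i => a i.succ)) (t + 2) (t + 3)
    (by
      intro i
      refine Fin.cases ?_ (fun i => Fin.cases ?_ (fun i => ?_) i) i
      · simp
      · simp; omega
      · simp only [Fin.cons_succ]
        have := ha i.succ
        omega) (by omega)
    (by
      intro i
      refine Fin.cases ?_ (fun i => Fin.cases ?_ (fun i => ?_) i) i
      · simp
      · simp; omega
      · simp only [Fin.cons_succ]
        have := ha i.succ
        omega)
  refine ⟨.seq (.copy (a 0) t (t + 1)) (.seq c1 (.seq (.loop t (.seq c2 (.seq (.clear o)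
    (.seq (.move (t + 2) o) (.inc (t + 1)))))) (.clear (t + 1)))), fun ρ h0 hρ => ?_⟩
  have ha0 := ha 0
  have hao0 := hao 0
  set x := ρ (a 0) with hx
  set w : List.Vector ℕ n := List.Vector.ofFn fun i => ρ (a i.succ) with hw
  let IH : ℕ → ℕ := fun k => Nat.rec (f w) (fun y IH => g (y ::ᵥ IH ::ᵥ w)) k
  let F : ℕ → ℕ → ℕ := fun k => Function.update (Function.update (Function.update ρ t k)
    (t + 1) (x - k)) o (IH (x - k))
  refine (RExec.copy (by omega) (by omega) (by omega) (hρ t le_rfl) (hρ (t + 1) (by omega))).seq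
    (RExec.seq (ρ' := F x) ?_ (RExec.seq (ρ' := F 0) ?_ ?_))
  · convert h1 _ ?_ ?_ using 1
    · funext j
      simp only [F, IH, Function.update_apply]
      by_cases h3 : j = o
      · rw [if_pos h3, if_pos h3]
        simp only [Nat.sub_self, hw]
        change f _ = f _
        congr 2
        funext i
        rw [if_neg (by have := ha i.succ; omega)]
      · rw [if_neg h3, if_neg h3]
        by_cases h4 : j = t + 1
        · rw [if_pos h4, if_neg (by omega), h4, hρ _ (by omega), Nat.sub_self]
        · rw [if_neg h4]
    · rw [Function.update_of_ne (by omega), h0]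
    · intro j hj
      rw [Function.update_of_ne (by omega), hρ j (by omega)]
  · refine RExec.loop F (fun k => ?_) fun k hk => ?_
    · simp only [F]
      rw [Function.update_of_ne (by omega), Function.update_of_ne (by omega),
        Function.update_self]
    · have hv : (Function.update (F (k + 1)) t k) = Function.update (Function.update
          (Function.update ρ t k) (t + 1) (x - (k + 1))) o (IH (x - (k + 1))) := by
        funext j
        simp only [F, Function.update_apply]
        split_ifs <;> first | rfl | omega
      have hIH : IH (x - k) = g ((x - (k + 1)) ::ᵥ IH (x - (k + 1)) ::ᵥ w) := by
        rw [show x - k = (x - (k + 1)) + 1 by omega]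
      rw [hv]
      have hval : (List.Vector.ofFn fun i => (Function.update (Function.update
          (Function.update ρ t k) (t + 1) (x - (k + 1))) o (IH (x - (k + 1))))
          ((Fin.cons (t + 1) (Fin.cons o fun i => a i.succ) : Fin (n + 2) → ℕ) i)) =
          (x - (k + 1)) ::ᵥ IH (x - (k + 1)) ::ᵥ w := by
        refine List.Vector.ext fun i => ?_
        rw [List.Vector.get_ofFn]
        refine Fin.cases ?_ (fun i => Fin.cases ?_ (fun i => ?_) i) i
        · rw [Fin.cons_zero, List.Vector.get_cons_zero, Function.update_of_ne (by omega),
            Function.update_self]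
        · rw [Fin.cons_succ, Fin.cons_zero, List.Vector.get_cons_succ, List.Vector.get_cons_zero,
            Function.update_self]
        · have := ha i.succ
          rw [Fin.cons_succ, Fin.cons_succ, List.Vector.get_cons_succ, List.Vector.get_cons_succ,
            Function.update_of_ne (hao _), Function.update_of_ne (by omega),
            Function.update_of_ne (by omega), hw, List.Vector.get_ofFn]
      have h2' := h2 (Function.update (Function.update
          (Function.update ρ t k) (t + 1) (x - (k + 1))) o (IH (x - (k + 1)))) ?_ ?_
      · rw [hval, ← hIH] at h2'
        convert h2'.seq ((RExec.clear o _).seq ((RExec.move (r := t + 2) (o := o) (by omega)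
          (Function.update_self ..)).seq (RExec.inc (t + 1) _))) using 1
        funext j
        have ht2 := hρ (t + 2) (by omega)
        simp only [F, Function.update_apply]
        split_ifs <;> first | rfl | omega | simp_all
      · rw [Function.update_of_ne (by omega), Function.update_of_ne (by omega),
          Function.update_of_ne (by omega), hρ _ (by omega)]
      · intro j hj
        rw [Function.update_of_ne (by omega), Function.update_of_ne (by omega),
          Function.update_of_ne (by omega), hρ _ (by omega)]
  · convert RExec.clear _ _ using 1
    funext j
    simp only [F, Function.update_apply]
    by_cases h3 : j = o
    · rw [if_pos h3, if_neg (by omega), if_pos h3]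
      simp [IH, List.Vector.head_ofFn, List.Vector.tail_ofFn, hx, hw]
    · rw [if_neg h3, if_neg h3]
      split_ifs with h4 h5
      · rw [h4, hρ _ (by omega)]
      · rw [h5, hρ _ le_rfl]
      · rfl

theorem computes_of_primrec {n : ℕ} {f : List.Vector ℕ n → ℕ} (h : Nat.Primrec' f) :
    Computes f := by
  induction h with
  | zero =>
    intro a o t _ _ _
    refine ⟨.skip, fun ρ h0 _ => ?_⟩
    convert RExec.skip ρ using 1
    exact (congrArg (Function.update ρ o) h0.symm).trans (Function.update_eq_self o ρ)
  | succ =>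
    intro a o t ha ho hao
    have := ha 0
    refine ⟨.seq (.copy (a 0) o t) (.inc o), fun ρ h0 hρ => ?_⟩
    convert (RExec.copy (hao 0) (by omega) (by omega) h0 (hρ t le_rfl)).seq (RExec.inc _ _) using 1
    simp [List.Vector.head_ofFn]
  | get i =>
    intro a o t ha ho hao
    have := ha i
    refine ⟨.copy (a i) o t, fun ρ h0 hρ => ?_⟩
    convert RExec.copy (hao i) (by omega) (by omega) h0 (hρ t le_rfl) using 1
    simp
  | comp g _ _ ihf ihg => exact ihf.comp ihg
  | prec _ _ ihf ihg => exact ihf.prec ihg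

theorem exists_cmd_primrec {f : ℕ → ℕ} (hf : Primrec f) {a o t : ℕ} (ha : a < t) (ho : o < t)
    (hao : a ≠ o) : ∃ c : Cmd, ∀ ρ : ℕ → ℕ, ρ o = 0 → (∀ j, t ≤ j → ρ j = 0) →
      RExec c ρ (Function.update ρ o (f (ρ a))) := by
  obtain ⟨c, hc⟩ := computes_of_primrec (Nat.Primrec'.prim_iff₁.2 hf) (fun _ => a) o t
    (fun _ => ha) ho (fun _ => hao)
  refine ⟨c, fun ρ h1 h2 => ?_⟩
  simpa [List.Vector.head_ofFn] using hc ρ h1 h2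

theorem exists_cmd_primrec₂ {f : ℕ → ℕ → ℕ} (hf : Primrec₂ f) {a b o t : ℕ} (ha : a < t)
    (hb : b < t) (ho : o < t) (hao : a ≠ o) (hbo : b ≠ o) :
    ∃ c : Cmd, ∀ ρ : ℕ → ℕ, ρ o = 0 → (∀ j, t ≤ j → ρ j = 0) →
      RExec c ρ (Function.update ρ o (f (ρ a) (ρ b))) := by
  obtain ⟨c, hc⟩ := computes_of_primrec (Nat.Primrec'.prim_iff₂.2 hf) ![a, b] o t
    (by simp [Fin.forall_fin_two, ha, hb]) ho (by simp [Fin.forall_fin_two, hao, hbo])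
  refine ⟨c, fun ρ h1 h2 => ?_⟩
  simpa [List.Vector.head_ofFn, List.Vector.tail_ofFn] using hc ρ h1 h2

end

section

open Relation

/-- The number with binary digits `D k, …, D (k + l - 1)`. -/
def window (D : ℕ → Bool) : ℕ → ℕ → ℕ
  | 0, _ => 0
  | l + 1, k => Nat.bit (D k) (window D l (k + 1))

theorem testBit_window (D : ℕ → Bool) (l k i : ℕ) (h : i < l) :
    (window D l k).testBit i = D (k + i) := by
  induction l generalizing k i with
  | zero => omega
  | succ l ih =>
    rw [window]
    cases i with
    | zero => rw [Nat.testBit_bit_zero, add_zero]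
    | succ i => rw [Nat.testBit_bit_succ, ih _ _ (by omega)]; congr 1; ring

/-- A primitive recursive description of how a bit array and an output array are changed in the
`n`-th step of a pass of length `ω`: in view of the first `bnd n` bits of the bit array, `kind`
tells whether to clear or set a bit of the bit array or to set a bit of the output array, and
`addr` tells which one. -/
structure PassSpec where
  kind : ℕ → ℕ → ℕ
  addr : ℕ → ℕ → ℕ
  bnd : ℕ → ℕ
  kind_primrec : Primrec₂ kind
  addr_primrec : Primrec₂ addr
  bnd_primrec : Primrec bnd

namespace PassSpec

variable (A : PassSpec)

/-- The `n`-th step of a pass. -/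
def act (n : ℕ) (x : (ℕ → Bool) × (ℕ → Bool)) : (ℕ → Bool) × (ℕ → Bool) :=
  let w := window x.1 (A.bnd n) 0
  if A.kind n w = 0 then (Function.update x.1 (A.addr n w) false, x.2)
  else if A.kind n w = 1 then (Function.update x.1 (A.addr n w) true, x.2)
  else (x.1, Function.update x.2 (A.addr n w) true)

/-- The remainder of an ordinal modulo `ω`, as a natural number. -/
noncomputable def natMod (α : Ordinal.{0}) : ℕ := Cardinal.toNat (α % Ordinal.omega0).card

theorem natMod_mul_add (α : Ordinal.{0}) (n : ℕ) : natMod (Ordinal.omega0 * α + n) = n := by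
  rw [natMod, Ordinal.mul_add_mod_self, Ordinal.natCast_mod_omega0, Ordinal.card_nat,
    Cardinal.toNat_natCast]

/-- The bit array and the output array at an ordinal stage, with limits superior at limits. -/
noncomputable def stage (α : Ordinal.{0}) : (ℕ → Bool) × (ℕ → Bool) :=
  Ordinal.limitRecOn (motive := fun _ => (ℕ → Bool) × (ℕ → Bool)) α
    (fun _ => false, fun _ => false)
    (fun β x => A.act (natMod β) x)
    (fun β _ ih =>
      (fun n => decide (∀ δ < β, ∃ γ, δ ≤ γ ∧ ∃ h : γ < β, (ih γ h).1 n = true),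
       fun n => decide (∀ δ < β, ∃ γ, δ ≤ γ ∧ ∃ h : γ < β, (ih γ h).2 n = true)))

theorem stage_zero : A.stage 0 = (fun _ => false, fun _ => false) := by
  rw [stage, Ordinal.limitRecOn_zero]

theorem stage_add_one (α : Ordinal.{0}) (n : ℕ) :
    A.stage (Ordinal.omega0 * α + (n + 1 : ℕ)) = A.act n (A.stage (Ordinal.omega0 * α + n)) := by
  rw [Nat.cast_add, Nat.cast_one, ← add_assoc, stage, Ordinal.limitRecOn_add_one, natMod_mul_add]
  rfl

theorem stage_limit {α : Ordinal.{0}} (h : Order.IsSuccLimit α) :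
    A.stage α = (fun n => limsupBit α fun γ => (A.stage γ).1 n,
      fun n => limsupBit α fun γ => (A.stage γ).2 n) := by
  rw [stage, Ordinal.limitRecOn_limit _ _ _ _ h]
  simp only [limsupBit, exists_prop]
  rfl

end PassSpec

/-- The registers used by the program of a pass. -/
def passRegs (n v w k a : ℕ) : ℕ → ℕ := fun j =>
  if j = 0 then n else if j = 1 then v else if j = 2 then w else if j = 3 then k
  else if j = 4 then a else 0

section PassRegs

variable (n v w k a x : ℕ)

theorem passRegs_update_zero :
    Function.update (passRegs n v w k a) 0 x = passRegs x v w k a := by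
  funext j; simp only [Function.update_apply, passRegs]; split_ifs <;> rfl

theorem passRegs_update_one :
    Function.update (passRegs n v w k a) 1 x = passRegs n x w k a := by
  funext j; simp only [Function.update_apply, passRegs]; split_ifs <;> first | rfl | omega

theorem passRegs_update_two :
    Function.update (passRegs n v w k a) 2 x = passRegs n v x k a := by
  funext j; simp only [Function.update_apply, passRegs]; split_ifs <;> first | rfl | omega

theorem passRegs_update_three :
    Function.update (passRegs n v w k a) 3 x = passRegs n v w x a := by
  funext j; simp only [Function.update_apply, passRegs]; split_ifs <;> first | rfl | omega

theorem passRegs_update_four :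
    Function.update (passRegs n v w k a) 4 x = passRegs n v w k x := by
  funext j; simp only [Function.update_apply, passRegs]; split_ifs <;> first | rfl | omega

theorem passRegs_eq_zero {j : ℕ} (h : 5 ≤ j) : passRegs n v w k a j = 0 := by
  simp only [passRegs]; split_ifs <;> omega

end PassRegs

theorem Exec.loop_of {S : Set ((ℕ → Bool) × (ℕ → Bool))} {r n : ℕ} {c : Cmd} (f : ℕ → Store)
    (hf : ∀ k, (f k).regs r = k)
    (h : ∀ k < n, Exec S c { f (k + 1) with regs := Function.update (f (k + 1)).regs r k } (f k)) :
    Exec S (.loop r c) (f n) (f 0) := by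
  induction n with
  | zero => exact Exec.loopZero (hf 0)
  | succ n ih =>
    exact Exec.loopSucc (hf (n + 1)) (h n (by omega)) (ih (fun k hk => h k (by omega)))

theorem RExec.exec {c : Cmd} {ρ ρ' : ℕ → ℕ} (h : RExec c ρ ρ')
    {S : Set ((ℕ → Bool) × (ℕ → Bool))} {D O : ℕ → Bool} {P : ℕ} :
    Exec S c ⟨ρ, D, P, O⟩ ⟨ρ', D, P, O⟩ :=
  (h D P O).mono (Set.empty_subset S)

/-- Doubling register `2`. -/
def Cmd.double : Cmd := .seq (.move 2 5) (.loop 5 (.seq (.inc 2) (.inc 2)))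

theorem RExec.double (n v w k a : ℕ) :
    RExec .double (passRegs n v w k a) (passRegs n v (2 * w) k a) := by
  have h1 := RExec.move (r := 2) (o := 5) (ρ := passRegs n v w k a) (by omega) rfl
  refine h1.seq ?_
  have := RExec.loop (r := 5) (n := w) (c := .seq (.inc 2) (.inc 2))
    (fun i => Function.update (passRegs n v (2 * (w - i)) k a) 5 i) (fun k => by simp)
    (fun i hi => ?_)
  · convert this using 1
    · rw [passRegs_update_two, Nat.sub_self, mul_zero]; rfl
    · rw [Nat.sub_zero]
      exact (Function.update_eq_self 5 (passRegs n v (2 * w) k a)).symm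
  · convert (RExec.inc 2 _).seq (RExec.inc 2 _) using 1
    funext j
    by_cases h2 : j = 2
    · subst h2
      simp [Function.update_apply, passRegs]
      omega
    · by_cases h5 : j = 5 <;> simp [Function.update_apply, passRegs, h2, h5]

/-- Computing the window of the bit array of length given in register `1`. -/
def Cmd.readWindow : Cmd := .loop 1 (.seq .double (.rd 1 (.inc 2)))

theorem exec_readWindow {S : Set ((ℕ → Bool) × (ℕ → Bool))} {D O : ℕ → Bool} {P : ℕ}
    (n b k a : ℕ) : Exec S .readWindow ⟨passRegs n b 0 k a, D, P, O⟩
      ⟨passRegs n 0 (window D b 0) k a, D, P, O⟩ := by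
  have := Exec.loop_of (S := S) (r := 1) (n := b) (c := .seq .double (.rd 1 (.inc 2)))
    (fun i => ⟨passRegs n i (window D (b - i) i) k a, D, P, O⟩) (fun i => rfl) (fun i hi => ?_)
  · simp only [Nat.sub_self, Nat.sub_zero] at this
    exact this
  · simp only [passRegs_update_one]
    refine Exec.seq (RExec.double n i _ k a).exec ?_
    rw [show b - i = (b - (i + 1)) + 1 by omega, window, Nat.bit_val]
    cases hD : D i with
    | false => exact Exec.rdFalse hD
    | true =>
      have h := RExec.inc 2 (passRegs n i (2 * window D (b - (i + 1)) (i + 1)) k a)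
      rw [passRegs_update_two] at h
      exact Exec.rdTrue hD h.exec

/-- Moving register `4` to the output pointer. -/
theorem exec_loop_incP {S : Set ((ℕ → Bool) × (ℕ → Bool))} {D O : ℕ → Bool}
    (n v w k a : ℕ) : Exec S (.loop 4 .incP) ⟨passRegs n v w k a, D, 0, O⟩
      ⟨passRegs n v w k 0, D, a, O⟩ := by
  have := Exec.loop_of (S := S) (r := 4) (n := a) (c := .incP)
    (fun i => ⟨passRegs n v w k i, D, a - i, O⟩) (fun i => rfl) (fun i hi => ?_)
  · simpa using this
  · simp only [passRegs_update_four]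
    rw [show a - i = (a - (i + 1)) + 1 by omega]
    exact Exec.incP

/-- The step of a pass is performed by a structured program. -/
theorem PassSpec.exists_cmd (A : PassSpec) : ∃ c : Cmd, ∀ (n v : ℕ) (x : (ℕ → Bool) × (ℕ → Bool)),
    Exec {x, A.act n x} c ⟨passRegs n v 0 0 0, x.1, 0, x.2⟩
      ⟨passRegs (n + 1) 0 0 0 0, (A.act n x).1, 0, (A.act n x).2⟩ := by
  obtain ⟨cb, hb⟩ := exists_cmd_primrec A.bnd_primrec (a := 0) (o := 1) (t := 6)
    (by omega) (by omega) (by omega)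
  obtain ⟨ck, hk⟩ := exists_cmd_primrec₂ A.kind_primrec (a := 0) (b := 2) (o := 3) (t := 6)
    (by omega) (by omega) (by omega) (by omega) (by omega)
  obtain ⟨ca, ha⟩ := exists_cmd_primrec₂ A.addr_primrec (a := 0) (b := 2) (o := 4) (t := 6)
    (by omega) (by omega) (by omega) (by omega) (by omega)
  refine ⟨.seq (.clear 1) (.seq cb (.seq .readWindow (.seq ck (.seq ca (.seq (.clear 2) (.seq
    (.cases 3 (.wr 4 false) (.cases 3 (.wr 4 true) (.seq (.loop 4 .incP) .out)))
    (.seq (.clear 3) (.seq (.clear 4) (.inc 0))))))))), fun n v x => ?_⟩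
  set S : Set ((ℕ → Bool) × (ℕ → Bool)) := {x, A.act n x} with hS
  set w := window x.1 (A.bnd n) 0 with hw
  have hz : ∀ n v w k a, ∀ j, 6 ≤ j → passRegs n v w k a j = 0 :=
    fun n v w k a j hj => passRegs_eq_zero n v w k a (by omega)
  have h1 := RExec.clear 1 (passRegs n v 0 0 0)
  rw [passRegs_update_one] at h1
  have h2 := hb (passRegs n 0 0 0 0) rfl (hz _ _ _ _ _)
  rw [passRegs_update_one] at h2
  have h3 := hk (passRegs n 0 w 0 0) rfl (hz _ _ _ _ _)
  rw [passRegs_update_three] at h3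
  have h4 := ha (passRegs n 0 w (A.kind n w) 0) rfl (hz _ _ _ _ _)
  rw [passRegs_update_four] at h4
  have h5 := RExec.clear 2 (passRegs n 0 w (A.kind n w) (A.addr n w))
  rw [passRegs_update_two] at h5
  have hfin : ∀ k a, RExec (.seq (.clear 3) (.seq (.clear 4) (.inc 0))) (passRegs n 0 0 k a)
      (passRegs (n + 1) 0 0 0 0) := by
    intro k a
    have h6 := RExec.clear 3 (passRegs n 0 0 k a)
    rw [passRegs_update_three] at h6
    have h7 := RExec.clear 4 (passRegs n 0 0 0 a)
    rw [passRegs_update_four] at h7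
    have h8 := RExec.inc 0 (passRegs n 0 0 0 0)
    rw [passRegs_update_zero] at h8
    exact h6.seq (h7.seq h8)
  refine h1.exec.seq (h2.exec.seq ((exec_readWindow n _ 0 0).seq (h3.exec.seq (h4.exec.seq
    (h5.exec.seq ?_)))))
  suffices h : ∃ k a, Exec S (.cases 3 (.wr 4 false) (.cases 3 (.wr 4 true)
      (.seq (.loop 4 .incP) .out))) ⟨passRegs n 0 0 (A.kind n w) (A.addr n w), x.1, 0, x.2⟩
      ⟨passRegs n 0 0 k a, (A.act n x).1, 0, (A.act n x).2⟩ by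
    obtain ⟨k, a, h⟩ := h
    exact h.seq (hfin k a).exec
  have hmem : A.act n x ∈ S := by simp [hS]
  have hact : A.act n x = if A.kind n w = 0 then (Function.update x.1 (A.addr n w) false, x.2)
      else if A.kind n w = 1 then (Function.update x.1 (A.addr n w) true, x.2)
      else (x.1, Function.update x.2 (A.addr n w) true) := rfl
  obtain hk0 | hk0 | ⟨m, hk0⟩ : A.kind n w = 0 ∨ A.kind n w = 1 ∨ ∃ m, A.kind n w = m + 2 := by
    rcases A.kind n w with _ | _ | m
    · simp
    · simp
    · exact Or.inr (Or.inr ⟨m, rfl⟩)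
  · rw [hk0, if_pos rfl] at hact
    rw [hact] at hmem ⊢
    rw [hk0]
    exact ⟨_, _, Exec.casesZero rfl (Exec.wr hmem)⟩
  · rw [hk0, if_neg (by omega), if_pos rfl] at hact
    rw [hact] at hmem ⊢
    rw [hk0]
    refine ⟨0, A.addr n w, Exec.casesSucc (k := 0) rfl ?_⟩
    simp only [passRegs_update_three]
    exact Exec.casesZero rfl (Exec.wr hmem)
  · rw [hk0, if_neg (by omega), if_neg (by omega)] at hact
    rw [hact] at hmem ⊢
    rw [hk0]
    refine ⟨m, 0, Exec.casesSucc (k := m + 1) rfl ?_⟩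
    simp only [passRegs_update_three]
    refine Exec.casesSucc (k := m) rfl ?_
    simp only [passRegs_update_three]
    exact (exec_loop_incP ..).seq (Exec.out hmem)

end

section

open Relation

theorem reflTransGen_of_sStep {pr : List Instr} {K : ℕ} {S : Set ((ℕ → Bool) × (ℕ → Bool))}
    (hK : ∀ ins ∈ pr, ins.reg + 2 < K) (hK2 : 2 ≤ K) {x y : ℕ × Store}
    (h : ReflTransGen (SStep pr S) x y) :
    ReflTransGen (GStep (rtm pr K) S) (goConf pr K x.1 x.2) (goConf pr K y.1 y.2) := by
  induction h with
  | refl => exact .refl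
  | tail _ h ih => exact ih.trans (transGen_of_iStep hK hK2 h.1 h.2.1 h.2.2).to_reflTransGen

/-- The program executing a `PassSpec`, preceded by a test of the bit `hb` of the bit array. -/
theorem PassSpec.exists_program (A : PassSpec) (hb : ℕ) :
    ∃ (pr : List Instr) (K pc : ℕ), 2 ≤ K ∧
      (∀ D O, D hb = true → ∃ c, TransGen (GStep (rtm pr K) {(D, O)})
        (goConf pr K 0 ⟨fun _ => 0, D, 0, O⟩) c ∧ c.state = .halt ∧ c.t2 = O) ∧
      (∀ D O, D hb = false → TransGen (GStep (rtm pr K) {(D, O)})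
        (goConf pr K 0 ⟨fun _ => 0, D, 0, O⟩)
        (goConf pr K pc ⟨passRegs 0 hb 0 0 0, D, 0, O⟩)) ∧
      (∀ n v x, TransGen (GStep (rtm pr K) {x, A.act n x})
        (goConf pr K pc ⟨passRegs n v 0 0 0, x.1, 0, x.2⟩)
        (goConf pr K pc ⟨passRegs (n + 1) 0 0 0 0, (A.act n x).1, 0, (A.act n x).2⟩)) := by
  obtain ⟨body, hbody⟩ := A.exists_cmd
  obtain ⟨c0, hc0⟩ := exists_cmd_primrec (Primrec.const hb) (a := 0) (o := 1) (t := 6)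
    (by omega) (by omega) (by omega)
  set n0 := c0.size with hn0
  obtain ⟨pr, hpr⟩ : ∃ pr : List Instr, pr = c0.comp 0 ++
    ([.rd 1 (n0 + 2), .jmp (n0 + 3), .halt] ++ (body.comp (n0 + 3) ++ [.jmp (n0 + 3)])) := ⟨_, rfl⟩
  have hcode : CodeAt pr 0 pr := fun i ins h => by rwa [zero_add]
  nth_rw 2 [hpr] at hcode
  simp only [codeAt_append, codeAt_cons, Cmd.length_comp, List.length_cons, List.length_nil,
    zero_add, ← hn0] at hcode
  obtain ⟨h1, ⟨h2, h3, h4, -⟩, h5, h6, -⟩ := hcode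
  set K := (pr.map Instr.reg).sum + 3 with hKdef
  have hK : ∀ ins ∈ pr, ins.reg + 2 < K := by
    intro ins hins
    have := List.single_le_sum (l := pr.map Instr.reg) (by simp) _ (List.mem_map_of_mem hins)
    omega
  have hK2 : 2 ≤ K := by omega
  have hpre : ∀ D O, ReflTransGen (GStep (rtm pr K) {(D, O)})
      (goConf pr K 0 ⟨fun _ => 0, D, 0, O⟩) (goConf pr K n0 ⟨passRegs 0 hb 0 0 0, D, 0, O⟩) := by
    intro D O
    have h := hc0 (passRegs 0 0 0 0 0) rfl (fun j hj => passRegs_eq_zero _ _ _ _ _ (by omega))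
    rw [passRegs_update_one] at h
    have h' := reflTransGen_of_sStep hK hK2 ((h.exec (S := {(D, O)}) (D := D) (O := O)
      (P := 0)).steps rfl h1)
    rw [zero_add] at h'
    convert h' using 3
    funext j
    simp [passRegs]
  refine ⟨pr, K, n0 + 3, hK2, fun D O h => ?_, fun D O h => ?_, fun n v x => ?_⟩
  · have hr := transGen_of_iStep (S := {(D, O)}) (s := ⟨passRegs 0 hb 0 0 0, D, 0, O⟩) hK hK2
      (IStep.rd h2) rfl rfl
    rw [if_pos (by exact h)] at hr
    refine ⟨⟨.halt, 1, unary 0, scratch K (passRegs 0 hb 0 0 0) D, O⟩, ?_, rfl, rfl⟩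
    refine (TransGen.trans_right (hpre D O) hr).tail ⟨?_, ?_, step_halt h4⟩
    · simp [goConf]
    · simp [goConf, dTrack_scratch hK2]
  · have hr := transGen_of_iStep (S := {(D, O)}) (s := ⟨passRegs 0 hb 0 0 0, D, 0, O⟩) hK hK2
      (IStep.rd h2) rfl rfl
    rw [if_neg (by simpa [passRegs] using h)] at hr
    exact (TransGen.trans_right (hpre D O) hr).trans
      (transGen_of_iStep hK hK2 (IStep.jmp h3) rfl rfl)
  · have h := reflTransGen_of_sStep hK hK2 ((hbody n v x).steps (by simp) h5)
    exact TransGen.trans_right h (transGen_of_iStep hK hK2 (IStep.jmp h6) (by simp) (by simp))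

/-- The bit array and output array of a configuration. -/
def track {N K : ℕ} (c : Conf (RState N K)) : (ℕ → Bool) × (ℕ → Bool) := (dTrack K c.t1, c.t2)

theorem exists_iterate_of_transGen {N K : ℕ} {M : TM (RState N K)}
    {S : Set ((ℕ → Bool) × (ℕ → Bool))} {c c' : Conf (RState N K)}
    (h : TransGen (GStep M S) c c') : ∃ m, 0 < m ∧ M.step^[m] c = c' ∧
      ∀ i < m, (M.step^[i] c).state ≠ .halt ∧ track (M.step^[i] c) ∈ S := by
  induction h with
  | single h => exact ⟨1, one_pos, h.2.2, fun i hi => by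
      obtain rfl : i = 0 := by omega
      exact ⟨h.1, h.2.1⟩⟩
  | tail _ h ih =>
    obtain ⟨m, h1, h2, h3⟩ := ih
    refine ⟨m + 1, by omega, ?_, fun i hi => ?_⟩
    · rw [Function.iterate_succ_apply', h2, h.2.2]
    · obtain hi | rfl : i < m ∨ i = m := by omega
      · exact h3 i hi
      · rw [h2]
        exact ⟨h.1, h.2.1⟩

/-- An infinite concatenation of finite computations. -/
theorem iterate_of_forall_transGen {N K : ℕ} {M : TM (RState N K)}
    {y : ℕ → Conf (RState N K)}
    (h : ∀ n, TransGen (GStep M {track (y n), track (y (n + 1))}) (y n) (y (n + 1))) :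
    (∀ i, (M.step^[i] (y 0)).state ≠ .halt) ∧
    (∀ k, ∃ n, ∀ i ≥ n, ∃ k' ≥ k, track (M.step^[i] (y 0)) = track (y k')) ∧
    (∀ i, ∃ k', track (M.step^[i] (y 0)) = track (y k')) ∧
    (∀ k, ∃ i ≥ k, M.step^[i] (y 0) = y k) := by
  choose m hm0 hm1 hm2 using fun n => exists_iterate_of_transGen (h n)
  let t : ℕ → ℕ := fun k => Nat.rec 0 (fun n r => r + m n) k
  have ht : ∀ k, t (k + 1) = t k + m k := fun k => rfl
  have hmono : StrictMono t := strictMono_nat_of_lt_succ fun k => by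
    have := hm0 k; rw [ht]; omega
  have hty : ∀ k, M.step^[t k] (y 0) = y k := by
    intro k
    induction k with
    | zero => rfl
    | succ k ih => rw [ht, add_comm, Function.iterate_add_apply, ih, hm1]
  have hloc : ∀ i k, t k ≤ i → ∃ k' ≥ k, t k' ≤ i ∧ i < t k' + m k' := by
    intro i k hk
    have hex : ∃ j, i < t (j + 1) := ⟨i, lt_of_lt_of_le (Nat.lt_succ_self i) (hmono.id_le _)⟩
    refine ⟨Nat.find hex, ?_, ?_, ?_⟩
    · by_contra hlt
      have h1 := Nat.find_spec hex
      have h2 := hmono.monotone (show Nat.find hex + 1 ≤ k by omega)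
      omega
    · rcases hj : Nat.find hex with _ | j
      · exact Nat.zero_le _
      · have := Nat.find_min hex (show j < Nat.find hex by omega)
        omega
    · exact ht _ ▸ Nat.find_spec hex
  have hprop : ∀ i k, t k ≤ i → (M.step^[i] (y 0)).state ≠ .halt ∧
      ∃ k' ≥ k, track (M.step^[i] (y 0)) = track (y k') := by
    intro i k hk
    obtain ⟨k', h1, h2, h3⟩ := hloc i k hk
    obtain ⟨j, rfl⟩ := Nat.exists_eq_add_of_le h2
    rw [add_comm, Function.iterate_add_apply, hty]
    obtain ⟨h4, h5⟩ := hm2 k' j (by omega)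
    refine ⟨h4, ?_⟩
    rcases h5 with h5 | h5
    · exact ⟨k', h1, h5⟩
    · exact ⟨k' + 1, by omega, h5⟩
  refine ⟨fun i => (hprop i 0 (Nat.zero_le _)).1, fun k => ⟨t k, fun i hi => (hprop i k hi).2⟩,
    fun i => ?_, fun k => ⟨t k, hmono.id_le k, hty k⟩⟩
  obtain ⟨k', -, h⟩ := (hprop i 0 (Nat.zero_le _)).2
  exact ⟨k', h⟩

end

section

open Relation Ordinal

/-- The computation of the machine executing the program `pr`. -/
structure IsRun (pr : List Instr) (K : ℕ) (conf : Ordinal.{0} → Conf (RState pr.length K)) :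
    Prop where
  zero : conf 0 = ⟨.clean 0, 0, fun _ => false, fun _ => false, fun _ => false⟩
  succ : ∀ α, conf (α + 1) = (rtm pr K).step (conf α)
  limit : ∀ α, Order.IsSuccLimit α → conf α = ⟨.lim, 0,
    fun n => limsupBit α fun γ => (conf γ).t0 n,
    fun n => limsupBit α fun γ => (conf γ).t1 n,
    fun n => limsupBit α fun γ => (conf γ).t2 n⟩

theorem isSuccLimit_add_omega0 (α : Ordinal.{0}) : Order.IsSuccLimit (α + ω) :=
  isSuccLimit_add α isSuccLimit_omega0

namespace IsRun

variable {pr : List Instr} {K : ℕ} {conf : Ordinal.{0} → Conf (RState pr.length K)}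

theorem add_nat (h : IsRun pr K conf) (α : Ordinal.{0}) (n : ℕ) :
    conf (α + n) = (rtm pr K).step^[n] (conf α) := by
  induction n with
  | zero => simp
  | succ n ih =>
    rw [Function.iterate_succ_apply', ← ih, ← h.succ, Nat.cast_succ, add_assoc]

theorem clean_add_nat (h : IsRun pr K conf) (hK : 2 ≤ K) {β : Ordinal.{0}} {t0 t1 t2 : ℕ → Bool}
    (hβ : conf β = ⟨.clean 1, 1, t0, t1, t2⟩) (h0 : t0 0 = false) (h1 : t1 0 = false) (i : ℕ) :
    conf (β + i) = ⟨.clean ((i + 1 : ℕ) : ZMod K), i + 1, fun n => if n < i + 1 then false else t0 n,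
      fun n => if n < i + 1 ∧ n % K ≠ 1 then false else t1 n, t2⟩ := by
  induction i with
  | zero =>
    rw [Nat.cast_zero, add_zero, hβ]
    congr 1
    · simp
    · funext n; split_ifs with hn
      · obtain rfl : n = 0 := by omega
        exact h0
      · rfl
    · funext n; split_ifs with hn
      · obtain rfl : n = 0 := by omega
        exact h1
      · rfl
  | succ i ih =>
    rw [Nat.cast_succ, ← add_assoc, h.succ, ih, rtm_step (st' := .clean ((i + 1 + 1 : ℕ) : ZMod K))
      (w0 := false) (w1 := if (i + 1) % K = 1 then t1 (i + 1) else false) (w2 := t2 (i + 1))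
      (d := true)]
    · congr 1
      · funext n
        simp only [Function.update_apply]
        split_ifs <;> first | rfl | omega
      · funext n
        simp only [Function.update_apply]
        by_cases hn : n = i + 1
        · subst hn
          by_cases hm : (i + 1) % K = 1 <;> simp [hm]
        · rw [if_neg hn]
          congr 1
          simp only [eq_iff_iff]
          constructor <;> rintro ⟨a, b⟩ <;> exact ⟨by omega, b⟩
      · funext n
        simp
    · have : (((i + 1 : ℕ) : ZMod K) = 1) ↔ (i + 1) % K = 1 := natCast_eq_one_iff_mod hK
      by_cases hm : (i + 1) % K = 1
      · simp only [rtrans, if_pos (this.2 hm), hm]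
        simp
      · simp only [rtrans, if_neg (mt this.1 hm), hm]
        simp

theorem clean_add_omega0 (h : IsRun pr K conf) (hK : 2 ≤ K) {β : Ordinal.{0}}
    {t0 t1 t2 : ℕ → Bool} (hβ : conf β = ⟨.clean 1, 1, t0, t1, t2⟩) (h0 : t0 0 = false)
    (h1 : t1 0 = false) :
    conf (β + ω) = ⟨.lim, 0, fun _ => false, fun n => if n % K = 1 then t1 n else false, t2⟩ := by
  have key := h.clean_add_nat hK hβ h0 h1
  rw [h.limit _ (isSuccLimit_add_omega0 β)]
  have aux : ∀ γ n, β + (n : ℕ) ≤ γ → γ < β + ω → ∃ i : ℕ, n ≤ i ∧ γ = β + i := by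
    intro γ n h1 h2
    obtain ⟨i, rfl⟩ := exists_add_nat_of_lt_add_omega0 (le_self_add.trans h1) h2
    exact ⟨i, by simpa using h1, rfl⟩
  congr 1
  · funext n
    refine limsupBit_eq_of_eventually (add_nat_lt_add_omega0 β n) fun γ h1 h2 => ?_
    obtain ⟨i, hi, rfl⟩ := aux γ n h1 h2
    rw [key]
    simp only
    rw [if_pos (by omega)]
  · funext n
    refine limsupBit_eq_of_eventually (add_nat_lt_add_omega0 β n) fun γ h1 h2 => ?_
    obtain ⟨i, hi, rfl⟩ := aux γ n h1 h2
    rw [key]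
    simp only
    by_cases hm : n % K = 1
    · simp [hm]
    · rw [if_pos ⟨by omega, hm⟩, if_neg hm]
  · funext n
    refine limsupBit_eq_of_eventually (add_nat_lt_add_omega0 β n) fun γ h1 h2 => ?_
    obtain ⟨i, hi, rfl⟩ := aux γ n h1 h2
    rw [key]

theorem clean_add_omega0_add_one (h : IsRun pr K conf) (hK : 2 ≤ K) {β : Ordinal.{0}}
    {t0 t1 t2 : ℕ → Bool} (hβ : conf β = ⟨.clean 1, 1, t0, t1, t2⟩) (h0 : t0 0 = false)
    (h1 : t1 0 = false) :
    conf (β + ω + 1) = goConf pr K 0 ⟨fun _ => 0, dTrack K t1, 0, t2⟩ := by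
  rw [h.succ, h.clean_add_omega0 hK hβ h0 h1, rtm_step (st' := .go 0 0) (w0 := false) (w1 := true)
    (w2 := t2 0) (d := false), goConf]
  · congr 1
    · funext n
      simp [Function.update_apply, unary]
    · funext n
      simp only [Function.update_apply, scratch]
      by_cases hn : n = 0
      · simp [hn]
      · rw [if_neg hn]
        by_cases hm : n % K = 0
        · simp [hm, hn]
        · rw [if_neg hm]
          by_cases hm1 : n % K = 1
          · rw [if_pos hm1, if_pos hm1, dTrack, ← eq_mul_add hm1]
          · simp [hm1]
    · simp
  · have : (0 : ℕ) % K ≠ 1 := by simp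
    simp [rtrans]

end IsRun

/-- The length of a block: a pass together with the cleaning of the tapes before it. -/
noncomputable def blockLength : Ordinal.{0} := ω + ω

theorem blockLength_mul_add_one (α : Ordinal.{0}) :
    blockLength * (α + 1) = blockLength * α + ω + ω := by
  rw [mul_add, mul_one, blockLength, ← add_assoc]

theorem block_bounds (s : Ordinal.{0}) : blockLength * (s / blockLength) ≤ s ∧
    s < blockLength * (s / blockLength + 1) := by
  have hW : blockLength ≠ 0 :=
    (lt_of_lt_of_le omega0_pos (by rw [blockLength]; exact le_self_add)).ne'
  exact ⟨mul_div_le s blockLength, by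
    rw [mul_add_one]; exact lt_mul_div_add s hW⟩

/-- The machine is at the beginning of block `α`. -/
def BlockStart (A : PassSpec) {pr : List Instr} {K : ℕ}
    (conf : Ordinal.{0} → Conf (RState pr.length K)) (α : Ordinal.{0}) : Prop :=
  (conf (blockLength * α)).state ≠ .halt ∧ track (conf (blockLength * α)) = A.stage (ω * α) ∧
  ∃ t0 t1 t2, conf (blockLength * α + 1) = ⟨.clean 1, 1, t0, t1, t2⟩ ∧ t0 0 = false ∧
    t1 0 = false ∧ (dTrack K t1, t2) = A.stage (ω * α)

/-- The machine executes block `α` without halting. -/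
def BlockRun (A : PassSpec) {pr : List Instr} {K : ℕ}
    (conf : Ordinal.{0} → Conf (RState pr.length K)) (α : Ordinal.{0}) : Prop :=
  (∀ s, blockLength * α ≤ s → s < blockLength * (α + 1) →
    (conf s).state ≠ .halt ∧ ∃ k : ℕ, track (conf s) = A.stage (ω * α + k)) ∧
  ∀ k : ℕ, ∃ s, blockLength * α ≤ s ∧ s < blockLength * (α + 1) ∧
    track (conf s) = A.stage (ω * α + k) ∧ (conf s).t1 0 = true

section Blocks

variable {A : PassSpec} {pr : List Instr} {K : ℕ}
  {conf : Ordinal.{0} → Conf (RState pr.length K)} {α : Ordinal.{0}}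

theorem track_eq_iff {N : ℕ} {c : Conf (RState N K)} {x : (ℕ → Bool) × (ℕ → Bool)} :
    track c = x ↔ (∀ i, c.t1 (K * i + 1) = x.1 i) ∧ ∀ i, c.t2 i = x.2 i := by
  rw [track, Prod.ext_iff]
  simp only [funext_iff, dTrack]

theorem blockStart_of_lim (h : IsRun pr K conf)
    (hl : (conf (blockLength * α)).state = .lim) (hh : (conf (blockLength * α)).head = 0)
    (hm : (conf (blockLength * α)).t1 0 = true)
    (ht : track (conf (blockLength * α)) = A.stage (ω * α)) : BlockStart A conf α := by
  refine ⟨by simp [hl], ht, ?_⟩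
  rw [h.succ]
  rcases hc : conf (blockLength * α) with ⟨st, hd, t0, t1, t2⟩
  simp only [hc] at hl hh hm
  subst hl hh
  refine ⟨Function.update t0 0 false, Function.update t1 0 false, t2, ?_, by simp, by simp, ?_⟩
  · rw [rtm_step (st' := .clean 1) (w0 := false) (w1 := false) (w2 := t2 0) (d := true)]
    · simp
    · simp [rtrans, hm]
  · rw [← ht, hc, track]
    congr 1

theorem blockStart_zero (h : IsRun pr K conf) (hK : 2 ≤ K) : BlockStart A conf 0 := by
  have h0 : (0 : ZMod K) ≠ 1 := by
    have := natCast_eq_one_iff_mod (K := K) (m := 0) hK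
    simpa using this
  rw [BlockStart, mul_zero, mul_zero, A.stage_zero, h.succ, h.zero]
  refine ⟨by simp, rfl, fun _ => false, fun _ => false, fun _ => false, ?_, rfl, rfl, rfl⟩
  rw [rtm_step (st' := .clean 1) (w0 := false) (w1 := false) (w2 := false) (d := true)]
  · simp
  · simp [rtrans]

theorem BlockStart.lt_omega0 (h : IsRun pr K conf) (hK : 2 ≤ K) (hs : BlockStart A conf α)
    (n : ℕ) : (conf (blockLength * α + n)).state ≠ .halt ∧
      track (conf (blockLength * α + n)) = A.stage (ω * α) := by
  obtain ⟨h1, h2, t0, t1, t2, h3, h4, h5, h6⟩ := hs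
  rcases n with _ | n
  · simpa using ⟨h1, h2⟩
  · rw [show blockLength * α + (n + 1 : ℕ) = blockLength * α + 1 + n by
      rw [Nat.add_comm]; push_cast; rw [add_assoc], h.clean_add_nat hK h3 h4 h5]
    refine ⟨by simp, ?_⟩
    rw [← h6, track]
    congr 1
    funext i
    have : (K * i + 1) % K = 1 := add_mod_of_lt (by omega)
    simp [dTrack, this]

theorem BlockStart.omega0 (h : IsRun pr K conf) (hK : 2 ≤ K) (hs : BlockStart A conf α) :
    (conf (blockLength * α + ω)).state ≠ .halt ∧
      track (conf (blockLength * α + ω)) = A.stage (ω * α) ∧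
    conf (blockLength * α + ω + 1) =
      goConf pr K 0 ⟨fun _ => 0, (A.stage (ω * α)).1, 0, (A.stage (ω * α)).2⟩ := by
  obtain ⟨h1, h2, t0, t1, t2, h3, h4, h5, h6⟩ := hs
  have e : blockLength * α + 1 + ω = blockLength * α + ω := by
    rw [add_assoc, one_add_omega0]
  rw [← e, h.clean_add_omega0_add_one hK h3 h4 h5, h.clean_add_omega0 hK h3 h4 h5, ← h6]
  refine ⟨by simp, ?_, rfl⟩
  rw [track]
  congr 1
  funext i
  have : (K * i + 1) % K = 1 := add_mod_of_lt (by omega)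
  simp [dTrack, this]

theorem BlockStart.next {hb pc : ℕ} (h : IsRun pr K conf) (hK : 2 ≤ K)
    (hpre : ∀ D O, D hb = false → TransGen (GStep (rtm pr K) {(D, O)})
        (goConf pr K 0 ⟨fun _ => 0, D, 0, O⟩)
        (goConf pr K pc ⟨passRegs 0 hb 0 0 0, D, 0, O⟩))
    (hpass : ∀ n v x, TransGen (GStep (rtm pr K) {x, A.act n x})
        (goConf pr K pc ⟨passRegs n v 0 0 0, x.1, 0, x.2⟩)
        (goConf pr K pc ⟨passRegs (n + 1) 0 0 0 0, (A.act n x).1, 0, (A.act n x).2⟩))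
    (hs : BlockStart A conf α) (hhb : (A.stage (ω * α)).1 hb = false) :
    BlockRun A conf α ∧ BlockStart A conf (α + 1) := by
  obtain ⟨hw1, hw2, hw3⟩ := hs.omega0 h hK
  obtain ⟨y, hyz, hys⟩ : ∃ y : ℕ → Conf (RState pr.length K),
      y 0 = goConf pr K 0 ⟨fun _ => 0, (A.stage (ω * α)).1, 0, (A.stage (ω * α)).2⟩ ∧
      ∀ n, y (n + 1) = goConf pr K pc ⟨passRegs n (if n = 0 then hb else 0) 0 0 0,
        (A.stage (ω * α + n)).1, 0, (A.stage (ω * α + n)).2⟩ :=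
    ⟨fun n => Nat.casesOn n
      (goConf pr K 0 ⟨fun _ => 0, (A.stage (ω * α)).1, 0, (A.stage (ω * α)).2⟩)
      fun n => goConf pr K pc ⟨passRegs n (if n = 0 then hb else 0) 0 0 0,
        (A.stage (ω * α + n)).1, 0, (A.stage (ω * α + n)).2⟩, rfl, fun _ => rfl⟩
  have hgo : ∀ pc s, track (goConf pr K pc s) = (s.D, s.O) := by
    intro pc s
    simp [track, goConf, dTrack_scratch hK]
  have hy : ∀ n, track (y n) = A.stage (ω * α + (n - 1 : ℕ)) := by
    rintro (_ | n)
    · simp [hyz, hgo]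
    · simp [hys, hgo]
  have hy0 : ∀ n, (y n).t1 0 = true := by
    rintro (_ | n) <;> simp [hyz, hys, goConf, scratch_zero]
  have hstep : ∀ n, TransGen (GStep (rtm pr K) {track (y n), track (y (n + 1))})
      (y n) (y (n + 1)) := by
    rintro (_ | n)
    · have := hpre _ (A.stage (ω * α)).2 hhb
      rw [hy, hy]
      simpa [hyz, hys] using this
    · have := hpass n (if n = 0 then hb else 0) (A.stage (ω * α + n))
      rw [hy, hy, Nat.add_sub_cancel, Nat.add_sub_cancel, A.stage_add_one]
      rw [hys, hys, A.stage_add_one, if_neg (Nat.succ_ne_zero n)]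
      exact this
  obtain ⟨p1, p2, p3, p4⟩ := iterate_of_forall_transGen hstep
  set β := blockLength * α + ω + 1 with hβ
  have hβω : β + ω = blockLength * α + ω + ω := by rw [hβ, add_assoc _ 1, one_add_omega0]
  have hc : ∀ i : ℕ, conf (β + i) = (rtm pr K).step^[i] (y 0) := by
    intro i
    rw [h.add_nat, hw3, hyz]
  constructor
  · constructor
    · intro s hs1 hs2
      rw [blockLength_mul_add_one] at hs2
      rcases lt_or_ge s (blockLength * α + ω) with hlt | hge
      · obtain ⟨n, rfl⟩ := exists_add_nat_of_lt_add_omega0 hs1 hlt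
        obtain ⟨q1, q2⟩ := hs.lt_omega0 h hK n
        exact ⟨q1, 0, by simpa using q2⟩
      · obtain ⟨n, rfl⟩ := exists_add_nat_of_lt_add_omega0 hge hs2
        rcases n with _ | n
        · exact ⟨by simpa using hw1, 0, by simpa using hw2⟩
        · rw [show blockLength * α + ω + (n + 1 : ℕ) = β + n by
            rw [Nat.add_comm, hβ]; push_cast; rw [add_assoc _ 1], hc]
          obtain ⟨k, hk⟩ := p3 n
          exact ⟨p1 n, _, hk.trans (hy k)⟩
    · intro k
      obtain ⟨i, -, hi⟩ := p4 (k + 1)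
      refine ⟨β + i, ?_, ?_, ?_, ?_⟩
      · rw [hβ, add_assoc, add_assoc]; exact le_self_add
      · rw [blockLength_mul_add_one, ← hβω]; exact add_nat_lt_add_omega0 β i
      · rw [hc, hi, hy, Nat.add_sub_cancel]
      · rw [hc, hi, hy0]
  · have hlim := h.limit _ (isSuccLimit_add_omega0 β)
    have hbl : blockLength * (α + 1) = β + ω := by rw [blockLength_mul_add_one, hβω]
    apply blockStart_of_lim h
    · rw [hbl, hlim]
    · rw [hbl, hlim]
    · rw [hbl, hlim]
      simp only
      rw [limsupBit_add_omega0]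
      intro n
      obtain ⟨i, hi, hi'⟩ := p4 n
      exact ⟨i, hi, by rw [hc, hi', hy0]⟩
    · have hst : A.stage (ω * (α + 1)) = (fun n => limsupBit (ω * α + ω) fun γ => (A.stage γ).1 n,
          fun n => limsupBit (ω * α + ω) fun γ => (A.stage γ).2 n) := by
        rw [mul_add, mul_one, A.stage_limit (isSuccLimit_add_omega0 _)]
      have key : ∀ g : (ℕ → Bool) × (ℕ → Bool) → Bool,
          limsupBit (β + ω) (fun γ => g (track (conf γ))) =
            limsupBit (ω * α + ω) (fun γ => g (A.stage γ)) := by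
        intro g
        rw [Bool.eq_iff_iff, limsupBit_add_omega0, limsupBit_add_omega0]
        constructor
        · intro H n
          obtain ⟨m, hm⟩ := p2 (n + 1)
          obtain ⟨i, hi, hi'⟩ := H m
          obtain ⟨k', hk', e⟩ := hm i hi
          rw [hc, e, hy] at hi'
          exact ⟨k' - 1, by omega, hi'⟩
        · intro H n
          obtain ⟨m, hm, hm'⟩ := H n
          obtain ⟨i, hi, hi'⟩ := p4 (m + 1)
          refine ⟨i, by omega, ?_⟩
          rw [hc, hi', hy, Nat.add_sub_cancel, hm']
      rw [hbl, hlim, hst, track_eq_iff]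
      exact ⟨fun i => key fun x => x.1 i, fun i => key fun x => x.2 i⟩

theorem blockStart_limit (h : IsRun pr K conf) (hα : Order.IsSuccLimit α)
    (hrun : ∀ α' < α, BlockRun A conf α') : BlockStart A conf α := by
  have hW : 0 < blockLength := lt_of_lt_of_le omega0_pos (by rw [blockLength]; exact le_self_add)
  have hl : Order.IsSuccLimit (blockLength * α) := isSuccLimit_mul_right hW hα
  have hl' : Order.IsSuccLimit (ω * α) := isSuccLimit_mul_right omega0_pos hα
  have hlim := h.limit _ hl
  have key : ∀ g : (ℕ → Bool) × (ℕ → Bool) → Bool,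
      limsupBit (blockLength * α) (fun γ => g (track (conf γ))) =
        limsupBit (ω * α) (fun γ => g (A.stage γ)) := by
    intro g
    rw [Bool.eq_iff_iff, limsupBit_eq_true, limsupBit_eq_true]
    constructor
    · intro H δ hδ
      obtain ⟨α', hα', hδ'⟩ := (lt_mul_iff_of_isSuccLimit hα).1 hδ
      obtain ⟨s, hs1, hs2, hs3⟩ := H (blockLength * α') (by gcongr)
      obtain ⟨h1, h2⟩ := block_bounds s
      have hlt : s / blockLength < α := (lt_mul_iff_div_lt hW.ne').1 hs2
      obtain ⟨-, k, hk⟩ := (hrun _ hlt).1 s h1 h2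
      refine ⟨ω * (s / blockLength) + k, ?_, ?_, by rw [← hk]; exact hs3⟩
      · refine hδ'.le.trans (le_trans ?_ le_self_add)
        gcongr
        exact (mul_le_iff_le_div hW.ne').1 hs1
      · refine lt_of_lt_of_le (add_nat_lt_add_omega0 _ k) ?_
        rw [← mul_add_one]
        gcongr
        exact hα.add_one_lt hlt |>.le
    · intro H s hs
      obtain ⟨α', hα', hs'⟩ := (lt_mul_iff_of_isSuccLimit hα).1 hs
      obtain ⟨δ, hδ1, hδ2, hδ3⟩ := H (ω * α') (by gcongr; exact omega0_pos)
      have hlt : δ / ω < α := (lt_mul_iff_div_lt omega0_ne_zero).1 hδ2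
      obtain ⟨k, hk⟩ := lt_omega0.1 (mod_lt δ omega0_ne_zero)
      obtain ⟨s', h1, h2, h3, -⟩ := (hrun _ hlt).2 k
      rw [← hk, div_add_mod] at h3
      refine ⟨s', ?_, ?_, by rw [h3]; exact hδ3⟩
      · refine hs'.le.trans (le_trans ?_ h1)
        gcongr
        exact (mul_le_iff_le_div omega0_ne_zero).1 hδ1
      · refine lt_of_lt_of_le h2 ?_
        gcongr
        exact hα.add_one_lt hlt |>.le
  apply blockStart_of_lim h
  · rw [hlim]
  · rw [hlim]
  · rw [hlim]
    simp only
    rw [limsupBit_eq_true]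
    intro s hs
    obtain ⟨α', hα', hs'⟩ := (lt_mul_iff_of_isSuccLimit hα).1 hs
    obtain ⟨s', h1, h2, -, h3⟩ := (hrun α' hα').2 0
    refine ⟨s', hs'.le.trans h1, lt_of_lt_of_le h2 ?_, h3⟩
    gcongr
    exact (hα.add_one_lt hα').le
  · rw [hlim, A.stage_limit hl', track_eq_iff]
    exact ⟨fun i => key fun x => x.1 i, fun i => key fun x => x.2 i⟩

end Blocks

/-- A `PassSpec` is executed by a machine, which halts before the first pass beginning with the
bit `hb` set. -/
theorem PassSpec.exists_machine (A : PassSpec) (hb : ℕ) : ∃ M : Machine,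
    (∀ α, (A.stage (ω * α)).1 hb = true → (∀ α' < α, (A.stage (ω * α')).1 hb = false) →
      ∃ s, M.haltsAt zeroR s ∧ blockLength * α ≤ s ∧ s < blockLength * (α + 1) ∧
        (M.snap zeroR s).tape 2 = (A.stage (ω * α)).2) ∧
    ((∀ α, (A.stage (ω * α)).1 hb = false) → ¬ M.halts zeroR ∧
      ∀ s, ∃ δ, ω * (s / blockLength) ≤ δ ∧ (M.snap zeroR s).tape 2 = (A.stage δ).2) := by
  obtain ⟨pr, K, pc, hK, hhalt, hpre, hpass⟩ := A.exists_program hb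
  have : NeZero K := ⟨by omega⟩
  obtain ⟨M, conf, hM1, hM2, c0, c1, c2⟩ := (rtm pr K).exists_machine
  have h : IsRun pr K conf := ⟨c0, c1, c2⟩
  have hnext : ∀ α, BlockStart A conf α → (A.stage (ω * α)).1 hb = false →
    BlockRun A conf α ∧ BlockStart A conf (α + 1) := fun α => BlockStart.next h hK hpre hpass
  have hstart : ∀ α, (∀ α' < α, (A.stage (ω * α')).1 hb = false) → BlockStart A conf α := by
    intro α
    induction α using Ordinal.limitRecOn with
    | zero => exact fun _ => blockStart_zero h hK
    | add_one α ih =>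
      intro hα
      exact (hnext α (ih fun α' h' => hα α' (h'.trans (lt_add_one α))) (hα α (lt_add_one α))).2
    | limit α hl ih =>
      intro hα
      exact blockStart_limit h hl fun α' h' =>
        (hnext α' (ih α' h' fun α'' h'' => hα α'' (h''.trans h')) (hα α' h')).1
  have hrun : ∀ α, (∀ α' ≤ α, (A.stage (ω * α')).1 hb = false) → BlockRun A conf α :=
    fun α hα => (hnext α (hstart α fun α' h' => hα α' h'.le) (hα α le_rfl)).1
  have hW : 0 < blockLength := lt_of_lt_of_le omega0_pos (by rw [blockLength]; exact le_self_add)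
  refine ⟨M, fun α hα hlt => ?_, fun hα => ?_⟩
  · have hs := hstart α hlt
    obtain ⟨hw1, hw2, hw3⟩ := hs.omega0 h hK
    obtain ⟨c, hc1, hc2, hc3⟩ := hhalt _ (A.stage (ω * α)).2 hα
    obtain ⟨m, -, hm1, hm2⟩ := exists_iterate_of_transGen hc1
    have hm : conf (blockLength * α + ω + 1 + m) = c := by rw [h.add_nat, hw3, hm1]
    refine ⟨blockLength * α + ω + 1 + m, ⟨?_, ?_⟩, ?_, ?_, ?_⟩
    · rw [hM1, hm, hc2]; rfl
    · intro s hs'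
      rw [hM1]
      change (conf s).state ≠ .halt
      rcases lt_or_ge s (blockLength * α) with h1 | h1
      · have hd : s / blockLength < α := (lt_mul_iff_div_lt hW.ne').1 h1
        obtain ⟨h2, h3⟩ := block_bounds s
        exact ((hrun _ fun α' h' => hlt α' (h'.trans_lt hd)).1 s h2 h3).1
      rcases lt_or_ge s (blockLength * α + ω) with h2 | h2
      · obtain ⟨n, rfl⟩ := exists_add_nat_of_lt_add_omega0 h1 h2
        exact (hs.lt_omega0 h hK n).1
      have h3 : s < blockLength * α + ω + ω := by
        refine hs'.trans ?_
        rw [add_assoc _ 1, ← Nat.cast_one, ← Nat.cast_add]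
        exact add_nat_lt_add_omega0 _ _
      obtain ⟨n, rfl⟩ := exists_add_nat_of_lt_add_omega0 h2 h3
      rcases n with _ | n
      · simpa using hw1
      · have e : blockLength * α + ω + (n + 1 : ℕ) = blockLength * α + ω + 1 + n := by
          rw [Nat.add_comm]; push_cast; rw [add_assoc _ 1]
        rw [e] at hs' ⊢
        rw [h.add_nat, hw3]
        exact (hm2 n (by simpa using hs')).1
    · rw [add_assoc, add_assoc]; exact le_self_add
    · rw [blockLength_mul_add_one, add_assoc _ 1, ← Nat.cast_one, ← Nat.cast_add]
      exact add_nat_lt_add_omega0 _ _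
    · rw [hM2, hm, hc3]
  · have hb' : ∀ s, (conf s).state ≠ .halt ∧ ∃ k : ℕ,
        track (conf s) = A.stage (ω * (s / blockLength) + k) := by
      intro s
      obtain ⟨h2, h3⟩ := block_bounds s
      exact (hrun _ fun α' _ => hα α').1 s h2 h3
    refine ⟨?_, fun s => ?_⟩
    · rintro ⟨s, hs⟩
      exact (hb' s).1 ((hM1 s).1 hs)
    · obtain ⟨-, k, hk⟩ := hb' s
      exact ⟨_, le_self_add, by rw [hM2, ← hk]; rfl⟩

end

/-- The address of a bit of the bit array of the universal machine. -/
def uaddr (tag u v : ℕ) : ℕ := Nat.pair tag (Nat.pair u v)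

/-- The entries of the list coded by the second component of `q`, which describe the machine
with code `q`. -/
def codeField (q i : ℕ) : ℕ := (Denumerable.ofNat (List ℕ) q.unpair.2).getD i 0

/-- The code of the transition in state `st` on reading `b0`, `b1`, `b2`. -/
def codeEntry (q st : ℕ) (b0 b1 b2 : Bool) : ℕ :=
  codeField q (4 + 8 * st + (b0.toNat + 2 * b1.toNat + 4 * b2.toNat))

/-- The state and head position of the machine with code `q` at step `t` of a pass, recovered
from the recorded bits. -/
def ucfg (look : ℕ → Bool) (q : ℕ) : ℕ → ℕ × ℕ
  | 0 => (bif look (uaddr 2 q 0) then codeField q 2 % (codeField q 0 + 1)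
      else codeField q 1 % (codeField q 0 + 1), 0)
  | t + 1 =>
    let e := codeEntry q (ucfg look q t).1 (look (uaddr 7 q t)) (look (uaddr 8 q t))
      (look (uaddr 9 q t))
    (e / 16 % (codeField q 0 + 1),
      bif e.testBit 3 then (ucfg look q t).2 + 1 else (ucfg look q t).2 - 1)

/-- The code of the transition at step `t` of a pass. -/
def uentry (look : ℕ → Bool) (q t : ℕ) : ℕ :=
  codeEntry q (ucfg look q t).1 (look (uaddr 7 q t)) (look (uaddr 8 q t)) (look (uaddr 9 q t))

/-- The relation whose well-founded part is removed, read off the output of program `p`. -/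
def urel (look : ℕ → Bool) (p b a : ℕ) : Bool :=
  !(b == 0) && (a == 0 || look (uaddr 12 p (Nat.pair (b - 1) (a - 1))))

/-- The condition that `k` halts before `k'` and `k'` before `p`, and `k'` halts at step `t`. -/
def ubefore (look : ℕ → Bool) (p k k' t : ℕ) : Bool :=
  !look (uaddr 4 k' t) && look (uaddr 4 k' (t + 1)) &&
    (look (uaddr 4 k t) || look (uaddr 4 k (t + 1)) && decide (k < k')) &&
    !look (uaddr 4 p t) && (!look (uaddr 4 p (t + 1)) || decide (k' < p))

/-- The kind and address of the write of the universal machine with parameter `p` in the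
`j`-th part of its work on step `t` of program `q`. -/
def univ (p : ℕ) (look : ℕ → Bool) (q t j : ℕ) : ℕ × ℕ :=
  bif j == 0 then bif t == 0 then ((look (uaddr 1 q 0)).toNat, uaddr 2 q 0) else (0, 0) else
  bif j == 1 then bif t == 0 then ((look (uaddr 3 q 0)).toNat, uaddr 4 q 0) else (0, 0) else
  bif j == 2 then bif t == 0 then (1, uaddr 1 q 0) else (0, 0) else
  bif j == 3 then ((look (uaddr 4 q t) ||
    (ucfg look q t).1 == codeField q 3 % (codeField q 0 + 1)).toNat, uaddr 4 q (t + 1)) else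
  bif j == 4 then bif look (uaddr 4 q (t + 1)) then (1, uaddr 3 q 0) else (0, 0) else
  bif decide (j < 8) then ((look (uaddr (j + 5) q (ucfg look q t).2)).toNat, uaddr (j + 2) q t) else
  bif decide (j < 11) then bif look (uaddr 4 q (t + 1)) then (0, 0) else
    (((uentry look q t).testBit (j - 8)).toNat, uaddr (j + 2) q (ucfg look q t).2) else
  bif j == 11 then bif q.unpair.2 == p &&
    ubefore look p q.unpair.1.unpair.1 q.unpair.1.unpair.2 t then (2, q.unpair.1) else (0, 0) else
  bif j == 12 then bif t == 0 && look (uaddr 2 q 0) && look (uaddr 3 p 0) && !look (uaddr 6 q 0)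
    then (1, uaddr 5 q 0) else (0, 0) else
  bif j == 13 then bif t == 0 then ((!look (uaddr 3 p 0)).toNat, uaddr 6 q 0) else (0, 0) else
  bif look (uaddr 3 p 0) && urel look p t q && !look (uaddr 5 t 0) then (1, uaddr 6 q 0) else (0, 0)

/-- A bound for the addresses read. -/
def ubound (p n : ℕ) : ℕ :=
  Nat.pair 12 (Nat.pair (n + 1 + p) (Nat.pair (n + 1) (n + 1))) + 1

section Prim

theorem primrec_testBit : Primrec₂ Nat.testBit := by
  have h : ∀ w a : ℕ, Nat.testBit w a = Nat.bodd (Nat.rec (motive := fun _ => ℕ) w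
      (fun _ r => r / 2) a) := by
    intro w a
    have h2 : ∀ a : ℕ, (Nat.rec (motive := fun _ => ℕ) w (fun _ r => r / 2) a : ℕ) = w >>> a := by
      intro a
      induction a with
      | zero => rfl
      | succ a ih => rw [Nat.shiftRight_succ, ← ih]
    rw [h2]
    simp [Nat.testBit, Nat.bodd_eq_one_and_ne_zero]
  refine Primrec.of_eq (f := fun x : ℕ × ℕ => Nat.bodd (Nat.rec (motive := fun _ => ℕ) x.1
      (fun _ r => r / 2) x.2)) ?_ (fun x => (h x.1 x.2).symm)
  exact Primrec.nat_bodd.comp (Primrec.nat_rec' Primrec.snd Primrec.fst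
    (h := fun _ y => y.2 / 2)
    (Primrec.nat_div.comp (Primrec.snd.comp Primrec.snd) (Primrec.const 2)).to₂)

theorem primrec_codeField : Primrec₂ codeField :=
  (Primrec.list_getD 0).comp ((Primrec.ofNat (List ℕ)).comp
    (Primrec.snd.comp (Primrec.unpair.comp Primrec.fst))) Primrec.snd

theorem primrec_uaddr {γ : Type*} [Primcodable γ] {f g h : γ → ℕ} (hf : Primrec f)
    (hg : Primrec g) (hh : Primrec h) : Primrec fun x => uaddr (f x) (g x) (h x) :=
  Primrec₂.natPair.comp hf (Primrec₂.natPair.comp hg hh)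

theorem primrec_codeEntry {γ : Type*} [Primcodable γ] {f g : γ → ℕ} {b0 b1 b2 : γ → Bool}
    (hf : Primrec f) (hg : Primrec g) (h0 : Primrec b0) (h1 : Primrec b1) (h2 : Primrec b2) :
    Primrec fun x => codeEntry (f x) (g x) (b0 x) (b1 x) (b2 x) := by
  have hn : Primrec Bool.toNat := Primrec.dom_finite _
  exact primrec_codeField.comp hf (Primrec.nat_add.comp (Primrec.nat_add.comp (Primrec.const 4)
    (Primrec.nat_mul.comp (Primrec.const 8) hg)) (Primrec.nat_add.comp (Primrec.nat_add.comp
      (hn.comp h0) (Primrec.nat_mul.comp (Primrec.const 2) (hn.comp h1)))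
      (Primrec.nat_mul.comp (Primrec.const 4) (hn.comp h2))))

theorem primrec_ucfg {γ : Type*} [Primcodable γ] {look : γ → ℕ → Bool} {q t : γ → ℕ}
    (hl : Primrec₂ look) (hq : Primrec q) (ht : Primrec t) :
    Primrec fun x => ucfg (look x) (q x) (t x) := by
  have hQ : Primrec fun x => codeField (q x) 0 + 1 :=
    Primrec.succ.comp (primrec_codeField.comp hq (Primrec.const 0))
  let e : γ → ℕ × (ℕ × ℕ) → ℕ := fun x y => codeEntry (q x) y.2.1 (look x (uaddr 7 (q x) y.1))
    (look x (uaddr 8 (q x) y.1)) (look x (uaddr 9 (q x) y.1))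
  have hlk : ∀ c, Primrec fun z : γ × (ℕ × (ℕ × ℕ)) => look z.1 (uaddr c (q z.1) z.2.1) :=
    fun c => hl.comp Primrec.fst (primrec_uaddr (Primrec.const c) (hq.comp Primrec.fst)
      (Primrec.fst.comp Primrec.snd))
  have he : Primrec fun z : γ × (ℕ × (ℕ × ℕ)) => e z.1 z.2 :=
    primrec_codeEntry (hq.comp Primrec.fst) (Primrec.fst.comp (Primrec.snd.comp Primrec.snd))
      (hlk 7) (hlk 8) (hlk 9)
  have hh : Primrec fun z : γ × (ℕ × (ℕ × ℕ)) => z.2.2.2 :=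
    Primrec.snd.comp (Primrec.snd.comp Primrec.snd)
  have hz : Primrec fun x => ((bif look x (uaddr 2 (q x) 0) then
      codeField (q x) 2 % (codeField (q x) 0 + 1)
      else codeField (q x) 1 % (codeField (q x) 0 + 1), 0) : ℕ × ℕ) :=
    Primrec.pair (Primrec.cond (hl.comp Primrec.id (primrec_uaddr (Primrec.const 2) hq
      (Primrec.const 0))) (Primrec.nat_mod.comp (primrec_codeField.comp hq (Primrec.const 2)) hQ)
      (Primrec.nat_mod.comp (primrec_codeField.comp hq (Primrec.const 1)) hQ)) (Primrec.const 0)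
  have hs : Primrec₂ fun (x : γ) (y : ℕ × (ℕ × ℕ)) =>
      ((e x y / 16 % (codeField (q x) 0 + 1), bif (e x y).testBit 3 then y.2.2 + 1
        else y.2.2 - 1) : ℕ × ℕ) :=
    Primrec.pair (Primrec.nat_mod.comp (Primrec.nat_div.comp he (Primrec.const 16))
      (hQ.comp Primrec.fst)) (Primrec.cond (primrec_testBit.comp he (Primrec.const 3))
      (Primrec.succ.comp hh) (Primrec.pred.comp hh))
  refine (Primrec.nat_rec' ht hz hs).of_eq fun x => ?_
  generalize t x = n
  induction n with
  | zero => rfl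
  | succ n ih =>
    rw [ucfg, ← ih]

theorem primrec_univ (p : ℕ) {γ : Type*} [Primcodable γ] {look : γ → ℕ → Bool} {q t j : γ → ℕ}
    (hl : Primrec₂ look) (hq : Primrec q) (ht : Primrec t) (hj : Primrec j) :
    Primrec fun x => univ p (look x) (q x) (t x) (j x) := by
  have hn : ∀ {b : γ → Bool}, Primrec b → Primrec fun x => (b x).toNat :=
    fun h => (Primrec.dom_finite Bool.toNat).comp h
  have hlk : ∀ {a : γ → ℕ}, Primrec a → Primrec fun x => look x (a x) :=
    fun h => hl.comp Primrec.id h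
  have hc := primrec_ucfg hl hq ht
  have hc1 : Primrec fun x => (ucfg (look x) (q x) (t x)).1 := Primrec.fst.comp hc
  have hc2 : Primrec fun x => (ucfg (look x) (q x) (t x)).2 := Primrec.snd.comp hc
  have hlt : ∀ {f g : γ → ℕ}, Primrec f → Primrec g → Primrec fun x => decide (f x < g x) :=
    fun h1 h2 => Primrec.nat_lt.decide.comp h1 h2
  have heq : ∀ {f g : γ → ℕ}, Primrec f → Primrec g → Primrec fun x => f x == g x :=
    fun h1 h2 => Primrec.beq.comp h1 h2
  have hand : ∀ {f g : γ → Bool}, Primrec f → Primrec g → Primrec fun x => f x && g x :=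
    fun h1 h2 => Primrec.and.comp h1 h2
  have hor : ∀ {f g : γ → Bool}, Primrec f → Primrec g → Primrec fun x => f x || g x :=
    fun h1 h2 => Primrec.or.comp h1 h2
  have hnot : ∀ {f : γ → Bool}, Primrec f → Primrec fun x => !f x :=
    fun h1 => Primrec.not.comp h1
  have hadd : ∀ {f g : γ → ℕ}, Primrec f → Primrec g → Primrec fun x => f x + g x :=
    fun h1 h2 => Primrec.nat_add.comp h1 h2
  have hsub : ∀ {f g : γ → ℕ}, Primrec f → Primrec g → Primrec fun x => f x - g x :=
    fun h1 h2 => Primrec.nat_sub.comp h1 h2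
  have hmod : ∀ {f g : γ → ℕ}, Primrec f → Primrec g → Primrec fun x => f x % g x :=
    fun h1 h2 => Primrec.nat_mod.comp h1 h2
  have hpair : ∀ {f g : γ → ℕ}, Primrec f → Primrec g → Primrec fun x => (f x, g x) :=
    fun h1 h2 => Primrec.pair h1 h2
  have hnpair : ∀ {f g : γ → ℕ}, Primrec f → Primrec g → Primrec fun x => Nat.pair (f x) (g x) :=
    fun h1 h2 => Primrec₂.natPair.comp h1 h2
  have hun1 : ∀ {f : γ → ℕ}, Primrec f → Primrec fun x => (f x).unpair.1 :=
    fun h1 => Primrec.fst.comp (Primrec.unpair.comp h1)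
  have hun2 : ∀ {f : γ → ℕ}, Primrec f → Primrec fun x => (f x).unpair.2 :=
    fun h1 => Primrec.snd.comp (Primrec.unpair.comp h1)
  have hfield : ∀ {f g : γ → ℕ}, Primrec f → Primrec g → Primrec fun x => codeField (f x) (g x) :=
    fun h1 h2 => primrec_codeField.comp h1 h2
  have htest : ∀ {f g : γ → ℕ}, Primrec f → Primrec g → Primrec fun x => (f x).testBit (g x) :=
    fun h1 h2 => primrec_testBit.comp h1 h2
  unfold univ uentry urel ubefore
  repeat' with_reducible first
    | exact hc1 | exact hc2 | exact hq | exact ht | exact hj | exact Primrec.const _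
    | apply Primrec.cond | apply hpair | apply hn | apply hand | apply hor | apply hnot
    | apply hlt | apply heq | apply hadd | apply hsub | apply hmod | apply hlk
    | apply primrec_uaddr | apply hnpair | apply hun1 | apply hun2 | apply hfield
    | apply htest | apply primrec_codeEntry

theorem primrec_ubound (p : ℕ) : Primrec (ubound p) :=
  have h : Primrec fun n : ℕ => n + 1 := Primrec.succ
  Primrec.succ.comp (Primrec₂.natPair.comp (Primrec.const 12) (Primrec₂.natPair.comp
    (Primrec.nat_add.comp h (Primrec.const p)) (Primrec₂.natPair.comp h h)))

end Prim

/-- The passes of the universal machine with parameter `p`. -/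
def uspec (p : ℕ) : PassSpec :=
  have h : Primrec₂ fun n w : ℕ => univ p w.testBit (n / 15).unpair.1 (n / 15).unpair.2 (n % 15) :=
    have hu : Primrec fun z : ℕ × ℕ => (z.1 / 15).unpair :=
      Primrec.unpair.comp (Primrec.nat_div.comp Primrec.fst (Primrec.const 15))
    primrec_univ p (γ := ℕ × ℕ) (look := fun z => z.2.testBit)
      (primrec_testBit.comp (Primrec.snd.comp Primrec.fst) Primrec.snd) (Primrec.fst.comp hu)
      (Primrec.snd.comp hu) (Primrec.nat_mod.comp Primrec.fst (Primrec.const 15))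
  { kind := fun n w =>
      (univ p w.testBit (n / 15).unpair.1 (n / 15).unpair.2 (n % 15)).1
    addr := fun n w =>
      (univ p w.testBit (n / 15).unpair.1 (n / 15).unpair.2 (n % 15)).2
    bnd := ubound p
    kind_primrec := Primrec.fst.comp h
    addr_primrec := Primrec.snd.comp h
    bnd_primrec := primrec_ubound p }

theorem uaddr_inj {tag u v tag' u' v' : ℕ} :
    uaddr tag u v = uaddr tag' u' v' ↔ tag = tag' ∧ u = u' ∧ v = v' := by
  simp [uaddr, Nat.pair_eq_pair]

theorem uaddr_ne_zero {tag u v : ℕ} (h : tag ≠ 0) : uaddr tag u v ≠ 0 := by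
  intro h0
  have := Nat.left_le_pair tag (Nat.pair u v)
  rw [uaddr] at h0
  omega

theorem pair_le_pair {a b a' b' : ℕ} (h : a ≤ a') (h' : b ≤ b') : Nat.pair a b ≤ Nat.pair a' b' := by
  rcases h.eq_or_lt with rfl | h
  · rcases h'.eq_or_lt with rfl | h'
    · rfl
    · exact (Nat.pair_lt_pair_right _ h').le
  · rcases h'.eq_or_lt with rfl | h'
    · exact (Nat.pair_lt_pair_left _ h).le
    · exact ((Nat.pair_lt_pair_left _ h).trans (Nat.pair_lt_pair_right _ h')).le

theorem uaddr_lt_ubound {p n tag u v : ℕ} (h1 : tag ≤ 12) (h2 : u ≤ n + 1 + p)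
    (h3 : v ≤ Nat.pair (n + 1) (n + 1)) : uaddr tag u v < ubound p n :=
  Nat.lt_succ_of_le (pair_le_pair h1 (pair_le_pair h2 h3))

theorem ucfg_snd_le (look : ℕ → Bool) (q t : ℕ) : (ucfg look q t).2 ≤ t := by
  induction t with
  | zero => rfl
  | succ t ih =>
    rw [ucfg]
    dsimp only
    cases Nat.testBit (codeEntry q (ucfg look q t).1 (look (uaddr 7 q t)) (look (uaddr 8 q t))
      (look (uaddr 9 q t))) 3 <;> simp <;> omega

theorem ucfg_congr {look look' : ℕ → Bool} {q t : ℕ} (h2 : look (uaddr 2 q 0) = look' (uaddr 2 q 0))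
    (h : ∀ tag t', 7 ≤ tag → tag ≤ 9 → t' < t → look (uaddr tag q t') = look' (uaddr tag q t')) :
    ucfg look q t = ucfg look' q t := by
  induction t with
  | zero => rw [ucfg, ucfg, h2]
  | succ t ih =>
    rw [ucfg, ucfg, ih fun tag t' h1 h2 h3 => h tag t' h1 h2 (by omega),
      h 7 t (by omega) (by omega) (by omega), h 8 t (by omega) (by omega) (by omega),
      h 9 t (by omega) (by omega) (by omega)]

theorem univ_congr {p q t j n : ℕ} {look look' : ℕ → Bool} (hq : q ≤ n) (ht : t ≤ n)
    (h : ∀ a < ubound p n, look a = look' a) : univ p look q t j = univ p look' q t j := by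
  have H : ∀ tag u v, tag ≤ 12 → u ≤ n + 1 + p → v ≤ Nat.pair (n + 1) (n + 1) →
      look (uaddr tag u v) = look' (uaddr tag u v) :=
    fun tag u v h1 h2 h3 => h _ (uaddr_lt_ubound h1 h2 h3)
  have hn : n + 1 ≤ Nat.pair (n + 1) (n + 1) := Nat.left_le_pair _ _
  have hcfg : ucfg look q t = ucfg look' q t :=
    ucfg_congr (H _ _ _ (by omega) (by omega) (by omega))
      fun tag t' _ _ _ => H _ _ _ (by omega) (by omega) (by omega)
  have hent : uentry look q t = uentry look' q t := by
    rw [uentry, uentry, hcfg, H 7 q t (by omega) (by omega) (by omega),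
      H 8 q t (by omega) (by omega) (by omega), H 9 q t (by omega) (by omega) (by omega)]
  have hc := ucfg_snd_le look' q t
  have hu1 : q.unpair.1.unpair.1 ≤ n :=
    (Nat.unpair_left_le _).trans ((Nat.unpair_left_le _).trans hq)
  have hu2 : q.unpair.1.unpair.2 ≤ n :=
    (Nat.unpair_right_le _).trans ((Nat.unpair_left_le _).trans hq)
  have hrel : urel look p t q = urel look' p t q := by
    rw [urel, urel, H 12 p _ le_rfl (by omega) (pair_le_pair (by omega) (by omega))]
  have hbef : ubefore look p q.unpair.1.unpair.1 q.unpair.1.unpair.2 t =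
      ubefore look' p q.unpair.1.unpair.1 q.unpair.1.unpair.2 t := by
    rw [ubefore, ubefore, H 4 _ t (by omega) (by omega) (by omega),
      H 4 _ (t + 1) (by omega) (by omega) (by omega),
      H 4 q.unpair.1.unpair.1 t (by omega) (by omega) (by omega),
      H 4 q.unpair.1.unpair.1 (t + 1) (by omega) (by omega) (by omega),
      H 4 p t (by omega) (by omega) (by omega), H 4 p (t + 1) (by omega) (by omega) (by omega)]
  have hT : j < 8 → look (uaddr (j + 5) q (ucfg look' q t).2) =
      look' (uaddr (j + 5) q (ucfg look' q t).2) :=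
    fun hj => H _ _ _ (by omega) (by omega) (by omega)
  rw [univ, univ, hrel, hbef, hcfg, hent, H 1 q 0 (by omega) (by omega) (by omega),
    H 2 q 0 (by omega) (by omega) (by omega), H 3 q 0 (by omega) (by omega) (by omega),
    H 3 p 0 (by omega) (by omega) (by omega), H 4 q t (by omega) (by omega) (by omega),
    H 4 q (t + 1) (by omega) (by omega) (by omega), H 6 q 0 (by omega) (by omega) (by omega),
    H 5 t 0 (by omega) (by omega) (by omega)]
  by_cases hj : j < 8
  · rw [hT hj]
  · simp [hj]

/-- The effect of a write of the given kind at the given address. -/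
def applyWrite (w : ℕ × ℕ) (x : (ℕ → Bool) × (ℕ → Bool)) : (ℕ → Bool) × (ℕ → Bool) :=
  if w.1 = 0 then (Function.update x.1 w.2 false, x.2)
  else if w.1 = 1 then (Function.update x.1 w.2 true, x.2)
  else (x.1, Function.update x.2 w.2 true)

theorem applyWrite_toNat (b : Bool) (a : ℕ) (x : (ℕ → Bool) × (ℕ → Bool)) :
    applyWrite (b.toNat, a) x = (Function.update x.1 a b, x.2) := by
  cases b <;> simp [applyWrite]

theorem applyWrite_nop {tag u v : ℕ} (h : tag ≠ 0) (x : (ℕ → Bool) × (ℕ → Bool)) :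
    (applyWrite (0, 0) x).1 (uaddr tag u v) = x.1 (uaddr tag u v) := by
  simp [applyWrite, uaddr_ne_zero h]

theorem uspec_act (p q t j : ℕ) (hj : j < 15) (x : (ℕ → Bool) × (ℕ → Bool)) :
    (uspec p).act (15 * Nat.pair q t + j) x = applyWrite (univ p x.1 q t j) x := by
  have h1 : (15 * Nat.pair q t + j) / 15 = Nat.pair q t := by omega
  have h2 : (15 * Nat.pair q t + j) % 15 = j := by omega
  have hl := Nat.left_le_pair q t
  have hr := Nat.right_le_pair q t
  have h3 : univ p (window x.1 (ubound p (15 * Nat.pair q t + j)) 0).testBit q t j =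
      univ p x.1 q t j := by
    refine univ_congr (n := 15 * Nat.pair q t + j) (by omega) (by omega) fun a ha => ?_
    rw [testBit_window _ _ _ _ ha, zero_add]
  simp only [PassSpec.act, uspec, h1, h2, Nat.unpair_pair, h3]
  rfl

/-- The arrays of the universal machine after `n` steps of pass `α`. -/
noncomputable def ustage (p : ℕ) (α : Ordinal.{0}) (n : ℕ) : (ℕ → Bool) × (ℕ → Bool) :=
  (uspec p).stage (Ordinal.omega0 * α + n)

theorem ustage_succ (p : ℕ) (α : Ordinal.{0}) (q t j : ℕ) (hj : j < 15) :
    ustage p α (15 * Nat.pair q t + (j + 1)) =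
      applyWrite (univ p (ustage p α (15 * Nat.pair q t + j)).1 q t j)
        (ustage p α (15 * Nat.pair q t + j)) := by
  rw [← uspec_act _ _ _ _ hj, ← add_assoc, ustage, PassSpec.stage_add_one]
  rfl

/-- The tag of the bits changed in the `j`-th part of a step. -/
def writeTag (j : ℕ) : ℕ := [2, 4, 1, 4, 3, 7, 8, 9, 10, 11, 12, 0, 5, 6, 6].getD j 0

theorem applyWrite_frame {tag u v q t j p : ℕ} (ht : tag ≠ 0) (hj : j < 15)
    (h : q ≠ u ∨ writeTag j ≠ tag) (x : (ℕ → Bool) × (ℕ → Bool)) :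
    (applyWrite (univ p x.1 q t j) x).1 (uaddr tag u v) = x.1 (uaddr tag u v) := by
  have key : ∀ (b : Bool) (w : ℕ), Function.update x.1 (uaddr (writeTag j) q w) b (uaddr tag u v) =
      x.1 (uaddr tag u v) := by
    intro b w
    rw [Function.update_of_ne]
    rw [Ne, uaddr_inj]
    rintro ⟨h1, h2, -⟩
    rcases h with h | h
    · exact h h2.symm
    · exact h h1.symm
  have h1 : ∀ (b : Bool) (w : ℕ), (applyWrite (b.toNat, uaddr (writeTag j) q w) x).1 (uaddr tag u v) =
      x.1 (uaddr tag u v) := fun b w => by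
    rw [applyWrite_toNat]; exact key b w
  have h2 : ∀ w : ℕ, (applyWrite (1, uaddr (writeTag j) q w) x).1 (uaddr tag u v) =
      x.1 (uaddr tag u v) := h1 true
  have h0 := applyWrite_nop (u := u) (v := v) ht x
  have h3 : ∀ w, (applyWrite (2, w) x).1 (uaddr tag u v) = x.1 (uaddr tag u v) :=
    fun w => by simp [applyWrite]
  interval_cases j <;> simp only [univ, writeTag, List.getD_cons_zero, List.getD_cons_succ] at h1 h2 ⊢
    <;> simp [Bool.cond_eq_ite] <;> (try split_ifs) <;>
    first | exact h0 | exact h1 _ _ | exact h2 _ | exact h3 _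

section

/-- A bit of the bit array of the universal machine after `n` steps of pass `α`. -/
noncomputable def ubit (p : ℕ) (α : Ordinal.{0}) (n tag u v : ℕ) : Bool :=
  (ustage p α n).1 (uaddr tag u v)

variable {p : ℕ} {α : Ordinal.{0}}

theorem ubit_eq_of_untouched {tag u v a b : ℕ} (ht : tag ≠ 0) (hab : a ≤ b)
    (h : ∀ m, a ≤ m → m < b → (m / 15).unpair.1 ≠ u ∨ writeTag (m % 15) ≠ tag) :
    ubit p α b tag u v = ubit p α a tag u v := by
  induction b, hab using Nat.le_induction with
  | base => rfl
  | succ b hb ih =>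
    rw [← ih fun m h1 h2 => h m h1 (by omega)]
    have h2 : b = 15 * Nat.pair (b / 15).unpair.1 (b / 15).unpair.2 + b % 15 := by
      rw [Nat.pair_unpair, Nat.div_add_mod]
    have h3 := ustage_succ p α (b / 15).unpair.1 (b / 15).unpair.2 (b % 15)
      (Nat.mod_lt _ (by norm_num))
    rw [← add_assoc, ← h2] at h3
    rw [ubit, h3, applyWrite_frame ht (Nat.mod_lt _ (by norm_num)) (h b hb (by omega)), ubit]

theorem ubit_block {tag q t v j j' : ℕ} (ht : tag ≠ 0) (h1 : j ≤ j') (h2 : j' ≤ 15)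
    (h : ∀ i < 15, j ≤ i → i < j' → writeTag i ≠ tag) :
    ubit p α (15 * Nat.pair q t + j') tag q v = ubit p α (15 * Nat.pair q t + j) tag q v := by
  refine ubit_eq_of_untouched ht (by omega) fun m h3 h4 => Or.inr ?_
  have : m % 15 = m - 15 * Nat.pair q t := by omega
  rw [this]
  exact h _ (by omega) (by omega) (by omega)

theorem pair_lt_pair_iff {q t t' : ℕ} : Nat.pair q t < Nat.pair q t' ↔ t < t' :=
  StrictMono.lt_iff_lt (f := Nat.pair q) fun _ _ h => Nat.pair_lt_pair_right q h

theorem ubit_between {tag q t v n n' : ℕ} (ht : tag ≠ 0) (h1 : 15 * Nat.pair q t + 15 ≤ n)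
    (h2 : n ≤ n') (h3 : n' ≤ 15 * Nat.pair q (t + 1)) :
    ubit p α n' tag q v = ubit p α n tag q v := by
  refine ubit_eq_of_untouched ht h2 fun m h4 h5 => Or.inl fun h6 => ?_
  have h7 : m / 15 = Nat.pair q (m / 15).unpair.2 := by rw [← h6, Nat.pair_unpair]
  have h8 : Nat.pair q t < Nat.pair q (m / 15).unpair.2 := by omega
  have h9 : Nat.pair q (m / 15).unpair.2 < Nat.pair q (t + 1) := by omega
  rw [pair_lt_pair_iff] at h8 h9
  omega

theorem ubit_before {tag q v n : ℕ} (ht : tag ≠ 0) (h1 : n ≤ 15 * Nat.pair q 0) :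
    ubit p α n tag q v = ubit p α 0 tag q v := by
  refine ubit_eq_of_untouched ht (by omega) fun m h4 h5 => Or.inl fun h6 => ?_
  have h7 : m / 15 = Nat.pair q (m / 15).unpair.2 := by rw [← h6, Nat.pair_unpair]
  have h9 : Nat.pair q (m / 15).unpair.2 < Nat.pair q 0 := by omega
  rw [pair_lt_pair_iff] at h9
  omega

/-- The state and head position of program `q` recovered in the universal computation. -/
noncomputable def uconf (p : ℕ) (α : Ordinal.{0}) (n q t : ℕ) : ℕ × ℕ := ucfg (ustage p α n).1 q t

section Slots

variable {q t : ℕ}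

theorem ubit_slot_eq {tag v j : ℕ} (hj : j < 15) : ubit p α (15 * Nat.pair q t + (j + 1)) tag q v =
    (applyWrite (univ p (ustage p α (15 * Nat.pair q t + j)).1 q t j)
        (ustage p α (15 * Nat.pair q t + j))).1 (uaddr tag q v) := by
  rw [ubit, ustage_succ _ _ _ _ _ hj]

theorem ubit_limitFlag (t : ℕ) : ubit p α (15 * Nat.pair q t + 1) 2 q 0 =
    if t = 0 then ubit p α (15 * Nat.pair q t) 1 q 0 else ubit p α (15 * Nat.pair q t) 2 q 0 := by
  rw [← zero_add 1, ubit_slot_eq (by norm_num)]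
  by_cases h : t = 0
  · simp [univ, h, applyWrite_toNat, ubit]
  · simp [univ, h, beq_eq_false_iff_ne.2 h, applyWrite_nop, ubit]

theorem ubit_haltedZero (t : ℕ) : ubit p α (15 * Nat.pair q t + 2) 4 q 0 =
    if t = 0 then ubit p α (15 * Nat.pair q t + 1) 3 q 0
      else ubit p α (15 * Nat.pair q t + 1) 4 q 0 := by
  rw [ubit_slot_eq (j := 1) (by norm_num)]
  by_cases h : t = 0
  · simp [univ, h, applyWrite_toNat, ubit]
  · simp [univ, h, beq_eq_false_iff_ne.2 h, applyWrite_nop, ubit]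

theorem ubit_haltedZero_of_ne (t : ℕ) {v : ℕ} (hv : v ≠ 0) :
    ubit p α (15 * Nat.pair q t + 2) 4 q v = ubit p α (15 * Nat.pair q t + 1) 4 q v := by
  rw [ubit_slot_eq (j := 1) (by norm_num)]
  by_cases h : t = 0
  · simp [univ, h, applyWrite_toNat, ubit, uaddr_inj, hv]
  · simp [univ, h, beq_eq_false_iff_ne.2 h, applyWrite_nop, ubit]

theorem ubit_started (t : ℕ) : ubit p α (15 * Nat.pair q t + 3) 1 q 0 =
    (decide (t = 0) || ubit p α (15 * Nat.pair q t + 2) 1 q 0) := by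
  rw [ubit_slot_eq (j := 2) (by norm_num)]
  by_cases h : t = 0
  · simp [univ, h, applyWrite]
  · simp [univ, h, beq_eq_false_iff_ne.2 h, applyWrite_nop, ubit]

theorem ubit_halted (t v : ℕ) : ubit p α (15 * Nat.pair q t + 4) 4 q v =
    if v = t + 1 then (ubit p α (15 * Nat.pair q t + 3) 4 q t ||
      (uconf p α (15 * Nat.pair q t + 3) q t).1 == codeField q 3 % (codeField q 0 + 1))
    else ubit p α (15 * Nat.pair q t + 3) 4 q v := by
  rw [ubit_slot_eq (j := 3) (by norm_num)]
  by_cases h : v = t + 1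
  · simp [univ, applyWrite_toNat, ubit, uconf, h]
  · simp [univ, h, applyWrite_toNat, ubit, uaddr_inj]

theorem ubit_hasHalted (t : ℕ) : ubit p α (15 * Nat.pair q t + 5) 3 q 0 =
    (ubit p α (15 * Nat.pair q t + 4) 4 q (t + 1) || ubit p α (15 * Nat.pair q t + 4) 3 q 0) := by
  rw [ubit_slot_eq (j := 4) (by norm_num)]
  cases h : (ustage p α (15 * Nat.pair q t + 4)).1 (uaddr 4 q (t + 1))
  · simp [univ, h, applyWrite_nop, ubit]
  · simp [univ, h, applyWrite, ubit]

theorem ubit_log {i : ℕ} (hi : i < 3) (t v : ℕ) :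
    ubit p α (15 * Nat.pair q t + (5 + i + 1)) (7 + i) q v =
    if v = t then ubit p α (15 * Nat.pair q t + (5 + i)) (10 + i) q
      (uconf p α (15 * Nat.pair q t + (5 + i)) q t).2
    else ubit p α (15 * Nat.pair q t + (5 + i)) (7 + i) q v := by
  rw [ubit_slot_eq (by omega)]
  by_cases h : v = t <;> interval_cases i <;>
    simp [univ, applyWrite_toNat, ubit, uconf, h, uaddr_inj]

theorem ubit_tape {i : ℕ} (hi : i < 3) (t v : ℕ) :
    ubit p α (15 * Nat.pair q t + (8 + i + 1)) (10 + i) q v =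
    if ubit p α (15 * Nat.pair q t + (8 + i)) 4 q (t + 1) = false ∧
        v = (uconf p α (15 * Nat.pair q t + (8 + i)) q t).2 then
      (uentry (ustage p α (15 * Nat.pair q t + (8 + i))).1 q t).testBit i
    else ubit p α (15 * Nat.pair q t + (8 + i)) (10 + i) q v := by
  rw [ubit_slot_eq (by omega)]
  cases h2 : ubit p α (15 * Nat.pair q t + (8 + i)) 4 q (t + 1)
  · by_cases h : v = (uconf p α (15 * Nat.pair q t + (8 + i)) q t).2
    · rw [ubit] at h2
      interval_cases i <;> simp [univ, h2, applyWrite_toNat, h, uconf]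
    · have h' := h
      rw [uconf] at h'
      have h2' := h2
      rw [ubit] at h2'
      interval_cases i <;> simp [univ, h2', applyWrite_toNat, h, uaddr_inj, h', ubit]
  · have h2' := h2
    rw [ubit] at h2'
    interval_cases i <;> simp [univ, h2', applyWrite_nop, ubit]

end Slots

end

section

section Blocks

variable {p q t : ℕ} {α : Ordinal.{0}}

theorem ubit_log_of_ne {i j v : ℕ} (hi : i < 3) (hj : j ≤ 15) (hv : v ≠ t) :
    ubit p α (15 * Nat.pair q t + j) (7 + i) q v = ubit p α (15 * Nat.pair q t) (7 + i) q v := by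
  have h1 : ubit p α (15 * Nat.pair q t + (5 + i)) (7 + i) q v =
      ubit p α (15 * Nat.pair q t + 0) (7 + i) q v :=
    ubit_block (by omega) (by omega) (by omega) (by interval_cases i <;> decide)
  rcases le_or_gt j (5 + i) with h | h
  · exact ubit_block (j := 0) (by omega) (by omega) (by omega) fun k h2 h3 h4 => by
      revert k; interval_cases i <;> interval_cases j <;> decide
  · have h2 := ubit_log hi t v (p := p) (α := α) (q := q)
    rw [if_neg hv, h1] at h2
    rw [← add_zero (15 * Nat.pair q t), ← h2]
    exact ubit_block (by omega) (by omega) (by omega) fun k h2 h3 h4 => by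
      revert k; interval_cases i <;> interval_cases j <;> decide

theorem ubit_limitFlag_block {j : ℕ} (h : 1 ≤ j) (hj : j ≤ 15) :
    ubit p α (15 * Nat.pair q t + j) 2 q 0 =
      if t = 0 then ubit p α (15 * Nat.pair q t) 1 q 0 else ubit p α (15 * Nat.pair q t) 2 q 0 := by
  rw [← ubit_limitFlag]
  exact ubit_block (by omega) (by omega) (by omega) fun k h2 h3 h4 => by
    revert k; interval_cases j <;> decide

theorem uconf_block {j : ℕ} (h : 1 ≤ j) (hj : j ≤ 15) :
    uconf p α (15 * Nat.pair q t + j) q t = uconf p α (15 * Nat.pair q t + 15) q t := by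
  refine ucfg_congr ?_ fun tag t' h1 h2 h3 => ?_
  · have := ubit_limitFlag_block (p := p) (α := α) (q := q) (t := t) h hj
    rwa [← ubit_limitFlag_block (p := p) (α := α) (q := q) (t := t) (j := 15) (by omega) le_rfl]
      at this
  · obtain ⟨i, rfl⟩ := Nat.exists_eq_add_of_le h1
    have := ubit_log_of_ne (p := p) (α := α) (q := q) (t := t) (i := i) (by omega) hj h3.ne
    rwa [← ubit_log_of_ne (p := p) (α := α) (q := q) (t := t) (j := 15) (by omega) le_rfl h3.ne]
      at this

theorem ubit_started_block : ubit p α (15 * Nat.pair q t + 15) 1 q 0 =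
    (decide (t = 0) || ubit p α (15 * Nat.pair q t) 1 q 0) := by
  rw [ubit_block (j := 3) (by omega) (by omega) (by omega) (by decide), ubit_started,
    ubit_block (j := 0) (j' := 2) (by omega) (by omega) (by omega) (by decide), add_zero]

theorem ubit_haltedZero_block : ubit p α (15 * Nat.pair q t + 15) 4 q 0 =
    if t = 0 then ubit p α (15 * Nat.pair q t) 3 q 0 else ubit p α (15 * Nat.pair q t) 4 q 0 := by
  rw [ubit_block (j := 4) (by omega) (by omega) (by omega) (by decide), ubit_halted,
    if_neg (by omega), ubit_block (j := 2) (j' := 3) (by omega) (by omega) (by omega) (by decide),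
    ubit_haltedZero,
    ubit_block (j := 0) (j' := 1) (tag := 3) (by omega) (by omega) (by omega) (by decide),
    ubit_block (j := 0) (j' := 1) (tag := 4) (by omega) (by omega) (by omega) (by decide), add_zero]

theorem ubit_halted_block_of_ne {v : ℕ} (h0 : v ≠ 0) (hv : v ≠ t + 1) :
    ubit p α (15 * Nat.pair q t + 15) 4 q v = ubit p α (15 * Nat.pair q t) 4 q v := by
  rw [ubit_block (j := 4) (by omega) (by omega) (by omega) (by decide), ubit_halted,
    if_neg hv, ubit_block (j := 2) (j' := 3) (by omega) (by omega) (by omega) (by decide),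
    ubit_haltedZero_of_ne _ h0,
    ubit_block (j := 0) (j' := 1) (tag := 4) (by omega) (by omega) (by omega) (by decide), add_zero]

theorem ubit_halted_block : ubit p α (15 * Nat.pair q t + 15) 4 q (t + 1) =
    (ubit p α (15 * Nat.pair q t + 15) 4 q t ||
      (uconf p α (15 * Nat.pair q t + 15) q t).1 == codeField q 3 % (codeField q 0 + 1)) := by
  rw [ubit_block (j := 4) (by omega) (by omega) (by omega) (by decide), ubit_halted, if_pos rfl,
    ubit_block (j := 4) (j' := 15) (by omega) (by omega) (by omega) (by decide), ubit_halted,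
    if_neg (by omega), uconf_block (by omega) (by omega)]

theorem ubit_hasHalted_block : ubit p α (15 * Nat.pair q t + 15) 3 q 0 =
    (ubit p α (15 * Nat.pair q t + 15) 4 q (t + 1) || ubit p α (15 * Nat.pair q t) 3 q 0) := by
  rw [ubit_block (j := 5) (j' := 15) (tag := 3) (by omega) (by omega) (by omega) (by decide),
    ubit_hasHalted,
    ubit_block (j := 4) (j' := 15) (tag := 4) (by omega) (by omega) (by omega) (by decide),
    ubit_block (j := 0) (j' := 4) (tag := 3) (by omega) (by omega) (by omega) (by decide), add_zero]

theorem ubit_log_block {i : ℕ} (hi : i < 3) : ubit p α (15 * Nat.pair q t + 15) (7 + i) q t =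
    ubit p α (15 * Nat.pair q t) (10 + i) q (uconf p α (15 * Nat.pair q t + 15) q t).2 := by
  rw [ubit_block (j := 5 + i + 1) (j' := 15) (by omega) (by omega) (by omega)
    (by interval_cases i <;> decide), ubit_log hi, if_pos rfl, uconf_block (by omega) (by omega),
    ubit_block (j := 0) (j' := 5 + i) (by omega) (by omega) (by omega)
    (by interval_cases i <;> decide), add_zero]

theorem uentry_block {j : ℕ} (h : 8 ≤ j) (hj : j ≤ 15) :
    uentry (ustage p α (15 * Nat.pair q t + j)).1 q t =
      uentry (ustage p α (15 * Nat.pair q t + 15)).1 q t := by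
  have h1 := uconf_block (p := p) (α := α) (q := q) (t := t) (by omega) hj
  have h2 : ∀ i < 3, ubit p α (15 * Nat.pair q t + 15) (7 + i) q t =
      ubit p α (15 * Nat.pair q t + j) (7 + i) q t := fun i hi =>
    ubit_block (by omega) (by omega) (by omega) fun k h2 h3 h4 => by
      revert k; interval_cases i <;> interval_cases j <;> decide
  rw [uconf, uconf] at h1
  have h70 := h2 0 (by omega)
  have h71 := h2 1 (by omega)
  have h72 := h2 2 (by omega)
  simp only [ubit, Nat.add_zero, Nat.reduceAdd] at h70 h71 h72
  rw [uentry, uentry, h1, h70, h71, h72]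

theorem ubit_tape_block {i : ℕ} (hi : i < 3) (v : ℕ) :
    ubit p α (15 * Nat.pair q t + 15) (10 + i) q v =
    if ubit p α (15 * Nat.pair q t + 15) 4 q (t + 1) = false ∧
        v = (uconf p α (15 * Nat.pair q t + 15) q t).2 then
      (uentry (ustage p α (15 * Nat.pair q t + 15)).1 q t).testBit i
    else ubit p α (15 * Nat.pair q t) (10 + i) q v := by
  rw [ubit_block (j := 8 + i + 1) (j' := 15) (tag := 10 + i) (by omega) (by omega) (by omega)
    (by interval_cases i <;> decide), ubit_tape hi, uconf_block (by omega) (by omega),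
    uentry_block (by omega) (by omega),
    ubit_block (j := 8 + i) (j' := 15) (tag := 4) (by omega) (by omega) (by omega)
    (by interval_cases i <;> decide),
    ubit_block (j := 0) (j' := 8 + i) (tag := 10 + i) (by omega) (by omega) (by omega)
    (by interval_cases i <;> decide), add_zero]

end Blocks

end

/-- The machine with states `0, …, Q` whose table is described by the list coded by `q`. -/
def machOf (q Q : ℕ) : Machine where
  Q := Q
  start := ⟨codeField q 1 % (Q + 1), Nat.mod_lt _ (Nat.succ_pos Q)⟩
  limit := ⟨codeField q 2 % (Q + 1), Nat.mod_lt _ (Nat.succ_pos Q)⟩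
  halt := ⟨codeField q 3 % (Q + 1), Nat.mod_lt _ (Nat.succ_pos Q)⟩
  trans := fun s => let e := codeEntry q s.1 (s.2 0) (s.2 1) (s.2 2)
    (⟨e / 16 % (Q + 1), Nat.mod_lt _ (Nat.succ_pos Q)⟩, fun i => e.testBit i, e.testBit 3)

/-- The machine with code `q`. -/
def mach (q : ℕ) : Machine := machOf q (codeField q 0)

/-- The number with lowest binary digits `b 0`, `b 1`, `b 2`, `d` followed by those of `s`. -/
def entryCode (s : ℕ) (b : Fin 3 → Bool) (d : Bool) : ℕ :=
  Nat.bit (b 0) (Nat.bit (b 1) (Nat.bit (b 2) (Nat.bit d s)))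

theorem entryCode_div (s : ℕ) (b : Fin 3 → Bool) (d : Bool) : entryCode s b d / 16 = s := by
  rw [entryCode, show 16 = 2 * 2 * 2 * 2 by norm_num, ← Nat.div_div_eq_div_mul,
    ← Nat.div_div_eq_div_mul, ← Nat.div_div_eq_div_mul]
  simp

theorem entryCode_testBit (s : ℕ) (b : Fin 3 → Bool) (d : Bool) (i : Fin 3) :
    (entryCode s b d).testBit i = b i := by
  fin_cases i
  · exact Nat.testBit_bit_zero _ _
  · exact (Nat.testBit_bit_succ 0 _ _).trans (Nat.testBit_bit_zero _ _)
  · exact (Nat.testBit_bit_succ 1 _ _).trans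
      ((Nat.testBit_bit_succ 0 _ _).trans (Nat.testBit_bit_zero _ _))

theorem entryCode_testBit_three (s : ℕ) (b : Fin 3 → Bool) (d : Bool) :
    (entryCode s b d).testBit 3 = d :=
  (Nat.testBit_bit_succ 2 _ _).trans ((Nat.testBit_bit_succ 1 _ _).trans
      ((Nat.testBit_bit_succ 0 _ _).trans (Nat.testBit_bit_zero _ _)))

theorem exists_mach_eq (M : Machine) : ∃ e : ℕ, ∀ d, mach (Nat.pair d e) = M := by
  obtain ⟨Q, st, li, ha, tr⟩ := M
  let g : ℕ → ℕ := fun k =>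
    let r := tr (Fin.ofNat (Q + 1) (k / 8), fun i => (k % 8).testBit i)
    entryCode r.1 r.2.1 r.2.2
  let l : List ℕ := [Q, st, li, ha] ++ (List.range (8 * (Q + 1))).map g
  refine ⟨Encodable.encode l, fun d => ?_⟩
  have hf : ∀ i, codeField (Nat.pair d (Encodable.encode l)) i = l.getD i 0 := fun i => by
    rw [codeField, Nat.unpair_pair, Denumerable.ofNat_encode]
  have h0 : codeField (Nat.pair d (Encodable.encode l)) 0 = Q := hf 0
  have hg : ∀ k < 8 * (Q + 1), codeField (Nat.pair d (Encodable.encode l)) (4 + k) = g k := by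
    intro k hk
    rw [hf, List.getD_append_right _ _ _ _ (by simp)]
    simp [List.getD_eq_getElem?_getD, hk]
  have he : ∀ (s : Fin (Q + 1)) (b : Fin 3 → Bool),
      codeEntry (Nat.pair d (Encodable.encode l)) s (b 0) (b 1) (b 2) =
        entryCode (tr (s, b)).1 (tr (s, b)).2.1 (tr (s, b)).2.2 := by
    intro s b
    have hs := s.2
    have h1 : (b 0).toNat ≤ 1 := Bool.toNat_le _
    have h2 : (b 1).toNat ≤ 1 := Bool.toNat_le _
    have h3 : (b 2).toNat ≤ 1 := Bool.toNat_le _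
    rw [codeEntry, add_assoc, hg _ (by omega)]
    have h4 : (8 * (s : ℕ) + ((b 0).toNat + 2 * (b 1).toNat + 4 * (b 2).toNat)) / 8 = s := by omega
    have h5 : (8 * (s : ℕ) + ((b 0).toNat + 2 * (b 1).toNat + 4 * (b 2).toNat)) % 8 =
      (b 0).toNat + 2 * (b 1).toNat + 4 * (b 2).toNat := by omega
    have h6 : Fin.ofNat (Q + 1) (s : ℕ) = s := Fin.ext (Nat.mod_eq_of_lt hs)
    have h7 : (fun i : Fin 3 => ((b 0).toNat + 2 * (b 1).toNat + 4 * (b 2).toNat).testBit i) = b := by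
      funext i
      fin_cases i <;> cases h0 : b 0 <;> cases h1 : b 1 <;> cases h2 : b 2 <;>
        simp [h0, h1, h2, Nat.testBit]
    simp only [g, h4, h5, h6, h7]
  rw [mach, h0, machOf]
  congr 1
  · exact Fin.ext ((congrArg (· % (Q + 1)) (hf 1)).trans (Nat.mod_eq_of_lt st.2))
  · exact Fin.ext ((congrArg (· % (Q + 1)) (hf 2)).trans (Nat.mod_eq_of_lt li.2))
  · exact Fin.ext ((congrArg (· % (Q + 1)) (hf 3)).trans (Nat.mod_eq_of_lt ha.2))
  · funext s
    obtain ⟨s, b⟩ := s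
    simp only [he, entryCode_div, entryCode_testBit, entryCode_testBit_three]
    refine Prod.ext (Fin.ext (Nat.mod_eq_of_lt (tr (s, b)).1.2)) rfl

/-- Program `q` has halted before stage `β`. -/
def HaltedBefore (q : ℕ) (β : Ordinal.{0}) : Prop := ∃ γ < β, (mach q).haltedAt zeroR γ

theorem HaltedBefore.mono {q : ℕ} {β β' : Ordinal.{0}} (h : HaltedBefore q β) (hb : β ≤ β') :
    HaltedBefore q β' :=
  let ⟨γ, h1, h2⟩ := h
  ⟨γ, h1.trans_le hb, h2⟩

theorem haltedBefore_add_one {q : ℕ} {β : Ordinal.{0}} :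
    HaltedBefore q (β + 1) ↔ HaltedBefore q β ∨ (mach q).haltedAt zeroR β := by
  constructor
  · rintro ⟨γ, h1, h2⟩
    rcases (Order.lt_add_one_iff.1 h1).eq_or_lt with rfl | h
    · exact Or.inr h2
    · exact Or.inl ⟨γ, h, h2⟩
  · rintro (h | h)
    · exact h.mono (Order.le_succ β)
    · exact ⟨β, Order.lt_succ β, h⟩

theorem haltedBefore_limit {q : ℕ} {β : Ordinal.{0}} (hβ : Order.IsSuccLimit β) :
    HaltedBefore q β ↔ ∃ γ < β, HaltedBefore q γ := by
  constructor
  · rintro ⟨γ, h1, h2⟩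
    exact ⟨γ + 1, hβ.succ_lt h1, γ, Order.lt_succ γ, h2⟩
  · rintro ⟨γ, h1, h2⟩
    exact h2.mono h1.le

/-- The first stage at which program `q` halts. -/
noncomputable def haltTime (q : ℕ) : Ordinal.{0} := sInf {γ | (mach q).haltedAt zeroR γ}

/-- The tapes of program `q` at stage `β`, or when it halts, if that is earlier. -/
noncomputable def frozenTape (q : ℕ) (β : Ordinal.{0}) (i : Fin 3) (m : ℕ) : Bool :=
  ((mach q).snap zeroR (if HaltedBefore q β then haltTime q else β)).tape i m

theorem frozenTape_eq_of_not {q : ℕ} {β : Ordinal.{0}} (h : ¬HaltedBefore q β) :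
    frozenTape q β = ((mach q).snap zeroR β).tape := by
  funext i m
  rw [frozenTape, if_neg h]

theorem haltedAt_haltTime {q : ℕ} {γ : Ordinal.{0}} (h : (mach q).haltedAt zeroR γ) :
    (mach q).haltedAt zeroR (haltTime q) := csInf_mem (s := {γ | (mach q).haltedAt zeroR γ}) ⟨γ, h⟩

theorem haltTime_le {q : ℕ} {γ : Ordinal.{0}} (h : (mach q).haltedAt zeroR γ) :
    haltTime q ≤ γ := csInf_le' h

theorem haltedBefore_iff {q : ℕ} {β : Ordinal.{0}} :
    HaltedBefore q β ↔ (mach q).halts zeroR ∧ haltTime q < β :=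
  ⟨fun ⟨γ, h1, h2⟩ => ⟨⟨γ, h2⟩, (haltTime_le h2).trans_lt h1⟩,
    fun ⟨⟨_, h1⟩, h2⟩ => ⟨_, h2, haltedAt_haltTime h1⟩⟩

theorem haltTime_eq {q : ℕ} {s : Ordinal.{0}} (h : (mach q).haltsAt zeroR s) : haltTime q = s :=
  (haltTime_le h.1).antisymm (not_lt.1 fun h2 => h.2 _ h2 (haltedAt_haltTime h.1))

theorem frozenTape_zero (q : ℕ) (i : Fin 3) (m : ℕ) : frozenTape q 0 i m = false := by
  rw [frozenTape_eq_of_not fun ⟨γ, h, _⟩ => not_lt_bot h, Machine.snap_zero]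
  simp [Machine.init, zeroR]

theorem frozenTape_add_one_of_halted {q : ℕ} {β : Ordinal.{0}} (h : HaltedBefore q (β + 1)) :
    frozenTape q (β + 1) = frozenTape q β := by
  funext i m
  rw [frozenTape, frozenTape, if_pos h]
  split_ifs with h2
  · rfl
  · have h3 := haltedBefore_iff.1 h
    have h4 : haltTime q = β := (Order.lt_add_one_iff.1 h3.2).antisymm
      (not_lt.1 fun h4 => h2 (haltedBefore_iff.2 ⟨h3.1, h4⟩))
    rw [h4]

theorem frozenTape_limit {q : ℕ} {β : Ordinal.{0}} (hβ : Order.IsSuccLimit β) (i : Fin 3) (m : ℕ) :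
    frozenTape q β i m = limsupBit β fun γ => frozenTape q γ i m := by
  by_cases h : HaltedBefore q β
  · obtain ⟨γ, h1, h2⟩ := (haltedBefore_limit hβ).1 h
    refine (limsupBit_eq_of_eventually h1 fun δ h3 _ => ?_).symm
    rw [frozenTape, frozenTape, if_pos h, if_pos (h2.mono h3)]
  · rw [frozenTape_eq_of_not h, Machine.snap_limit _ _ hβ]
    refine limsupBit_congr fun γ hγ => ?_
    rw [frozenTape_eq_of_not fun h2 => h (h2.mono hγ.le)]

section

open Ordinal

theorem isSuccLimit_omega0_mul {α : Ordinal.{0}} (h : α ≠ 0) : Order.IsSuccLimit (ω * α) :=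
  isSuccLimit_mul_left isSuccLimit_omega0 (pos_iff_ne_zero.2 h)

theorem mach_trans_state (q : ℕ) (s : Fin ((mach q).Q + 1) × (Fin 3 → Bool)) :
    ((mach q).trans s).1.val =
      codeEntry q s.1 (s.2 0) (s.2 1) (s.2 2) / 16 % (codeField q 0 + 1) := rfl

theorem mach_trans_write (q : ℕ) (s : Fin ((mach q).Q + 1) × (Fin 3 → Bool)) (i : Fin 3) :
    ((mach q).trans s).2.1 i = (codeEntry q s.1 (s.2 0) (s.2 1) (s.2 2)).testBit i := rfl

theorem mach_trans_move (q : ℕ) (s : Fin ((mach q).Q + 1) × (Fin 3 → Bool)) :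
    ((mach q).trans s).2.2 = (codeEntry q s.1 (s.2 0) (s.2 1) (s.2 2)).testBit 3 := rfl

theorem ucfg_eq_snap {look : ℕ → Bool} {q : ℕ} {α : Ordinal.{0}} {t : ℕ}
    (hflag : look (uaddr 2 q 0) = decide (α ≠ 0))
    (hlog : ∀ t' < t, ¬HaltedBefore q (ω * α + t') → ∀ i : Fin 3, look (uaddr (7 + i) q t') =
      ((mach q).snap zeroR (ω * α + t')).tape i ((mach q).snap zeroR (ω * α + t')).head)
    (ht : ¬HaltedBefore q (ω * α + t)) :
    ucfg look q t = (((mach q).snap zeroR (ω * α + t)).state.val,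
      ((mach q).snap zeroR (ω * α + t)).head) := by
  induction t with
  | zero =>
    rw [ucfg, hflag]
    by_cases h : α = 0
    · subst h
      simp [Machine.snap_zero, Machine.init, mach, machOf]
    · rw [Nat.cast_zero, add_zero, Machine.snap_limit _ _ (isSuccLimit_omega0_mul h)]
      simp [h, mach, machOf]
  | succ t ih =>
    have hlt : ω * α + (t : Ordinal.{0}) ≤ ω * α + ((t + 1 : ℕ) : Ordinal.{0}) := by
      gcongr; omega
    have ht' : ¬HaltedBefore q (ω * α + t) := fun h => ht (h.mono hlt)
    have h0 := hlog t (by omega) ht' 0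
    have h1 := hlog t (by omega) ht' 1
    have h2 := hlog t (by omega) ht' 2
    simp only [Fin.val_zero, Fin.val_one, Fin.val_two, Nat.add_zero, Nat.reduceAdd] at h0 h1 h2
    rw [ucfg, ih (fun t' h => hlog t' (by omega)) ht', Nat.cast_add, Nat.cast_one, ← add_assoc,
      Machine.snap_succ, Machine.stepSnap]
    simp only [h0, h1, h2, mach_trans_state, mach_trans_move, Bool.cond_eq_ite]
    rfl

/-- The bits belonging to program `q` after `n` steps of pass `α` are those expected when `t`
steps of program `q` have been simulated. -/
structure Simulates (p : ℕ) (α : Ordinal.{0}) (n q t : ℕ) : Prop where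
  tape : ∀ (i : Fin 3) (v : ℕ), ubit p α n (10 + i) q v = frozenTape q (ω * α + t) i v
  hasHalted : ubit p α n 3 q 0 = true ↔ HaltedBefore q (ω * α + t)
  started : ubit p α n 1 q 0 = decide (α ≠ 0 ∨ t ≠ 0)
  flag : t ≠ 0 → ubit p α n 2 q 0 = decide (α ≠ 0)
  halted : t ≠ 0 → ∀ t' ≤ t, ubit p α n 4 q t' = true ↔ HaltedBefore q (ω * α + t')
  log : ∀ t' < t, ¬HaltedBefore q (ω * α + t') → ∀ i : Fin 3, ubit p α n (7 + i) q t' =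
    ((mach q).snap zeroR (ω * α + t')).tape i ((mach q).snap zeroR (ω * α + t')).head

variable {p q t : ℕ} {α : Ordinal.{0}}

theorem Simulates.of_eq {n n' : ℕ} (h : Simulates p α n q t)
    (he : ∀ tag v, tag ≠ 0 → ubit p α n' tag q v = ubit p α n tag q v) :
    Simulates p α n' q t where
  tape i v := by rw [he _ _ (by omega), h.tape]
  hasHalted := by rw [he _ _ (by omega), h.hasHalted]
  started := by rw [he _ _ (by omega), h.started]
  flag ht := by rw [he _ _ (by omega), h.flag ht]
  halted ht t' ht' := by rw [he _ _ (by omega), h.halted ht t' ht']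
  log t' ht' hh i := by rw [he _ _ (by omega), h.log t' ht' hh]

theorem Simulates.block (h : Simulates p α (15 * Nat.pair q t) q t) :
    Simulates p α (15 * Nat.pair q t + 15) q (t + 1) := by
  have hcast : ω * α + ((t + 1 : ℕ) : Ordinal.{0}) = ω * α + t + 1 := by
    rw [Nat.cast_add, Nat.cast_one, add_assoc]
  have hflag : ubit p α (15 * Nat.pair q t + 15) 2 q 0 = decide (α ≠ 0) := by
    rw [ubit_limitFlag_block (by omega) le_rfl]
    split_ifs with h0
    · rw [h.started]; simp [h0]
    · exact h.flag h0
  have hold : ∀ t' < t, ¬HaltedBefore q (ω * α + t') → ∀ i : Fin 3,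
      ubit p α (15 * Nat.pair q t + 15) (7 + i) q t' =
      ((mach q).snap zeroR (ω * α + t')).tape i ((mach q).snap zeroR (ω * α + t')).head := by
    intro t' ht' hh i
    rw [ubit_log_of_ne i.2 le_rfl ht'.ne, h.log t' ht' hh]
  have hcfg : ¬HaltedBefore q (ω * α + t) → uconf p α (15 * Nat.pair q t + 15) q t =
      (((mach q).snap zeroR (ω * α + t)).state.val, ((mach q).snap zeroR (ω * α + t)).head) :=
    ucfg_eq_snap hflag hold
  have hhalt : ∀ t' ≤ t, ubit p α (15 * Nat.pair q t + 15) 4 q t' = true ↔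
      HaltedBefore q (ω * α + t') := by
    intro t' ht'
    rcases Nat.eq_zero_or_pos t' with rfl | h0
    · rw [ubit_haltedZero_block]
      split_ifs with h1
      · subst h1; exact h.hasHalted
      · exact h.halted h1 0 (by omega)
    · rw [ubit_halted_block_of_ne (by omega) (by omega)]
      exact h.halted (by omega) t' ht'
  have hhalt1 : ubit p α (15 * Nat.pair q t + 15) 4 q (t + 1) = true ↔
      HaltedBefore q (ω * α + (t + 1 : ℕ)) := by
    rw [ubit_halted_block, Bool.or_eq_true, hhalt t le_rfl, hcast, haltedBefore_add_one]
    by_cases h1 : HaltedBefore q (ω * α + t)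
    · simp [h1]
    · rw [hcfg h1, beq_iff_eq, Machine.haltedAt, Fin.ext_iff]
      rfl
  have hlog : ¬HaltedBefore q (ω * α + t) → ∀ i : Fin 3,
      ubit p α (15 * Nat.pair q t + 15) (7 + i) q t =
      ((mach q).snap zeroR (ω * α + t)).tape i ((mach q).snap zeroR (ω * α + t)).head := by
    intro hh i
    rw [ubit_log_block i.2, hcfg hh, h.tape, frozenTape_eq_of_not hh]
  refine ⟨fun i v => ?_, ?_, ?_, fun _ => hflag, fun _ t' ht' => ?_, fun t' ht' => ?_⟩
  · rw [ubit_tape_block i.2]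
    by_cases hh : HaltedBefore q (ω * α + (t + 1 : ℕ))
    · rw [if_neg (by rw [hhalt1.2 hh]; simp), h.tape, hcast, frozenTape_add_one_of_halted]
      rwa [← hcast]
    · have hh' : ¬HaltedBefore q (ω * α + t) := fun h1 => hh (by
        rw [hcast]; exact h1.mono (Order.le_succ _))
      have hb : ubit p α (15 * Nat.pair q t + 15) 4 q (t + 1) = false := by
        rw [← Bool.not_eq_true, hhalt1]; exact hh
      have h0 := hlog hh' 0
      have h1 := hlog hh' 1
      have h2 := hlog hh' 2
      have hc := hcfg hh'
      simp only [Fin.val_zero, Fin.val_one, Fin.val_two, Nat.add_zero, Nat.reduceAdd, ubit]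
        at h0 h1 h2
      rw [uconf] at hc
      rw [hb, hcfg hh', h.tape, frozenTape_eq_of_not hh, frozenTape_eq_of_not hh', hcast,
        Machine.snap_succ, Machine.stepSnap, uentry, hc, h0, h1, h2]
      simp [mach_trans_write]
  · rw [ubit_hasHalted_block, Bool.or_eq_true, hhalt1, h.hasHalted]
    refine or_iff_left_of_imp fun h1 => ?_
    rw [hcast]; exact h1.mono (Order.le_succ _)
  · rw [ubit_started_block, h.started]
    by_cases h0 : t = 0 <;> simp [h0]
  · rcases Nat.lt_or_ge t t' with h1 | h1
    · obtain rfl : t' = t + 1 := by omega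
      exact hhalt1
    · exact hhalt t' h1
  · rcases Nat.lt_or_ge t' t with h1 | h1
    · exact hold t' h1
    · obtain rfl : t' = t := by omega
      exact hlog

theorem Simulates.start (h : Simulates p α 0 q 0) (t : ℕ) :
    Simulates p α (15 * Nat.pair q t) q t := by
  induction t with
  | zero => exact h.of_eq fun tag v ht => ubit_before ht le_rfl
  | succ t ih =>
    have := (pair_lt_pair_iff (q := q)).2 (Nat.lt_add_one t)
    exact ih.block.of_eq fun tag v ht => ubit_between ht le_rfl (by omega) le_rfl

end

section

open Ordinal

theorem exists_eq_omega0_mul_add (δ : Ordinal.{0}) : ∃ (β : Ordinal.{0}) (n : ℕ), δ = ω * β + n := by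
  obtain ⟨n, hn⟩ := lt_omega0.1 (mod_lt δ omega0_ne_zero)
  exact ⟨δ / ω, n, by rw [← hn, div_add_mod]⟩

theorem omega0_mul_add_lt {β β' : Ordinal.{0}} (h : β < β') (n : ℕ) : ω * β + n < ω * β' := by
  refine (add_nat_lt_add_omega0 _ n).trans_le ?_
  rw [← mul_add_one]
  exact mul_le_mul_right (Order.add_one_le_of_lt h) _

theorem omega0_mul_add_lt_iff {β α : Ordinal.{0}} {n : ℕ} : ω * β + n < ω * α ↔ β < α := by
  refine ⟨fun h => not_le.1 fun h2 => ?_, fun h => omega0_mul_add_lt h n⟩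
  exact h.not_ge ((mul_le_mul_right h2 _).trans le_self_add)

theorem omega0_mul_add_le_iff {β β' : Ordinal.{0}} {n n' : ℕ} :
    ω * β + n ≤ ω * β' + n' ↔ β < β' ∨ β = β' ∧ n ≤ n' := by
  rcases lt_trichotomy β β' with h | rfl | h
  · simp only [h, true_or, iff_true]
    exact (omega0_mul_add_lt h n).le.trans le_self_add
  · simp
  · have := (omega0_mul_add_lt h n').trans_le (le_self_add (b := (n : Ordinal.{0})))
    simp [h.not_gt, h.ne', this]

theorem PassSpec.stage_mono (A : PassSpec) (sel : (ℕ → Bool) × (ℕ → Bool) → Bool)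
    (hact : ∀ n x, sel x = true → sel (A.act n x) = true)
    (hlim : ∀ α, Order.IsSuccLimit α → sel (A.stage α) = limsupBit α fun γ => sel (A.stage γ))
    {γ δ : Ordinal.{0}} (h : γ ≤ δ) (hγ : sel (A.stage γ) = true) : sel (A.stage δ) = true := by
  induction δ using Ordinal.limitRecOn with
  | zero => rwa [← nonpos_iff_eq_zero.1 h]
  | add_one δ ih =>
    rcases h.eq_or_lt with rfl | h
    · exact hγ
    · obtain ⟨β, n, rfl⟩ := exists_eq_omega0_mul_add δ
      have h2 := A.stage_add_one β n
      rw [Nat.cast_add, Nat.cast_one, ← add_assoc] at h2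
      rw [h2]
      exact hact _ _ (ih (Order.lt_add_one_iff.1 h))
  | limit δ hl ih =>
    rcases h.eq_or_lt with rfl | h
    · exact hγ
    · rw [hlim δ hl]
      exact limsupBit_eq_of_eventually h fun ε h1 h2 => ih ε h2 h1

theorem exists_eq_slot (n : ℕ) : ∃ q t j, j < 15 ∧ n = 15 * Nat.pair q t + j :=
  ⟨(n / 15).unpair.1, (n / 15).unpair.2, n % 15, Nat.mod_lt _ (by norm_num), by
    rw [Nat.pair_unpair, Nat.div_add_mod]⟩

theorem uspec_act_mono {p tag u v : ℕ} (ht : tag = 1 ∨ tag = 3 ∨ tag = 5) (n : ℕ)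
    (x : (ℕ → Bool) × (ℕ → Bool)) (hx : x.1 (uaddr tag u v) = true) :
    ((uspec p).act n x).1 (uaddr tag u v) = true := by
  obtain ⟨q, t, j, hj, rfl⟩ := exists_eq_slot n
  have h0 : tag ≠ 0 := by omega
  rw [uspec_act _ _ _ _ hj]
  by_cases h : q ≠ u ∨ writeTag j ≠ tag
  · rw [applyWrite_frame h0 hj h, hx]
  · push Not at h
    obtain ⟨rfl, h⟩ := h
    have h2 : ∀ w, (applyWrite (1, uaddr tag q w) x).1 (uaddr tag q v) = true := by
      intro w
      simp only [applyWrite, one_ne_zero, if_false, if_true, Function.update_apply, hx, ite_self]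
    have h3 : (applyWrite (0, 0) x).1 (uaddr tag q v) = true := by rw [applyWrite_nop h0, hx]
    have h4 : j = 2 ∧ tag = 1 ∨ j = 4 ∧ tag = 3 ∨ j = 12 ∧ tag = 5 := by
      subst h
      revert ht h0
      clear h2 h3 hx
      interval_cases j <;> simp [writeTag]
    rcases h4 with ⟨rfl, rfl⟩ | ⟨rfl, rfl⟩ | ⟨rfl, rfl⟩ <;> simp [univ, Bool.cond_eq_ite] <;>
      split_ifs <;> first | exact h2 _ | exact h3

theorem uspec_act_mono_output {p m : ℕ} (n : ℕ) (x : (ℕ → Bool) × (ℕ → Bool))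
    (hx : x.2 m = true) : ((uspec p).act n x).2 m = true := by
  rw [PassSpec.act]
  split_ifs
  · exact hx
  · exact hx
  · simp [Function.update_apply, hx]

theorem uspec_stage_mono {p tag u v : ℕ} (ht : tag = 1 ∨ tag = 3 ∨ tag = 5) {γ δ : Ordinal.{0}}
    (h : γ ≤ δ) (hγ : ((uspec p).stage γ).1 (uaddr tag u v) = true) :
    ((uspec p).stage δ).1 (uaddr tag u v) = true :=
  (uspec p).stage_mono (fun x => x.1 (uaddr tag u v)) (uspec_act_mono ht)
    (fun α hα => by rw [PassSpec.stage_limit _ hα]) h hγ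

theorem uspec_stage_mono_output {p m : ℕ} {γ δ : Ordinal.{0}}
    (h : γ ≤ δ) (hγ : ((uspec p).stage γ).2 m = true) : ((uspec p).stage δ).2 m = true :=
  (uspec p).stage_mono (fun x => x.2 m) uspec_act_mono_output
    (fun α hα => by rw [PassSpec.stage_limit _ hα]) h hγ

theorem uspec_stage_limit_iff {p tag u v : ℕ} (ht : tag = 1 ∨ tag = 3 ∨ tag = 5) {α : Ordinal.{0}}
    (h : Order.IsSuccLimit α) : ((uspec p).stage α).1 (uaddr tag u v) = true ↔
      ∃ γ < α, ((uspec p).stage γ).1 (uaddr tag u v) = true := by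
  constructor
  · rw [PassSpec.stage_limit _ h, limsupBit_eq_true]
    intro H
    obtain ⟨γ, -, h1, h2⟩ := H 0 h.pos
    exact ⟨γ, h1, h2⟩
  · rintro ⟨γ, h1, h2⟩
    exact uspec_stage_mono ht h1.le h2

variable {p q : ℕ}

theorem ubit_zero {α : Ordinal.{0}} {tag u v : ℕ} :
    ubit p α 0 tag u v = ((uspec p).stage (ω * α)).1 (uaddr tag u v) := by
  rw [ubit, ustage, Nat.cast_zero, add_zero]

theorem exists_block_interval {q t n : ℕ} (h : 15 * Nat.pair q t ≤ n) :
    ∃ t', t ≤ t' ∧ 15 * Nat.pair q t' ≤ n ∧ n < 15 * Nat.pair q (t' + 1) := by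
  by_contra! H
  have key : ∀ k, 15 * Nat.pair q (t + k) ≤ n := by
    intro k
    induction k with
    | zero => exact h
    | succ k ih => exact H (t + k) (by omega) ih
  have := key (n + 1)
  have := Nat.right_le_pair q (t + (n + 1))
  omega

theorem Simulates.tape_eq {α : Ordinal.{0}} (h : Simulates p α 0 q 0) {n t : ℕ}
    (hn : 15 * Nat.pair q t ≤ n) (i : Fin 3) (v : ℕ) :
    ∃ t', t ≤ t' ∧ ubit p α n (10 + i) q v = frozenTape q (ω * α + t') i v := by
  obtain ⟨t', h1, h2, h3⟩ := exists_block_interval hn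
  rcases le_or_gt n (15 * Nat.pair q t' + (8 + i)) with h4 | h4
  · refine ⟨t', h1, ?_⟩
    rw [← (h.start t').tape]
    have h5 := i.2
    refine ubit_eq_of_untouched (by omega) h2 fun m h6 h7 => Or.inr ?_
    have h8 : m % 15 < 8 + i := by omega
    have h9 : ∀ i < 3, ∀ j < 8 + i, writeTag j ≠ 10 + i := by decide
    exact h9 i h5 _ h8
  · refine ⟨t' + 1, by omega, ?_⟩
    rw [← (h.start (t' + 1)).tape]
    refine (ubit_eq_of_untouched (by omega) h3.le fun m h6 h7 => ?_).symm
    by_cases h8 : (m / 15).unpair.1 = q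
    · right
      have h10 : m / 15 = Nat.pair q (m / 15).unpair.2 := by rw [← h8, Nat.pair_unpair]
      have h11 : Nat.pair q (m / 15).unpair.2 < Nat.pair q (t' + 1) := by omega
      rw [pair_lt_pair_iff] at h11
      have h12 : Nat.pair q (m / 15).unpair.2 ≤ Nat.pair q t' := pair_le_pair le_rfl (by omega)
      have h13 : 8 + i < m % 15 := by omega
      have h5 := i.2
      have h9 : ∀ i < 3, ∀ j < 15, 8 + i < j → writeTag j ≠ 10 + i := by decide
      exact h9 i h5 _ (Nat.mod_lt _ (by norm_num)) h13
    · exact Or.inl h8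

theorem Simulates.tape_eq_of_lt {α : Ordinal.{0}} (h : Simulates p α 0 q 0) (n : ℕ)
    (i : Fin 3) (v : ℕ) :
    ∃ t' : ℕ, ubit p α n (10 + i) q v = frozenTape q (ω * α + t') i v := by
  rcases le_total (15 * Nat.pair q 0) n with h1 | h1
  · obtain ⟨t', -, h2⟩ := h.tape_eq h1 i v
    exact ⟨t', h2⟩
  · exact ⟨0, by rw [ubit_before (by omega) h1, h.tape]⟩

/-- The universal machine simulates every program correctly. -/
theorem simulates_zero (p q : ℕ) (α : Ordinal.{0}) : Simulates p α 0 q 0 := by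
  induction α using WellFoundedLT.induction with
  | ind α ih =>
    rcases eq_or_ne α 0 with rfl | h0
    · have h : ∀ tag v, ubit p 0 0 tag q v = false := by
        intro tag v
        rw [ubit_zero, mul_zero, PassSpec.stage_zero]
      refine ⟨fun i v => ?_, ?_, ?_, fun h => absurd rfl h, fun h => absurd rfl h,
        fun t' ht' => absurd ht' (Nat.not_lt_zero t')⟩
      · simp [h, frozenTape_zero]
      · simp [h, HaltedBefore]
      · simp [h]
    · have hlim := isSuccLimit_omega0_mul h0
      refine ⟨fun i v => ?_, ?_, ?_, fun h => absurd rfl h, fun h => absurd rfl h,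
        fun t' ht' => absurd ht' (Nat.not_lt_zero t')⟩
      · rw [Nat.cast_zero, add_zero, frozenTape_limit hlim, ubit_zero, PassSpec.stage_limit _ hlim]
        dsimp only
        rw [Bool.eq_iff_iff, limsupBit_eq_true, limsupBit_eq_true]
        constructor
        · intro H δ hδ
          obtain ⟨β, t, rfl⟩ := exists_eq_omega0_mul_add δ
          obtain ⟨γ, h1, h2, h3⟩ := H (ω * β + (15 * Nat.pair q t : ℕ))
            (omega0_mul_add_lt (omega0_mul_add_lt_iff.1 hδ) _)
          obtain ⟨β', n, rfl⟩ := exists_eq_omega0_mul_add γ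
          have hβ' := omega0_mul_add_lt_iff.1 h2
          rcases omega0_mul_add_le_iff.1 h1 with h4 | ⟨rfl, h4⟩
          · obtain ⟨t', h5⟩ := (ih β' hβ').tape_eq_of_lt n i v
            exact ⟨ω * β' + t', omega0_mul_add_le_iff.2 (Or.inl h4), omega0_mul_add_lt hβ' _,
              h5.symm.trans h3⟩
          · obtain ⟨t', h6, h5⟩ := (ih β hβ').tape_eq h4 i v
            exact ⟨ω * β + t', omega0_mul_add_le_iff.2 (Or.inr ⟨rfl, h6⟩),
              omega0_mul_add_lt hβ' _, h5.symm.trans h3⟩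
        · intro H δ hδ
          obtain ⟨γ, h1, h2, h3⟩ := H δ hδ
          obtain ⟨β', t, rfl⟩ := exists_eq_omega0_mul_add γ
          have hβ' := omega0_mul_add_lt_iff.1 h2
          refine ⟨ω * β' + (15 * Nat.pair q t : ℕ), h1.trans ?_, omega0_mul_add_lt hβ' _, ?_⟩
          · have := Nat.right_le_pair q t
            exact omega0_mul_add_le_iff.2 (Or.inr ⟨rfl, by omega⟩)
          · rw [← h3]
            exact ((ih β' hβ').start t).tape i v
      · rw [ubit_zero, uspec_stage_limit_iff (by omega) hlim, Nat.cast_zero, add_zero,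
          haltedBefore_limit hlim]
        constructor
        · rintro ⟨γ, h1, h2⟩
          obtain ⟨β, n, rfl⟩ := exists_eq_omega0_mul_add γ
          have hβ := omega0_mul_add_lt_iff.1 h1
          refine ⟨ω * β + n, h1, ((ih β hβ).start n).hasHalted.1
            (uspec_stage_mono (by omega) (omega0_mul_add_le_iff.2 (Or.inr ⟨rfl, ?_⟩)) h2)⟩
          have := Nat.right_le_pair q n
          omega
        · rintro ⟨γ, h1, h2⟩
          obtain ⟨β, n, rfl⟩ := exists_eq_omega0_mul_add γ
          have hβ := omega0_mul_add_lt_iff.1 h1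
          exact ⟨ω * β + (15 * Nat.pair q n : ℕ), omega0_mul_add_lt hβ _,
            ((ih β hβ).start n).hasHalted.2 h2⟩
      · have h0' := pos_iff_ne_zero.2 h0
        simp only [h0, ne_eq, not_false_eq_true, true_or, decide_true]
        rw [ubit_zero, uspec_stage_limit_iff (by omega) hlim]
        refine ⟨ω * 0 + (15 * Nat.pair q 1 : ℕ), omega0_mul_add_lt h0' _,
          ((ih 0 h0').start 1).started.trans (by simp)⟩

end

section

open Ordinal

variable {p q k k' : ℕ} {α : Ordinal.{0}}

theorem ubit_halted_iff {n t v : ℕ} (hn : 15 * Nat.pair k t + 11 ≤ n) (hmod : n % 15 = 11)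
    (hv : v ≤ t + 1) : ubit p α n 4 k v = true ↔ HaltedBefore k (ω * α + v) := by
  obtain ⟨t', h1, h2, h3⟩ := exists_block_interval (q := k) (t := t) (n := n) (by omega)
  rw [← ((simulates_zero p k α).start (t' + 1)).halted (by omega) v (by omega)]
  rw [ubit_eq_of_untouched (by omega) h3.le fun m h6 h7 => ?_]
  by_cases h8 : (m / 15).unpair.1 = k
  · right
    have h10 : m / 15 = Nat.pair k (m / 15).unpair.2 := by rw [← h8, Nat.pair_unpair]
    have h11 : Nat.pair k (m / 15).unpair.2 < Nat.pair k (t' + 1) := by omega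
    rw [pair_lt_pair_iff] at h11
    have h12 : Nat.pair k (m / 15).unpair.2 ≤ Nat.pair k t' := pair_le_pair le_rfl (by omega)
    have h13 : 11 ≤ m % 15 := by omega
    have h9 : ∀ j < 15, 11 ≤ j → writeTag j ≠ 4 := by decide
    exact h9 _ (Nat.mod_lt _ (by norm_num)) h13
  · exact Or.inl h8

/-- Program `k'` halts at stage `β`, after `k` and before `p`, ties being broken by comparing
programs. -/
def HaltsBetween (p k k' : ℕ) (β : Ordinal.{0}) : Prop :=
  ¬HaltedBefore k' β ∧ HaltedBefore k' (β + 1) ∧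
    (HaltedBefore k β ∨ HaltedBefore k (β + 1) ∧ k < k') ∧
    ¬HaltedBefore p β ∧ (¬HaltedBefore p (β + 1) ∨ k' < p)

theorem ubefore_iff {t n : ℕ} (hn : n = 15 * Nat.pair (Nat.pair (Nat.pair k k') p) t + 11) :
    ubefore (ustage p α n).1 p k k' t = true ↔ HaltsBetween p k k' (ω * α + t) := by
  have h1 := Nat.left_le_pair (Nat.pair k k') p
  have h2 := Nat.right_le_pair (Nat.pair k k') p
  have h3 := Nat.left_le_pair k k'
  have h4 := Nat.right_le_pair k k'
  have key : ∀ e ≤ Nat.pair (Nat.pair k k') p, ∀ v ≤ t + 1,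
      (ustage p α n).1 (uaddr 4 e v) = decide (HaltedBefore e (ω * α + v)) := by
    intro e he v hv
    rw [Bool.eq_iff_iff, decide_eq_true_iff]
    have := pair_le_pair he (le_refl t)
    exact ubit_halted_iff (t := t) (by omega) (by omega) hv
  have hc : ω * α + ((t + 1 : ℕ) : Ordinal.{0}) = ω * α + t + 1 := by
    rw [Nat.cast_add, Nat.cast_one, add_assoc]
  rw [ubefore, key k (by omega) _ (by omega), key k (by omega) _ le_rfl,
    key k' (by omega) _ (by omega), key k' (by omega) _ le_rfl, key p (by omega) _ (by omega),
    key p (by omega) _ le_rfl, HaltsBetween, hc]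
  simp only [Bool.and_eq_true, Bool.or_eq_true, Bool.not_eq_true', decide_eq_true_iff,
    decide_eq_false_iff_not, and_assoc]

theorem univ_fst_le_one {look : ℕ → Bool} {t j : ℕ} (hj : j ≠ 11) :
    (univ p look q t j).1 ≤ 1 := by
  unfold univ
  simp only [Bool.cond_eq_ite, beq_eq_false_iff_ne.2 hj, Bool.false_eq_true, if_false]
  repeat' split
  all_goals first | exact Nat.zero_le _ | exact le_rfl | exact Bool.toNat_le _

theorem univ_output {look : ℕ → Bool} {t : ℕ} :
    univ p look q t 11 = if q.unpair.2 = p ∧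
      ubefore look p q.unpair.1.unpair.1 q.unpair.1.unpair.2 t = true then (2, q.unpair.1)
      else (0, 0) := by
  simp [univ, Bool.cond_eq_ite]

theorem applyWrite_output_of_le {w : ℕ × ℕ} (h : w.1 ≤ 1) (x : (ℕ → Bool) × (ℕ → Bool)) :
    (applyWrite w x).2 = x.2 := by
  rw [applyWrite]
  split_ifs
  · rfl
  · rfl
  · omega

theorem ustage_output_succ (n : ℕ) (h : (ustage p α (n + 1)).2 (Nat.pair k k') = true) :
    (ustage p α n).2 (Nat.pair k k') = true ∨ ∃ β, HaltsBetween p k k' β := by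
  obtain ⟨q, t, j, hj, rfl⟩ := exists_eq_slot n
  rw [add_assoc, ustage_succ _ _ _ _ _ hj] at h
  by_cases hj' : j = 11
  · subst hj'
    rw [univ_output] at h
    split_ifs at h with h2
    · obtain ⟨h2, h3⟩ := h2
      by_cases h4 : q.unpair.1 = Nat.pair k k'
      · right
        have h5 : q = Nat.pair (Nat.pair k k') p := by rw [← h2, ← h4, Nat.pair_unpair]
        rw [h4, Nat.unpair_pair] at h3
        exact ⟨_, (ubefore_iff (by rw [h5])).1 h3⟩
      · left
        simpa [applyWrite, Function.update_apply, Ne.symm h4] using h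
    · left
      rwa [applyWrite_output_of_le (by norm_num)] at h
  · left
    rwa [applyWrite_output_of_le (univ_fst_le_one hj')] at h

theorem exists_haltsBetween {δ : Ordinal.{0}} (h : ((uspec p).stage δ).2 (Nat.pair k k') = true) :
    ∃ β, HaltsBetween p k k' β := by
  induction δ using Ordinal.limitRecOn with
  | zero => simp [PassSpec.stage_zero] at h
  | add_one δ ih =>
    obtain ⟨β, n, rfl⟩ := exists_eq_omega0_mul_add δ
    rw [add_assoc, ← Nat.cast_one, ← Nat.cast_add] at h
    exact (ustage_output_succ n h).elim ih id
  | limit δ hl ih =>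
    rw [PassSpec.stage_limit _ hl, limsupBit_eq_true] at h
    obtain ⟨γ, -, h1, h2⟩ := h 0 hl.pos
    exact ih γ h1 h2

theorem stage_output_of_haltsBetween {t : ℕ} (h : HaltsBetween p k k' (ω * α + t)) :
    ((uspec p).stage (ω * (α + 1))).2 (Nat.pair k k') = true := by
  refine uspec_stage_mono_output (γ := ω * α +
    (15 * Nat.pair (Nat.pair (Nat.pair k k') p) t + (11 + 1) : ℕ)) ?_ ?_
  · exact (omega0_mul_add_lt (Order.lt_add_one_iff.2 le_rfl) _).le
  · change (ustage _ _ _).2 _ = true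
    rw [ustage_succ _ _ _ _ _ (by norm_num), univ_output, Nat.unpair_pair, Nat.unpair_pair,
      if_pos ⟨rfl, (ubefore_iff rfl).2 h⟩]
    simp [applyWrite]

/-- Program `k` halts before program `k'` does, ties being broken by comparing programs. -/
def HaltsEarlier (k k' : ℕ) : Prop :=
  (mach k).halts zeroR ∧ (mach k').halts zeroR ∧
    (haltTime k < haltTime k' ∨ haltTime k = haltTime k' ∧ k < k')

theorem haltsBetween_haltTime (h : HaltsEarlier k k')
    (hp : (mach p).halts zeroR → HaltsEarlier k' p) : HaltsBetween p k k' (haltTime k') := by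
  obtain ⟨h1, h2, h3⟩ := h
  simp only [HaltsBetween, haltedBefore_iff, h1, h2, true_and, lt_irrefl, not_false_eq_true,
    Order.lt_add_one_iff, le_refl]
  refine ⟨h3.imp id fun h => ⟨h.1.le, h.2⟩, ?_, ?_⟩
  · rintro ⟨h4, h5⟩
    obtain ⟨-, -, h6 | h6⟩ := hp h4
    · exact h6.not_gt h5
    · exact h6.1.not_gt h5
  · by_cases h4 : (mach p).halts zeroR
    · obtain ⟨-, -, h6 | h6⟩ := hp h4
      · exact Or.inl fun h => h6.not_ge h.2
      · exact Or.inr h6.2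
    · exact Or.inl fun h => h4 h.1

theorem HaltsBetween.haltsEarlier {β : Ordinal.{0}} (h : HaltsBetween p k k' β) :
    HaltsEarlier k k' ∧ ((mach p).halts zeroR → HaltsEarlier k' p) := by
  simp only [HaltsBetween, haltedBefore_iff, Order.lt_add_one_iff] at h
  obtain ⟨h1, ⟨h2, h3⟩, h4, h5, h6⟩ := h
  have h7 : haltTime k' = β := h3.antisymm (not_lt.1 fun h => h1 ⟨h2, h⟩)
  subst h7
  refine ⟨?_, fun hp => ⟨h2, hp, ?_⟩⟩
  · rcases h4 with ⟨h8, h9⟩ | ⟨⟨h8, h9⟩, h10⟩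
    · exact ⟨h8, h2, Or.inl h9⟩
    · exact ⟨h8, h2, h9.lt_or_eq.imp id fun h => ⟨h, h10⟩⟩
  · have h8 : haltTime k' ≤ haltTime p := not_lt.1 fun h => h5 ⟨hp, h⟩
    rcases h8.lt_or_eq with h9 | h9
    · exact Or.inl h9
    · exact Or.inr ⟨h9, h6.resolve_left fun h => h ⟨hp, h9.ge⟩⟩

/-- The relation `HaltsEarlier` restricted to the programs that halt before `p` does. -/
noncomputable def segmentReal (p : ℕ) : R := fun m =>
  decide (HaltsEarlier m.unpair.1 m.unpair.2 ∧ ((mach p).halts zeroR → HaltsEarlier m.unpair.2 p))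

theorem stage_output_le_segmentReal {δ : Ordinal.{0}} {m : ℕ}
    (h : ((uspec p).stage δ).2 m = true) : segmentReal p m = true := by
  rw [← Nat.pair_unpair m] at h
  obtain ⟨β, hβ⟩ := exists_haltsBetween h
  exact decide_eq_true hβ.haltsEarlier

theorem stage_output_eq_segmentReal {α δ : Ordinal.{0}}
    (hα : ∀ k, (mach k).halts zeroR → ((mach p).halts zeroR → HaltsEarlier k p) →
      haltTime k < ω * α) (h : ω * α ≤ δ) : ((uspec p).stage δ).2 = segmentReal p := by
  funext m
  rw [Bool.eq_iff_iff]
  refine ⟨stage_output_le_segmentReal, fun h2 => ?_⟩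
  obtain ⟨h3, h4⟩ := of_decide_eq_true h2
  have h5 := hα _ h3.2.1 h4
  have h6 := haltsBetween_haltTime h3 h4
  obtain ⟨β, n, h7⟩ := exists_eq_omega0_mul_add (haltTime m.unpair.2)
  rw [h7] at h5 h6
  refine uspec_stage_mono_output ?_ (by simpa using stage_output_of_haltsBetween h6)
  exact (mul_le_mul_right (Order.add_one_le_of_lt (omega0_mul_add_lt_iff.1 h5)) _).trans h

theorem stage_hasHalted_iff : ((uspec p).stage (ω * α)).1 (uaddr 3 q 0) = true ↔
    HaltedBefore q (ω * α) := by
  rw [← ubit_zero, (simulates_zero p q α).hasHalted, Nat.cast_zero, add_zero]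

theorem writableReal_segmentReal (hp : (mach p).halts zeroR) : WritableReal (segmentReal p) := by
  obtain ⟨M, hM, -⟩ := (uspec p).exists_machine (uaddr 3 p 0)
  have hex : ∃ α : Ordinal.{0}, haltTime p < ω * α := by
    obtain ⟨β, n, h⟩ := exists_eq_omega0_mul_add (haltTime p)
    exact ⟨β + 1, by rw [h]; exact omega0_mul_add_lt (Order.lt_add_one_iff.2 le_rfl) n⟩
  obtain ⟨α, h1, h2⟩ := WellFounded.has_min (wellFounded_lt (α := Ordinal.{0}))
    {α | haltTime p < ω * α} hex
  obtain ⟨s, h3, -, -, h4⟩ := hM α (stage_hasHalted_iff.2 (haltedBefore_iff.2 ⟨hp, h1⟩))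
    fun α' h => by
      rw [← Bool.not_eq_true, stage_hasHalted_iff, haltedBefore_iff]
      exact fun h5 => h2 α' h5.2 h
  refine ⟨M, s, h3, ?_⟩
  rw [h4]
  refine stage_output_eq_segmentReal (α := α) (fun k hk hkp => ?_) le_rfl
  obtain ⟨-, -, h5 | h5⟩ := hkp hp
  · exact h5.trans h1
  · exact h5.1.trans_lt h1

theorem eventuallyWritableReal_segmentReal (hp : ¬(mach p).halts zeroR) :
    EventuallyWritableReal (segmentReal p) := by
  obtain ⟨M, -, hM⟩ := (uspec p).exists_machine (uaddr 3 p 0)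
  obtain ⟨h1, h2⟩ := hM fun α => by
    rw [← Bool.not_eq_true, stage_hasHalted_iff, haltedBefore_iff]
    exact fun h => hp h.1
  obtain ⟨β, hβ⟩ := Ordinal.bddAbove_of_small (s := Set.range haltTime)
  refine ⟨M, h1, blockLength * (β + 1), fun s hs => ?_⟩
  obtain ⟨δ, h3, h4⟩ := h2 s
  rw [h4]
  have hb : blockLength ≠ 0 := by simp [blockLength]
  refine stage_output_eq_segmentReal (α := β + 1) (fun k hk _ => ?_) (le_trans ?_ h3)
  · have h5 : haltTime k ≤ β := hβ ⟨k, rfl⟩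
    refine (Order.lt_add_one_iff.2 h5).trans_le ?_
    exact le_mul_of_one_le_left' (Order.one_le_iff_pos.2 omega0_pos)
  · exact mul_le_mul_right ((mul_le_iff_le_div hb).1 hs) _

end

section

open Ordinal

variable {p q : ℕ} {α : Ordinal.{0}}

theorem writeTag_eq_five : ∀ j < 15, writeTag j = 5 → j = 12 := by decide

theorem writeTag_eq_six : ∀ j < 15, writeTag j = 6 → j = 13 ∨ j = 14 := by decide

theorem pair_slot_inj {q t j q' t' j' : ℕ} (hj : j < 15) (hj' : j' < 15) :
    15 * Nat.pair q t + j = 15 * Nat.pair q' t' + j' ↔ q = q' ∧ t = t' ∧ j = j' := by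
  refine ⟨fun h => ?_, by rintro ⟨rfl, rfl, rfl⟩; rfl⟩
  have h1 : Nat.pair q t = Nat.pair q' t' := by omega
  obtain ⟨rfl, rfl⟩ := Nat.pair_eq_pair.1 h1
  exact ⟨rfl, rfl, by omega⟩

theorem ubit_removed_succ (m : ℕ) : ubit p α (m + 1) 5 q 0 = (ubit p α m 5 q 0 ||
    decide (m = 15 * Nat.pair q 0 + 12) &&
      (ubit p α m 2 q 0 && ubit p α m 3 p 0 && !ubit p α m 6 q 0)) := by
  obtain ⟨u, t, j, hj, rfl⟩ := exists_eq_slot m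
  simp only [pair_slot_inj hj (by norm_num : 12 < 15)]
  by_cases h : u ≠ q ∨ writeTag j ≠ 5
  · rw [add_assoc, ubit, ustage_succ _ _ _ _ _ hj, applyWrite_frame (by norm_num) hj h]
    have : ¬(u = q ∧ t = 0 ∧ j = 12) := by
      rintro ⟨rfl, -, rfl⟩
      simp [writeTag] at h
    simp [this, ubit]
  · push Not at h
    obtain ⟨rfl, h⟩ := h
    obtain rfl := writeTag_eq_five j hj h
    rw [add_assoc, ubit_slot_eq hj]
    by_cases ht : t = 0
    · subst ht
      cases h2 : (ubit p α (15 * Nat.pair u 0 + 12) 2 u 0 && ubit p α (15 * Nat.pair u 0 + 12) 3 p 0 &&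
        !ubit p α (15 * Nat.pair u 0 + 12) 6 u 0) <;> simp only [ubit] at h2 <;>
        simp [univ, h2, applyWrite, ubit, uaddr_ne_zero]
    · simp [univ, ht, beq_eq_false_iff_ne.2 ht, applyWrite_nop, ubit]

theorem ubit_blocked_succ (m : ℕ) : ubit p α (m + 1) 6 q 0 =
    if m = 15 * Nat.pair q 0 + 13 then !ubit p α m 3 p 0 else (ubit p α m 6 q 0 ||
      decide (∃ t, m = 15 * Nat.pair q t + 14 ∧ ubit p α m 3 p 0 = true ∧
        urel (ustage p α m).1 p t q = true ∧ ubit p α m 5 t 0 = false)) := by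
  obtain ⟨u, t, j, hj, rfl⟩ := exists_eq_slot m
  simp only [pair_slot_inj hj (by norm_num : 13 < 15), pair_slot_inj hj (by norm_num : 14 < 15)]
  by_cases h : u ≠ q ∨ writeTag j ≠ 6
  · rw [add_assoc, ubit, ustage_succ _ _ _ _ _ hj, applyWrite_frame (by norm_num) hj h]
    have h1 : ¬(u = q ∧ t = 0 ∧ j = 13) := by
      rintro ⟨rfl, -, rfl⟩
      simp [writeTag] at h
    have h2 : ¬(u = q ∧ j = 14) := by
      rintro ⟨rfl, rfl⟩
      simp [writeTag] at h
    rw [if_neg h1, decide_eq_false, Bool.or_false, ubit]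
    rintro ⟨t', ⟨h3, -, h4⟩, -⟩
    exact h2 ⟨h3, h4⟩
  · push Not at h
    obtain ⟨rfl, h⟩ := h
    rw [add_assoc, ubit_slot_eq hj]
    obtain rfl | rfl := writeTag_eq_six j hj h
    · by_cases ht : t = 0
      · subst ht
        simp [univ, applyWrite_toNat, ubit]
      · simp [univ, ht, beq_eq_false_iff_ne.2 ht, applyWrite_nop, ubit]
    · cases h2 : (ubit p α (15 * Nat.pair u t + 14) 3 p 0 &&
        urel (ustage p α (15 * Nat.pair u t + 14)).1 p t u &&
        !ubit p α (15 * Nat.pair u t + 14) 5 t 0) <;> simp only [ubit] at h2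
      · simp only [univ, h2]
        simp only [Bool.and_eq_false_iff, Bool.not_eq_false'] at h2
        simp [applyWrite_nop, ubit]
        grind
      · simp only [univ, h2]
        simp only [Bool.and_eq_true, Bool.not_eq_true'] at h2
        simp [applyWrite, ubit, h2]

/-- The real written by program `p`. -/
noncomputable def writtenReal (p : ℕ) : R := ((mach p).snap zeroR (haltTime p)).tape 2

theorem ubit_mono {tag u v n n' : ℕ} (ht : tag = 1 ∨ tag = 3 ∨ tag = 5) (h : n ≤ n')
    (hn : ubit p α n tag u v = true) : ubit p α n' tag u v = true :=
  uspec_stage_mono ht (by gcongr) hn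

theorem stage_of_ubit {tag u v n : ℕ} (ht : tag = 1 ∨ tag = 3 ∨ tag = 5)
    (hn : ubit p α n tag u v = true) : ((uspec p).stage (ω * (α + 1))).1 (uaddr tag u v) = true :=
  uspec_stage_mono ht (omega0_mul_add_lt (Order.lt_add_one_iff.2 le_rfl) n).le hn

theorem ubit_written {n v : ℕ} (h : ubit p α n 3 p 0 = true) :
    ubit p α n 12 p v = writtenReal p v := by
  have key : ∀ t : ℕ, HaltedBefore p (ω * α + t) → frozenTape p (ω * α + t) 2 v = writtenReal p v :=
    fun t ht => by rw [frozenTape, if_pos ht, writtenReal]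
  rcases le_total n (15 * Nat.pair p 0) with h1 | h1
  · rw [ubit_before (by norm_num) h1] at h ⊢
    exact ((simulates_zero p p α).tape 2 v).trans
      (key 0 ((simulates_zero p p α).hasHalted.1 h))
  · obtain ⟨t, -, h2, h3⟩ := exists_block_interval h1
    obtain ⟨t', h4, h5⟩ := (simulates_zero p p α).tape_eq h2 2 v
    refine h5.trans ?_
    have h6 := ((simulates_zero p p α).start (t + 1)).hasHalted.1 (ubit_mono (by norm_num) h3.le h)
    rcases h4.eq_or_lt with rfl | h4
    · rw [← key _ h6]
      rw [Nat.cast_add, Nat.cast_one, ← add_assoc] at h6 ⊢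
      rw [frozenTape_add_one_of_halted h6]
    · exact key _ (h6.mono (by gcongr; omega))

/-- The relation coded by the real written by program `p`, shifted and with `0` added on top. -/
def TopRel (p b a : ℕ) : Prop :=
  b ≠ 0 ∧ (a = 0 ∨ writtenReal p (Nat.pair (b - 1) (a - 1)) = true)

theorem urel_iff {n a b : ℕ} (h : ubit p α n 3 p 0 = true) :
    urel (ustage p α n).1 p b a = true ↔ TopRel p b a := by
  have h1 := ubit_written (v := Nat.pair (b - 1) (a - 1)) h
  rw [ubit] at h1
  simp [urel, TopRel, h1]

/-- Element `a` has been removed by the start of pass `α`. -/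
def Removed (p a : ℕ) (α : Ordinal.{0}) : Prop :=
  ((uspec p).stage (ω * α)).1 (uaddr 5 a 0) = true

theorem Removed.mono {a : ℕ} {α' : Ordinal.{0}} (h : Removed p a α) (hα : α ≤ α') : Removed p a α' :=
  uspec_stage_mono (by norm_num) (mul_le_mul_right hα _) h

theorem removed_of_not_blocked_add_one
    (h : ((uspec p).stage (ω * (α + 1))).1 (uaddr 6 q 0) = false) {b : ℕ} (hb : TopRel p b q) :
    Removed p b (α + 1) := by
  have hmono : ∀ n n', 15 * Nat.pair q 0 + 14 ≤ n → n ≤ n' → ubit p α n 6 q 0 = true →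
      ubit p α n' 6 q 0 = true := by
    intro n n' h1 h2 h3
    induction n', h2 using Nat.le_induction with
    | base => exact h3
    | succ m hm ih => rw [ubit_blocked_succ, if_neg (by omega), ih, Bool.true_or]
  have hfalse : ∀ n, 15 * Nat.pair q 0 + 14 ≤ n → ubit p α n 6 q 0 = false := by
    intro n hn
    by_contra h1
    rw [Bool.not_eq_false] at h1
    have hl : Order.IsSuccLimit (ω * (α + 1)) := isSuccLimit_omega0_mul (by simp)
    rw [PassSpec.stage_limit _ hl] at h
    have h2 : limsupBit (ω * (α + 1)) (fun γ => ((uspec p).stage γ).1 (uaddr 6 q 0)) = true := by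
      refine limsupBit_eq_of_eventually (β := ω * α + n)
        (omega0_mul_add_lt (Order.lt_add_one_iff.2 le_rfl) n) fun γ h3 h4 => ?_
      obtain ⟨β, m, rfl⟩ := exists_eq_omega0_mul_add γ
      rw [omega0_mul_add_le_iff] at h3
      rw [omega0_mul_add_lt_iff, Order.lt_add_one_iff] at h4
      rcases h3 with h3 | ⟨rfl, h3⟩
      · exact absurd h3 h4.not_gt
      · exact hmono n m hn h3 h1
    simp [h2] at h
  have h1 : ubit p α (15 * Nat.pair q 0 + 13) 3 p 0 = true := by
    have := hfalse _ le_rfl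
    rwa [ubit_blocked_succ (15 * Nat.pair q 0 + 13), if_pos rfl, Bool.not_eq_false'] at this
  have h0 := pair_le_pair (le_refl q) (Nat.zero_le b)
  have h2 : ubit p α (15 * Nat.pair q b + 14) 3 p 0 = true := ubit_mono (by norm_num) (by omega) h1
  have h3 := hfalse (15 * Nat.pair q b + 14 + 1) (by omega)
  rw [ubit_blocked_succ, if_neg (by omega), Bool.or_eq_false_iff, decide_eq_false_iff_not] at h3
  refine stage_of_ubit (by norm_num) (n := 15 * Nat.pair q b + 14) ?_
  by_contra h4
  exact h3.2 ⟨b, rfl, h2, (urel_iff h2).2 hb, by simpa using h4⟩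

theorem removed_of_not_blocked (hα : α ≠ 0)
    (h : ((uspec p).stage (ω * α)).1 (uaddr 6 q 0) = false) {b : ℕ} (hb : TopRel p b q) :
    Removed p b α := by
  rcases zero_or_succ_or_isSuccLimit α with h0 | ⟨β, rfl⟩ | hl
  · exact absurd h0 hα
  · exact removed_of_not_blocked_add_one h hb
  · have hl' := isSuccLimit_omega0_mul hα
    have h1 := h
    rw [PassSpec.stage_limit _ hl', ← Bool.not_eq_true, limsupBit_eq_true] at h1
    push Not at h1
    obtain ⟨γ, h2, h3⟩ := h1
    obtain ⟨β, m, rfl⟩ := exists_eq_omega0_mul_add γ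
    rw [omega0_mul_add_lt_iff] at h2
    have h4 := hl.add_one_lt h2
    refine (removed_of_not_blocked_add_one (q := q) ?_ hb).mono h4.le
    rw [← Bool.not_eq_true]
    exact h3 _ (omega0_mul_add_lt (Order.lt_add_one_iff.2 le_rfl) m).le
      ((mul_lt_mul_iff_right₀ omega0_pos).2 h4)

theorem Removed.exists_lt {a : ℕ} (h : Removed p a α) :
    ∃ β < α, ∀ b, TopRel p b a → Removed p b β := by
  obtain ⟨α₀, h1, h2⟩ := WellFounded.has_min (wellFounded_lt (α := Ordinal.{0}))
    {α | Removed p a α} ⟨α, h⟩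
  have h3 : α₀ ≤ α := not_lt.1 (h2 α h)
  have h0 : α₀ ≠ 0 := by
    rintro rfl
    simp [Removed, PassSpec.stage_zero] at h1
  obtain ⟨γ, h4, h5⟩ :=
    (uspec_stage_limit_iff (by norm_num) (isSuccLimit_omega0_mul h0)).1 h1
  obtain ⟨β, m, rfl⟩ := exists_eq_omega0_mul_add γ
  rw [omega0_mul_add_lt_iff] at h4
  have h6 : ¬Removed p a β := fun h => h2 β h h4
  refine ⟨β, h4.trans_le h3, fun b hb => ?_⟩
  change ubit p β m 5 a 0 = true at h5
  induction m with
  | zero => exact absurd (by rwa [ubit_zero] at h5) h6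
  | succ m ih =>
    rw [ubit_removed_succ, Bool.or_eq_true] at h5
    rcases h5 with h5 | h5
    · exact ih h5
    · simp only [Bool.and_eq_true, decide_eq_true_iff, Bool.not_eq_true'] at h5
      obtain ⟨rfl, ⟨h7, -⟩, h8⟩ := h5
      rw [ubit_limitFlag_block (by norm_num) (by norm_num), if_pos rfl,
        ubit_before (by norm_num) le_rfl, (simulates_zero p a β).started] at h7
      rw [ubit_block (j := 0) (by norm_num) (by norm_num) (by norm_num) (by decide), add_zero,
        ubit_before (by norm_num) le_rfl, ubit_zero] at h8
      exact removed_of_not_blocked (by simpa using h7) h8 hb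

theorem removed_add_two {a : ℕ} (h : HaltedBefore p (ω * α))
    (ha : ∀ b, TopRel p b a → Removed p b α) : Removed p a (α + 1 + 1) := by
  have h1 : ubit p α 0 3 p 0 = true := by rw [ubit_zero]; exact stage_hasHalted_iff.2 h
  have hfalse : ∀ n, 15 * Nat.pair a 0 + 14 ≤ n → ubit p α n 6 a 0 = false := by
    intro n hn
    induction n, hn using Nat.le_induction with
    | base =>
      rw [ubit_blocked_succ (15 * Nat.pair a 0 + 13), if_pos rfl,
        ubit_mono (by norm_num) (Nat.zero_le _) h1, Bool.not_true]
    | succ m hm ih =>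
      rw [ubit_blocked_succ, if_neg (by omega), ih, Bool.false_or, decide_eq_false_iff_not]
      rintro ⟨t, -, h2, h3, h4⟩
      have h5 : ubit p α 0 5 t 0 = true := by rw [ubit_zero]; exact ha t ((urel_iff h2).1 h3)
      rw [ubit_mono (by norm_num) (Nat.zero_le m) h5] at h4
      cases h4
  have h2 : ubit p (α + 1) 0 6 a 0 = false := by
    rw [ubit_zero, PassSpec.stage_limit _ (isSuccLimit_omega0_mul (by simp))]
    refine limsupBit_eq_of_eventually (β := ω * α + (15 * Nat.pair a 0 + 14 : ℕ))
      (omega0_mul_add_lt (Order.lt_add_one_iff.2 le_rfl) _) fun γ h3 h4 => ?_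
    obtain ⟨β, m, rfl⟩ := exists_eq_omega0_mul_add γ
    rw [omega0_mul_add_le_iff] at h3
    rw [omega0_mul_add_lt_iff, Order.lt_add_one_iff] at h4
    rcases h3 with h3 | ⟨rfl, h3⟩
    · exact absurd h3 h4.not_gt
    · exact hfalse m h3
  refine stage_of_ubit (by norm_num) (n := 15 * Nat.pair a 0 + 12 + 1) ?_
  have h3 : ubit p (α + 1) (15 * Nat.pair a 0 + 12) 6 a 0 = false := by
    rw [ubit_block (j := 0) (by norm_num) (by norm_num) (by norm_num) (by decide), add_zero,
        ubit_before (by norm_num) le_rfl, h2]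
  have h4 : ubit p (α + 1) (15 * Nat.pair a 0 + 12) 2 a 0 = true := by
    rw [ubit_limitFlag_block (by norm_num) (by norm_num), if_pos rfl,
        ubit_before (by norm_num) le_rfl, (simulates_zero p a (α + 1)).started]
    simp
  have h5 : ubit p (α + 1) (15 * Nat.pair a 0 + 12) 3 p 0 = true := by
    refine ubit_mono (by norm_num) (Nat.zero_le _) ?_
    rw [ubit_zero]
    exact stage_of_ubit (by norm_num) h1
  rw [ubit_removed_succ, h3, h4, h5]
  simp

theorem exists_removed (hp : (mach p).halts zeroR) (hwf : WellFounded (TopRel p)) (a : ℕ) :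
    ∃ α, Removed p a α := by
  induction a using hwf.induction with
  | _ a ih =>
    choose! f hf using ih
    obtain ⟨β, hβ⟩ := Ordinal.bddAbove_of_small (s := Set.range f)
    refine ⟨_, removed_add_two (α := max β (haltTime p + 1)) (haltedBefore_iff.2 ⟨hp, ?_⟩)
      fun b hb => (hf b hb).mono ((hβ ⟨b, rfl⟩).trans (le_max_left _ _))⟩
    refine (Order.lt_add_one_iff.2 le_rfl).trans_le ((le_max_right β _).trans ?_)
    exact le_mul_of_one_le_left' (Order.one_le_iff_pos.2 omega0_pos)

theorem exists_strictMono_clockable (hp : (mach p).halts zeroR) (hwf : WellFounded (TopRel p)) :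
    ∃ f : ℕ → {o : Ordinal.{0} // Clockable o}, ∀ b a, TopRel p b a → f b < f a := by
  have key : ∀ a, ∃ s α, Clockable s ∧ blockLength * α ≤ s ∧ s < blockLength * (α + 1) ∧
      Removed p a α ∧ ∀ β < α, ¬Removed p a β := by
    intro a
    obtain ⟨α, h1, h2⟩ := WellFounded.has_min (wellFounded_lt (α := Ordinal.{0}))
      {α | Removed p a α} (exists_removed hp hwf a)
    have h3 : ∀ β < α, ¬Removed p a β := fun β hβ h => h2 β h hβ
    obtain ⟨M, hM, -⟩ := (uspec p).exists_machine (uaddr 5 a 0)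
    obtain ⟨s, h4, h5, h6, -⟩ := hM α h1 fun β hβ => by simpa [Removed] using h3 β hβ
    exact ⟨s, α, ⟨M, h4⟩, h5, h6, h1, h3⟩
  choose s T hs h1 h2 h3 h4 using key
  refine ⟨fun a => ⟨s a, hs a⟩, fun b a hba => ?_⟩
  obtain ⟨β, h5, h6⟩ := (h3 a).exists_lt
  have h7 : T b ≤ β := not_lt.1 fun h => h4 b β h (h6 b hba)
  change s b < s a
  refine (h2 b).trans_le (le_trans ?_ (h1 a))
  exact mul_le_mul_right (Order.add_one_le_of_lt (h7.trans_lt h5)) _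

end

section

open Ordinal

variable {p k k' : ℕ}

theorem isWellOrder_haltsEarlier (s : Set ℕ) (hs : ∀ k ∈ s, (mach k).halts zeroR) :
    IsWellOrder s fun a b => HaltsEarlier a b := by
  let f : (fun a b : s => HaltsEarlier a b) ↪r
      Prod.Lex ((· < ·) : Ordinal.{0} → Ordinal.{0} → Prop) ((· < ·) : ℕ → ℕ → Prop) :=
    { toFun := fun k => (haltTime k, k)
      inj' := fun a b h => Subtype.ext (Prod.ext_iff.1 h).2
      map_rel_iff' := by
        intro a b
        change Prod.Lex _ _ (haltTime a, (a : ℕ)) (haltTime b, (b : ℕ)) ↔ _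
        simp only [Prod.lex_def, HaltsEarlier, hs a a.2, hs b b.2, true_and] }
  exact f.isWellOrder

theorem codesOrdinal_of_rel_iff {x : R} {s : Set ℕ} {r : ℕ → ℕ → Prop}
    [hr : IsWellOrder s fun a b => r a b] (hx : ∀ n k, rel x n k ↔ n ∈ s ∧ k ∈ s ∧ r n k)
    (hs : ∀ a ∈ s, ∃ b ∈ s, b ≠ a) : codesOrdinal x (type fun a b : s => r a b) := by
  have hf : field x = s := by
    ext n
    simp only [field, Set.mem_ofPred_eq, hx]
    constructor
    · rintro ⟨k, h | h⟩
      · exact h.1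
      · exact h.2.1
    · intro hn
      obtain ⟨b, hb, hne⟩ := hs n hn
      refine ⟨b, ?_⟩
      rcases trichotomous_of (fun a b : s => r a b) ⟨n, hn⟩ ⟨b, hb⟩ with h | h | h
      · exact Or.inl ⟨hn, hb, h⟩
      · exact absurd (congrArg Subtype.val h).symm hne
      · exact Or.inr ⟨hb, hn, h⟩
  let e : relOn x ≃r fun a b : s => r a b :=
    { toEquiv := Equiv.setCongr hf
      map_rel_iff' := by
        rintro ⟨a, ha⟩ ⟨b, hb⟩
        have ha' := hf ▸ ha
        have hb' := hf ▸ hb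
        simp [relOn, hx, ha', hb'] }
  have hw : codesWellOrder x := e.toRelEmbedding.isWellOrder
  refine ⟨hw, ?_⟩
  have : IsWellOrder (field x) (relOn x) := hw
  exact type_eq.2 ⟨e⟩

/-- The programs halting on input `0`. -/
def haltingSet : Set ℕ := {k | (mach k).halts zeroR}

/-- The order in which programs halt. -/
def haltingOrder (a b : haltingSet) : Prop := HaltsEarlier a b

instance : IsWellOrder haltingSet haltingOrder := isWellOrder_haltsEarlier _ fun _ h => h

theorem HaltsEarlier.trans {k k' k'' : ℕ} (h : HaltsEarlier k k') (h' : HaltsEarlier k' k'') :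
    HaltsEarlier k k'' :=
  trans_of haltingOrder (a := ⟨k, h.1⟩) (b := ⟨k', h.2.1⟩) (c := ⟨k'', h'.2.1⟩) h h'

theorem rel_segmentReal_iff {n k : ℕ} : rel (segmentReal p) n k ↔
    HaltsEarlier n k ∧ ((mach p).halts zeroR → HaltsEarlier k p) := by
  simp only [rel, segmentReal, Nat.unpair_pair, decide_eq_true_iff]

theorem writableOrdinal_of_lt_type {β : Ordinal.{0}} (h : β < type haltingOrder) (h1 : β ≠ 1) :
    WritableOrdinal β := by
  obtain ⟨⟨p, hp⟩, rfl⟩ := typein_surj haltingOrder h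
  let s : Set ℕ := {k | HaltsEarlier k p}
  have : IsWellOrder s fun a b => HaltsEarlier a b := isWellOrder_haltsEarlier s fun k hk => hk.1
  let e : (Subrel haltingOrder fun x => haltingOrder x ⟨p, hp⟩) ≃r
      fun a b : s => HaltsEarlier a b :=
    { toFun := fun a => ⟨a.1.1, a.2⟩
      invFun := fun a => ⟨⟨a.1, a.2.1⟩, a.2⟩
      left_inv := fun _ => rfl
      right_inv := fun _ => rfl
      map_rel_iff' := Iff.rfl }
  rw [← type_subrel, type_eq.2 ⟨e⟩] at h1 ⊢
  refine ⟨segmentReal p, writableReal_segmentReal hp, codesOrdinal_of_rel_iff (fun n k => ?_) ?_⟩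
  · rw [rel_segmentReal_iff]
    exact ⟨fun h => ⟨h.1.trans (h.2 hp), h.2 hp, h.1⟩, fun h => ⟨h.2.2, fun _ => h.2.1⟩⟩
  · intro a ha
    by_contra! H
    exact h1 (type_eq_one_iff_unique.2 ⟨⟨⟨⟨a, ha⟩⟩, fun b => Subtype.ext (H b b.2)⟩⟩)

theorem exists_haltsEarlier (hk : (mach k).halts zeroR) : ∃ k', HaltsEarlier k k' := by
  obtain ⟨e, he⟩ := exists_mach_eq (mach k)
  have h := Nat.left_le_pair (k + 1) e
  refine ⟨Nat.pair (k + 1) e, hk, by rwa [he], Or.inr ⟨?_, by omega⟩⟩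
  rw [haltTime, haltTime, he]

/-- A machine that enters state `1`, which is its halting state if `h` is `1`. -/
def oneStepMachine (h : Fin 3) : Machine :=
  ⟨2, 0, 1, h, fun _ => (1, fun _ => false, true)⟩

theorem oneStepMachine_state (h : Fin 3) {α : Ordinal.{0}} (hα : α ≠ 0) :
    ((oneStepMachine h).snap zeroR α).state = (1 : Fin 3) := by
  rcases zero_or_succ_or_isSuccLimit α with rfl | ⟨β, rfl⟩ | hl
  · exact absurd rfl hα
  · change ((oneStepMachine h).snap zeroR (β + 1)).state = _
    rw [Machine.snap_succ]
    rfl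
  · rw [Machine.snap_limit _ _ hl]
    rfl

theorem oneStepMachine_state_zero (h : Fin 3) :
    ((oneStepMachine h).snap zeroR 0).state = (0 : Fin 3) := by
  rw [Machine.snap_zero]
  rfl

theorem exists_not_halts : ∃ p, ¬(mach p).halts zeroR := by
  obtain ⟨e, he⟩ := exists_mach_eq (oneStepMachine 2)
  refine ⟨Nat.pair 0 e, ?_⟩
  rw [he]
  rintro ⟨α, hα⟩
  rw [Machine.haltedAt] at hα
  by_cases h : α = 0
  · rw [h, oneStepMachine_state_zero] at hα
    exact absurd hα (by decide : (0 : Fin 3) ≠ 2)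
  · rw [oneStepMachine_state _ h] at hα
    exact absurd hα (by decide : (1 : Fin 3) ≠ 2)

theorem omega0_lt_type_haltingOrder : ω < type haltingOrder := by
  obtain ⟨e₀, he₀⟩ := exists_mach_eq (oneStepMachine 0)
  obtain ⟨e₁, he₁⟩ := exists_mach_eq (oneStepMachine 1)
  have h0 : ∀ d, (mach (Nat.pair d e₀)).haltedAt zeroR 0 := fun d => by
    rw [he₀]
    exact oneStepMachine_state_zero 0
  have h0' : ∀ d, haltTime (Nat.pair d e₀) = 0 := fun d =>
    nonpos_iff_eq_zero.1 (haltTime_le (h0 d))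
  have h1 : (mach (Nat.pair 0 e₁)).haltedAt zeroR 1 := by
    rw [he₁]
    exact oneStepMachine_state 1 one_ne_zero
  have h1' : haltTime (Nat.pair 0 e₁) ≠ 0 := fun h => by
    have h2 := haltedAt_haltTime h1
    rw [h, he₁, Machine.haltedAt, oneStepMachine_state_zero] at h2
    exact absurd h2 (by decide : (0 : Fin 3) ≠ 1)
  refine lt_of_le_of_lt ?_ (typein_lt_type haltingOrder ⟨Nat.pair 0 e₁, _, h1⟩)
  rw [← type_subrel, ← type_nat_lt]
  refine RelEmbedding.ordinal_type_le (RelEmbedding.ofMonotone (fun d => ⟨⟨Nat.pair d e₀, _, h0 d⟩,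
    ⟨_, h0 d⟩, ⟨_, h1⟩, Or.inl ?_⟩) fun a b hab => ⟨⟨_, h0 a⟩, ⟨_, h0 b⟩, Or.inr ⟨?_, ?_⟩⟩)
  · rw [h0']
    exact pos_iff_ne_zero.2 h1'
  · exact (h0' a).trans (h0' b).symm
  · exact Nat.pair_lt_pair_left _ hab

theorem isSuccLimit_type_haltingOrder : Order.IsSuccLimit (type haltingOrder) := by
  rw [isSuccLimit_iff, Order.isSuccPrelimit_iff_succ_lt]
  refine ⟨(omega0_pos.trans omega0_lt_type_haltingOrder).ne', fun a ha => ?_⟩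
  obtain ⟨⟨k, hk⟩, rfl⟩ := typein_surj haltingOrder ha
  obtain ⟨k', hk'⟩ := exists_haltsEarlier hk
  refine lt_of_le_of_lt ?_ (typein_lt_type haltingOrder ⟨k', hk'.2.1⟩)
  exact Order.succ_le_of_lt ((typein_lt_typein haltingOrder).2 hk')

theorem eventuallyWritableOrdinal_type_haltingOrder :
    EventuallyWritableOrdinal (type haltingOrder) := by
  obtain ⟨p, hp⟩ := exists_not_halts
  refine ⟨segmentReal p, eventuallyWritableReal_segmentReal hp,
    codesOrdinal_of_rel_iff (s := haltingSet) (r := HaltsEarlier)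
      (hr := inferInstanceAs (IsWellOrder haltingSet haltingOrder)) (fun n k => ?_) ?_⟩
  · rw [rel_segmentReal_iff]
    exact ⟨fun h => ⟨h.1.1, h.1.2.1, h.1⟩, fun h => ⟨h.2.2, fun h2 => absurd h2 hp⟩⟩
  · intro a ha
    obtain ⟨k', hk'⟩ := exists_haltsEarlier ha
    refine ⟨k', hk'.2.1, ?_⟩
    rintro rfl
    rcases hk'.2.2 with h | h
    · exact h.false
    · exact h.2.false

theorem type_clockable_le : type ((· < ·) : {o : Ordinal.{0} // Clockable o} →
    {o : Ordinal.{0} // Clockable o} → Prop) ≤ lift.{1} (type haltingOrder) := by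
  have key : ∀ o : {o : Ordinal.{0} // Clockable o}, ∃ k, (mach k).halts zeroR ∧ haltTime k = o := by
    rintro ⟨o, M, hM⟩
    obtain ⟨e, he⟩ := exists_mach_eq M
    rw [← he 0] at hM
    exact ⟨_, ⟨_, hM.1⟩, haltTime_eq hM⟩
  choose f h1 h2 using key
  have := lift_type_le.{1, 0, 0}.2 ⟨(RelEmbedding.ofMonotone
    (r := ((· < ·) : {o : Ordinal.{0} // Clockable o} → {o : Ordinal.{0} // Clockable o} → Prop))
    (s := haltingOrder) (fun o => ⟨f o, h1 o⟩)
    fun a b hab => ⟨h1 a, h1 b, Or.inl (by rw [h2, h2]; exact hab)⟩).collapse⟩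
  rwa [lift_id'] at this

theorem wellFounded_topRel (h : codesWellOrder (writtenReal p)) : WellFounded (TopRel p) := by
  have hrel : WellFounded (rel (writtenReal p)) := by
    have hw : WellFounded (relOn (writtenReal p)) := h.wf
    refine ⟨fun a => ⟨a, fun b hb => ?_⟩⟩
    have hacc : ∀ c : field (writtenReal p), Acc (rel (writtenReal p)) c := by
      intro c
      induction c using hw.induction with
      | _ c ih => exact ⟨_, fun d hd => ih ⟨d, c, Or.inl hd⟩ hd⟩
    exact hacc ⟨b, a, Or.inl hb⟩
  have hsucc : ∀ a, Acc (TopRel p) (a + 1) := by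
    intro a
    induction a using hrel.induction with
    | _ a ih =>
      refine ⟨_, fun b hb => ?_⟩
      obtain ⟨hb, h0 | h0⟩ := hb
      · omega
      · obtain ⟨b, rfl⟩ := Nat.exists_eq_succ_of_ne_zero hb
        exact ih b h0
  refine ⟨fun a => ⟨a, fun b hb => ?_⟩⟩
  obtain ⟨b, rfl⟩ := Nat.exists_eq_succ_of_ne_zero hb.1
  exact hsucc b

theorem WritableOrdinal.lift_lt_type_clockable {β : Ordinal.{0}} (h : WritableOrdinal β) :
    lift.{1} β < type ((· < ·) : {o : Ordinal.{0} // Clockable o} →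
      {o : Ordinal.{0} // Clockable o} → Prop) := by
  obtain ⟨x, ⟨M, s, hs, rfl⟩, hw, rfl⟩ := h
  obtain ⟨e, he⟩ := exists_mach_eq M
  have he := he 0
  subst he
  obtain rfl := haltTime_eq hs
  change codesWellOrder (writtenReal _) at hw
  obtain ⟨f, hf⟩ := exists_strictMono_clockable ⟨_, hs.1⟩ (wellFounded_topRel hw)
  have : IsWellOrder _ (relOn (writtenReal (Nat.pair 0 e))) := hw
  refine lt_of_le_of_lt ?_ (typein_lt_type (· < ·) (f 0))
  rw [← type_subrel]
  have := lift_type_le.{0, 1, 0}.2 ⟨(RelEmbedding.ofMonotone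
    (r := relOn (writtenReal (Nat.pair 0 e)))
    (s := Subrel ((· < ·) : {o : Ordinal.{0} // Clockable o} → {o : Ordinal.{0} // Clockable o} →
      Prop) fun x => x < f 0)
    (fun a => ⟨f (a + 1), hf _ _ ⟨by omega, Or.inl rfl⟩⟩)
    fun a b hab => hf _ _ ⟨by omega, Or.inr hab⟩).collapse⟩
  rwa [lift_id'] at this

theorem not_clockable_of_omega0_lt {α : Ordinal.{0}} (hl : Order.IsSuccLimit α) (h : ω < α) :
    ¬Clockable α := by
  rintro ⟨M, h1, h2⟩
  refine h2 ω h ?_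
  rw [Machine.haltedAt, Machine.snap_limit _ _ hl] at h1
  rw [Machine.haltedAt, Machine.snap_limit _ _ isSuccLimit_omega0]
  exact h1

theorem WritableOrdinal.lt_type_haltingOrder {β : Ordinal.{0}} (h : WritableOrdinal β) :
    β < type haltingOrder :=
  lift_lt.1 (h.lift_lt_type_clockable.trans_le type_clockable_le)

theorem writableOrdinal_add_two {β : Ordinal.{0}} (h : β < type haltingOrder) :
    WritableOrdinal (β + 1 + 1) := by
  refine writableOrdinal_of_lt_type (isSuccLimit_type_haltingOrder.add_one_lt
    (isSuccLimit_type_haltingOrder.add_one_lt h)) fun h1 => ?_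
  have h2 : (1 : Ordinal.{0}) < β + 1 + 1 := Order.lt_add_one_iff.2 le_add_self
  exact h2.ne' h1

theorem sSup_writableOrdinal : sSup {α | WritableOrdinal α} = type haltingOrder := by
  refine csSup_eq_of_forall_le_of_forall_lt_exists_gt ⟨_, writableOrdinal_add_two
    isSuccLimit_type_haltingOrder.pos⟩ (fun a ha => ha.lt_type_haltingOrder.le) fun w hw => ?_
  exact ⟨_, writableOrdinal_add_two hw, (Order.lt_add_one_iff.2 le_rfl).trans
    (Order.lt_add_one_iff.2 le_rfl)⟩

theorem type_clockable : type ((· < ·) : {o : Ordinal.{0} // Clockable o} →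
    {o : Ordinal.{0} // Clockable o} → Prop) = lift.{1} (type haltingOrder) := by
  refine type_clockable_le.antisymm (le_of_forall_lt fun c hc => ?_)
  obtain ⟨β, hβ, rfl⟩ := lt_lift_iff.1 hc
  refine lt_of_le_of_lt ?_ (writableOrdinal_add_two hβ).lift_lt_type_clockable
  rw [lift_le]
  exact le_self_add.trans le_self_add

theorem type_writable : type ((· < ·) : {o : Ordinal.{0} // WritableOrdinal o} →
    {o : Ordinal.{0} // WritableOrdinal o} → Prop) = lift.{1} (type haltingOrder) := by
  rw [← type_lt_Iio]
  have hl := isSuccLimit_type_haltingOrder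
  have h0 : WritableOrdinal 0 := writableOrdinal_of_lt_type hl.pos zero_ne_one
  have hW : ∀ β < type haltingOrder, β ≠ 0 → WritableOrdinal (β + 1) := by
    intro β hβ hne
    refine writableOrdinal_of_lt_type (hl.add_one_lt hβ) fun h => hne ?_
    exact Order.succ_injective (by rw [Order.succ_eq_add_one, h]; simp)
  refine le_antisymm ?_ ?_
  · exact RelEmbedding.ordinal_type_le (RelEmbedding.ofMonotone
      (fun a => ⟨a.1, a.2.lt_type_haltingOrder⟩) fun a b hab => hab)
  · refine RelEmbedding.ordinal_type_le (RelEmbedding.ofMonotone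
      (fun a => if h : a.1 = 0 then ⟨0, h0⟩ else ⟨a.1 + 1, hW _ a.2 h⟩) fun a b hab => ?_)
    have hb : b.1 ≠ 0 := (pos_of_gt (a := a.1) hab).ne'
    rw [dif_neg hb]
    split_ifs with ha
    · exact (Order.lt_add_one_iff.2 (zero_le (a := b.1)))
    · exact (Order.lt_add_one_iff.2 (Order.add_one_le_of_lt (x := a.1) (y := b.1) hab))

end

end ITTM

/-- **Order-type Theorem.** Let `λ` be the supremum of the writable ordinals.
Then the order type of the class of clockable ordinals equals the order type
of the class of writable ordinals, and both equal `λ`; moreover `λ` is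
neither clockable nor writable, but it is eventually writable. (The order
types, being order types of sets of ordinals, live one universe up, whence
the `lift`.) -/
theorem order_type_theorem (lam : Ordinal)
    (hlam : lam = sSup {α : Ordinal | ITTM.WritableOrdinal α}) :
    Ordinal.type
        ((· < ·) : {o : Ordinal // ITTM.Clockable o} → {o : Ordinal // ITTM.Clockable o} → Prop)
      = Ordinal.lift.{1} lam ∧
    Ordinal.type
        ((· < ·) : {o : Ordinal // ITTM.WritableOrdinal o} →
          {o : Ordinal // ITTM.WritableOrdinal o} → Prop)
      = Ordinal.lift.{1} lam ∧
    ¬ ITTM.Clockable lam ∧ ¬ ITTM.WritableOrdinal lam ∧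
    ITTM.EventuallyWritableOrdinal lam := by
  subst hlam
  rw [ITTM.sSup_writableOrdinal]
  exact ⟨ITTM.type_clockable, ITTM.type_writable,
    ITTM.not_clockable_of_omega0_lt ITTM.isSuccLimit_type_haltingOrder
      ITTM.omega0_lt_type_haltingOrder,
    fun h => h.lt_type_haltingOrder.false, ITTM.eventuallyWritableOrdinal_type_haltingOrder⟩
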